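/- Propagation of largeness toward the boundary (claim in the proof of Lemma 3.2): Let α∈(1/2,1) and K>0. There exist constants C₀>0, β>1 and r₀∈(0,1) depending only on n, λ, Λ, α and K such that the following holds, with γ=β(1−1/α) and f(r)=exp(C₀ r^γ). Assume [g]_{C^{α,α/(1+α)}} ≤ K, and let u be a positive solution of u_t = Lu in 𝒞₁ vanishing continuously on Γ with u(Ē)=1. If 0<r≤r₀ and (y,t_y)∈𝒞_{1/2} satisfies u(y,t_y) ≥ f(r), then there exists (z,t_z) with z'−y'∈(−r,r)^{n−1}, t_z∈(t_y−r,t_y], 0<h_Γ(z,t_z)<r^β, and u(z,t_z) ≥ f(r/2), where h_Γ(x,t)=x_n−g(x',t). -/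

import Mathlib

noncomputable section
open scoped BigOperators
open Classical

abbrev Spc (m : ℕ) := EuclideanSpace ℝ (Fin (m + 1))
abbrev Spc' (m : ℕ) := EuclideanSpace ℝ (Fin m)

/-- The horizontal coordinates `x' ∈ ℝ^{n-1}` of a point `x ∈ ℝⁿ`. -/
def xprime {m : ℕ} (x : Spc m) : Spc' m :=
  (WithLp.equiv 2 _).symm fun i => x i.castSucc

/-- The last (vertical) coordinate `x_n` of a point `x ∈ ℝⁿ`. -/
def xlast {m : ℕ} (x : Spc m) : ℝ := x (Fin.last m)

/-- Build a point of `ℝⁿ` from `x' ∈ ℝ^{n-1}` and the vertical coordinate. -/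
def mkPt {m : ℕ} (x' : Spc' m) (xn : ℝ) : Spc m :=
  (WithLp.equiv 2 _).symm fun i => if h : i = Fin.last m then xn else x' (i.castPred h)

/-- The `i`-th standard basis vector. -/
def eVec (m : ℕ) (i : Fin (m + 1)) : Spc m := EuclideanSpace.single i 1

/-- The entry `∂²u/∂xᵢ∂xⱼ` of the spatial Hessian of `u(x,t)` at `p = (x,t)`. -/
def sHess {m : ℕ} (u : Spc m × ℝ → ℝ) (p : Spc m × ℝ) (i j : Fin (m + 1)) : ℝ :=
  fderiv ℝ (fun y => fderiv ℝ (fun z => u (z, p.2)) y (eVec m j)) p.1 (eVec m i)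

/-- The operator `Lu = tr(A(x) D²ₓu)` at the point `p = (x,t)`. -/
def Lop {m : ℕ} (A : Spc m → Matrix (Fin (m + 1)) (Fin (m + 1)) ℝ)
    (u : Spc m × ℝ → ℝ) (p : Spc m × ℝ) : ℝ :=
  ∑ i, ∑ j, A p.1 i j * sHess u p j i

/-- Uniform ellipticity with symmetric coefficients: `λ|ξ|² ≤ ξ·A(x)ξ ≤ Λ|ξ|²`. -/
def IsElliptic {m : ℕ} (lam Lam : ℝ)
    (A : Spc m → Matrix (Fin (m + 1)) (Fin (m + 1)) ℝ) : Prop :=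
  (∀ x, (A x).IsSymm) ∧
  ∀ (x ξ : Spc m),
    lam * ‖ξ‖ ^ 2 ≤ ∑ i, ∑ j, ξ i * A x i j * ξ j ∧
      ∑ i, ∑ j, ξ i * A x i j * ξ j ≤ Lam * ‖ξ‖ ^ 2

/-- `u` is (pointwise) a solution of `u_t = Lu` on `Ω`: twice continuously
differentiable in `x`, differentiable in `t`, with `∂ₜu = tr(A(x)D²ₓu)`. -/
def SolvesL {m : ℕ} (A : Spc m → Matrix (Fin (m + 1)) (Fin (m + 1)) ℝ)
    (u : Spc m × ℝ → ℝ) (Ω : Set (Spc m × ℝ)) : Prop :=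
  ∀ p ∈ Ω, ContDiffAt ℝ 2 (fun y => u (y, p.2)) p.1 ∧
    HasDerivAt (fun s => u (p.1, s)) (Lop A u p) p.2

/-- `u` is a pointwise subsolution: `u_t ≤ Lu` on `Ω`. -/
def SubSolvesL {m : ℕ} (A : Spc m → Matrix (Fin (m + 1)) (Fin (m + 1)) ℝ)
    (u : Spc m × ℝ → ℝ) (Ω : Set (Spc m × ℝ)) : Prop :=
  ∀ p ∈ Ω, ContDiffAt ℝ 2 (fun y => u (y, p.2)) p.1 ∧
    DifferentiableAt ℝ (fun s => u (p.1, s)) p.2 ∧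
    deriv (fun s => u (p.1, s)) p.2 ≤ Lop A u p

/-- `u` solves the heat equation `∂ₜu = Δu` on `Ω`. -/
def SolvesHeat {m : ℕ} (u : Spc m × ℝ → ℝ) (Ω : Set (Spc m × ℝ)) : Prop :=
  ∀ p ∈ Ω, ContDiffAt ℝ 2 (fun y => u (y, p.2)) p.1 ∧
    HasDerivAt (fun s => u (p.1, s)) (∑ i, sHess u p i i) p.2

/-- The graph `Γ = {x_n = g(x',t)}`. -/
def graphSet {m : ℕ} (g : Spc' m → ℝ → ℝ) : Set (Spc m × ℝ) :=
  {p | xlast p.1 = g (xprime p.1) p.2}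

/-- The cylinder `𝒞_r` of size `r` on top of the graph of `g`. -/
def Cyl {m : ℕ} (g : Spc' m → ℝ → ℝ) (r : ℝ) : Set (Spc m × ℝ) :=
  {p | ‖xprime p.1‖ < r ∧ -r ^ 2 < p.2 ∧ p.2 < r ^ 2 ∧
    g (xprime p.1) p.2 < xlast p.1 ∧ xlast p.1 < g (xprime p.1) p.2 + r}

/-- The point `Ē = ((0', g(0',1/2) + 1/2), 1/2)`. -/
def Ebar {m : ℕ} (g : Spc' m → ℝ → ℝ) : Spc m × ℝ := (mkPt 0 (g 0 (1 / 2) + 1 / 2), 1 / 2)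

/-- The point `E̲ = ((0', g(0',−1/2) + 1/2), −1/2)`. -/
def Eund {m : ℕ} (g : Spc' m → ℝ → ℝ) : Spc m × ℝ := (mkPt 0 (g 0 (-(1 / 2)) + 1 / 2), -(1 / 2))

/-- `u` vanishes continuously on `Γ`: `u(Q) → 0` as `Q → P` within `Ω`,
for every `P ∈ Γ` in the closure of `Ω`. -/
def VanishesOn {m : ℕ} (u : Spc m × ℝ → ℝ) (Ω Γ : Set (Spc m × ℝ)) : Prop :=
  ∀ P ∈ Γ ∩ closure Ω, Filter.Tendsto u (nhdsWithin P Ω) (nhds 0)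

/-- `[g]_{C^{α,β}} ≤ K`. -/
def HolderSemi {m : ℕ} (α β K : ℝ) (g : Spc' m → ℝ → ℝ) : Prop :=
  ∀ x' y' t s, |g x' t - g y' s| ≤ K * (‖x' - y'‖ ^ α + |t - s| ^ β)

/-- The backward-in-time cylinder `𝒞_r^−` (Lipschitz setting, parabolic scaling). -/
def CylB {m : ℕ} (g : Spc' m → ℝ → ℝ) (r : ℝ) : Set (Spc m × ℝ) :=
  {p | (∀ i : Fin m, -r < xprime p.1 i ∧ xprime p.1 i < r) ∧ -r ^ 2 < p.2 ∧ p.2 ≤ 0 ∧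
    g (xprime p.1) p.2 < xlast p.1 ∧ xlast p.1 < g (xprime p.1) p.2 + r}

/-- The set `𝒜_r` of points of `𝒞_r^−` at height at least `δr` above `Γ`. -/
def ASet {m : ℕ} (g : Spc' m → ℝ → ℝ) (δ r : ℝ) : Set (Spc m × ℝ) :=
  {p ∈ CylB g r | g (xprime p.1) p.2 + δ * r ≤ xlast p.1}

/-- The backward-in-time cylinder `𝒞_r^−` (Hölder setting, time interval `(−r,0]`). -/
def CylBH {m : ℕ} (g : Spc' m → ℝ → ℝ) (r : ℝ) : Set (Spc m × ℝ) :=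
  {p | (∀ i : Fin m, -r < xprime p.1 i ∧ xprime p.1 i < r) ∧ -r < p.2 ∧ p.2 ≤ 0 ∧
    g (xprime p.1) p.2 < xlast p.1 ∧ xlast p.1 < g (xprime p.1) p.2 + r}

/-- The set `𝒜_r` of points of the Hölder cylinder `𝒞_r^−` at height at least `r^β` above `Γ`. -/
def ASetH {m : ℕ} (g : Spc' m → ℝ → ℝ) (β r : ℝ) : Set (Spc m × ℝ) :=
  {p ∈ CylBH g r | g (xprime p.1) p.2 + r ^ β ≤ xlast p.1}

/-- The height `h_Γ(x,t) = x_n − g(x',t)` above the graph. -/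
def hGamma {m : ℕ} (g : Spc' m → ℝ → ℝ) (p : Spc m × ℝ) : ℝ :=
  xlast p.1 - g (xprime p.1) p.2

section

open Set Filter Topology MeasureTheory

/-- `w` is a pointwise supersolution at `p`: it has a second order superjet at `p` which is a
supersolution for some constant coefficient operator with ellipticity `lam, Lam`. -/
def SupAt {m : ℕ} (lam Lam : ℝ) (w : Spc m × ℝ → ℝ) (p : Spc m × ℝ) : Prop :=
  ∃ (e : OrthonormalBasis (Fin (m + 1)) ℝ (Spc m)) (μ : Fin (m + 1) → ℝ)
    (q : Spc m →L[ℝ] ℝ) (H : Spc m →L[ℝ] Spc m →L[ℝ] ℝ) (b : ℝ),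
    (∀ k, lam ≤ μ k ∧ μ k ≤ Lam) ∧ (∑ k, μ k * H (e k) (e k) ≤ b) ∧
    (∀ ε > 0, ∀ᶠ h in 𝓝 (0 : Spc m),
      w (p.1 + h, p.2) ≤ w p + q h + H h h / 2 + ε * ‖h‖ ^ 2) ∧
    (∀ ε > 0, ∀ᶠ s in 𝓝[>] (0 : ℝ), w (p.1, p.2 - s) ≤ w p - b * s + ε * s)

lemma SupAt.const {m : ℕ} {lam Lam : ℝ} (h : lam ≤ Lam) (c : ℝ) (p : Spc m × ℝ) :
    SupAt lam Lam (fun _ => c) p := by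
  refine ⟨stdOrthonormalBasis ℝ _ |>.reindex (finCongr (by simp)), fun _ => lam, 0, 0, 0,
    fun _ => ⟨le_rfl, h⟩, by simp, ?_, ?_⟩
  · intro ε hε
    refine Eventually.of_forall fun h => ?_
    simp; positivity
  · intro ε hε
    filter_upwards [self_mem_nhdsWithin] with s hs
    have : 0 < s := hs
    simp; positivity

lemma SupAt.mono {m : ℕ} {lam Lam : ℝ} {w w' : Spc m × ℝ → ℝ} {p : Spc m × ℝ}
    (h : SupAt lam Lam w p) (hp : w' p = w p) (hle : ∀ᶠ z in 𝓝 p, w' z ≤ w z) :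
    SupAt lam Lam w' p := by
  obtain ⟨e, μ, q, H, b, h1, h2, h3, h4⟩ := h
  refine ⟨e, μ, q, H, b, h1, h2, ?_, ?_⟩
  · intro ε hε
    have hc : Tendsto (fun h : Spc m => ((p.1 + h, p.2) : Spc m × ℝ)) (𝓝 0) (𝓝 p) := by
      have : Continuous (fun h : Spc m => ((p.1 + h, p.2) : Spc m × ℝ)) := by fun_prop
      simpa using this.tendsto 0
    filter_upwards [h3 ε hε, hc.eventually hle] with h ha hb
    rw [hp]; exact hb.trans ha
  · intro ε hε
    have hc : Tendsto (fun s : ℝ => ((p.1, p.2 - s) : Spc m × ℝ)) (𝓝[>] 0) (𝓝 p) := by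
      have : Continuous (fun s : ℝ => ((p.1, p.2 - s) : Spc m × ℝ)) := by fun_prop
      have := this.tendsto 0
      simp only [sub_zero] at this
      exact this.mono_left nhdsWithin_le_nhds
    filter_upwards [h4 ε hε, hc.eventually hle] with h ha hb
    rw [hp]; exact hb.trans ha

lemma SupAt.affine {m : ℕ} {lam Lam : ℝ} {w : Spc m × ℝ → ℝ} {p : Spc m × ℝ}
    (h : SupAt lam Lam w p) {c : ℝ} (hc : 0 < c) (d : ℝ) :
    SupAt lam Lam (fun z => c * w z + d) p := by
  obtain ⟨e, μ, q, H, b, h1, h2, h3, h4⟩ := h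
  refine ⟨e, μ, c • q, c • H, c * b, h1, ?_, ?_, ?_⟩
  · have : ∑ k, μ k * (c • H) (e k) (e k) = c * ∑ k, μ k * H (e k) (e k) := by
      rw [Finset.mul_sum]; refine Finset.sum_congr rfl fun k _ => ?_
      simp; ring
    rw [this]; gcongr
  · intro ε hε
    filter_upwards [h3 (ε / c) (by positivity)] with h ha
    have := mul_le_mul_of_nonneg_left ha hc.le
    have e1 : c * (ε / c * ‖h‖ ^ 2) = ε * ‖h‖ ^ 2 := by field_simp
    simp only [smul_apply, smul_eq_mul]
    nlinarith
  · intro ε hε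
    filter_upwards [h4 (ε / c) (by positivity)] with h ha
    have := mul_le_mul_of_nonneg_left ha hc.le
    have e1 : c * (ε / c * h) = ε * h := by field_simp
    nlinarith

/-- The parabolic scaling centred at `P` with ratio `r`. -/
def pscale {m : ℕ} (P : Spc m × ℝ) (r : ℝ) (z : Spc m × ℝ) : Spc m × ℝ :=
  (P.1 + r • z.1, P.2 + r ^ 2 * z.2)

lemma continuous_pscale {m : ℕ} (P : Spc m × ℝ) (r : ℝ) : Continuous (pscale P r) := by
  unfold pscale; fun_prop

lemma SupAt.pscale {m : ℕ} {lam Lam : ℝ} {w : Spc m × ℝ → ℝ} {P z : Spc m × ℝ} {r : ℝ}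
    (hr : 0 < r) (h : SupAt lam Lam w (pscale P r z)) :
    SupAt lam Lam (fun z => w (_root_.pscale P r z)) z := by
  obtain ⟨e, μ, q, H, b, h1, h2, h3, h4⟩ := h
  refine ⟨e, μ, r • q, r ^ 2 • H, r ^ 2 * b, h1, ?_, ?_, ?_⟩
  · have : ∑ k, μ k * (r ^ 2 • H) (e k) (e k) = r ^ 2 * ∑ k, μ k * H (e k) (e k) := by
      rw [Finset.mul_sum]; refine Finset.sum_congr rfl fun k _ => ?_
      simp; ring
    rw [this]; gcongr
  · intro ε hε
    have hc : Tendsto (fun h : Spc m => r • h) (𝓝 0) (𝓝 0) := by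
      have : Continuous (fun h : Spc m => r • h) := by fun_prop
      simpa using this.tendsto 0
    filter_upwards [hc.eventually (h3 (ε / r ^ 2) (by positivity))] with h ha
    simp only [_root_.pscale, smul_add, ← add_assoc] at ha ⊢
    refine ha.trans (le_of_eq ?_)
    simp only [map_smul, smul_apply, smul_eq_mul, norm_smul, Real.norm_eq_abs,
      mul_pow, sq_abs]
    field_simp
  · intro ε hε
    have hc : Tendsto (fun s : ℝ => r ^ 2 * s) (𝓝[>] 0) (𝓝[>] 0) := by
      refine tendsto_nhdsWithin_iff.2 ⟨?_, ?_⟩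
      · have : Continuous (fun s : ℝ => r ^ 2 * s) := by fun_prop
        have := this.tendsto 0
        simp only [mul_zero] at this
        exact this.mono_left nhdsWithin_le_nhds
      · filter_upwards [self_mem_nhdsWithin] with s hs
        have : 0 < s := hs
        show 0 < r ^ 2 * s
        positivity
    filter_upwards [hc.eventually (h4 (ε / r ^ 2) (by positivity))] with h ha
    simp only [_root_.pscale, mul_sub, ← add_sub_assoc] at ha ⊢
    refine ha.trans (le_of_eq ?_)
    field_simp

lemma zero_and_nonneg_of_eventually_nonneg {a b : ℝ}
    (h : ∀ ε > 0, ∀ᶠ s in 𝓝 (0 : ℝ), 0 ≤ s * a + s ^ 2 * b + ε * s ^ 2) : a = 0 ∧ 0 ≤ b := by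
  have key : ∀ a : ℝ, (∀ ε > 0, ∀ᶠ s in 𝓝 (0 : ℝ), 0 ≤ s * a + s ^ 2 * b + ε * s ^ 2) →
      0 ≤ a := by
    intro a h
    have h1 : ∀ᶠ s in 𝓝[>] (0 : ℝ), 0 ≤ a + s * (b + 1) := by
      filter_upwards [nhdsWithin_le_nhds (h 1 one_pos), self_mem_nhdsWithin] with s hs hs0
      have hs0 : 0 < s := hs0
      have : 0 ≤ s * (a + s * (b + 1)) := by
        have e1 : s * (a + s * (b + 1)) = s * a + s ^ 2 * b + 1 * s ^ 2 := by ring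
        rw [e1]; exact hs
      exact nonneg_of_mul_nonneg_right this hs0
    have h2 : Tendsto (fun s : ℝ => a + s * (b + 1)) (𝓝[>] 0) (𝓝 a) := by
      have : Continuous (fun s : ℝ => a + s * (b + 1)) := by fun_prop
      have := this.tendsto 0
      simp only [zero_mul, add_zero] at this
      exact this.mono_left nhdsWithin_le_nhds
    exact ge_of_tendsto h2 h1
  have ha := key a h
  have ha' : 0 ≤ -a := by
    refine key (-a) fun ε hε => ?_
    have hc : Tendsto (fun s : ℝ => -s) (𝓝 0) (𝓝 0) := by
      simpa using (continuous_neg.tendsto (0 : ℝ))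
    filter_upwards [hc.eventually (h ε hε)] with s hs
    have e1 : s * -a + s ^ 2 * b + ε * s ^ 2 = -s * a + (-s) ^ 2 * b + ε * (-s) ^ 2 := by ring
    rw [e1]; exact hs
  have ha0 : a = 0 := by linarith
  refine ⟨ha0, ?_⟩
  refine le_of_forall_pos_le_add fun ε hε => ?_
  have h1 : ∀ᶠ s in 𝓝[>] (0 : ℝ), 0 ≤ b + ε := by
    filter_upwards [nhdsWithin_le_nhds (h ε hε), self_mem_nhdsWithin] with s hs hs0
    have hs0 : 0 < s := hs0
    rw [ha0] at hs
    have : 0 ≤ s ^ 2 * (b + ε) := by linarith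
    exact nonneg_of_mul_nonneg_right this (by positivity)
  obtain ⟨s, hs⟩ := h1.exists
  exact hs

lemma le_of_eventually_mul_le {b c : ℝ}
    (h : ∀ ε > 0, ∀ᶠ s in 𝓝[>] (0 : ℝ), b * s ≤ c * s + ε * s) : b ≤ c := by
  refine le_of_forall_pos_le_add fun ε hε => ?_
  have h1 : ∀ᶠ s in 𝓝[>] (0 : ℝ), b ≤ c + ε := by
    filter_upwards [h ε hε, self_mem_nhdsWithin] with s hs hs0
    have hs0 : 0 < s := hs0
    nlinarith
  obtain ⟨s, hs⟩ := h1.exists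
  exact hs

lemma touch_horizontal {m : ℕ} {w : Spc m × ℝ → ℝ} {p : Spc m × ℝ} {q : Spc m →L[ℝ] ℝ}
    {H : Spc m →L[ℝ] Spc m →L[ℝ] ℝ}
    (h3 : ∀ ε > 0, ∀ᶠ h in 𝓝 (0 : Spc m),
      w (p.1 + h, p.2) ≤ w p + q h + H h h / 2 + ε * ‖h‖ ^ 2)
    {v : Spc m} {A B : ℝ}
    (hx : ∀ ε > 0, ∀ᶠ s in 𝓝 (0 : ℝ),
      w p + s * A + s ^ 2 * B / 2 - ε * s ^ 2 ≤ w (p.1 + s • v, p.2)) :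
    q v = A ∧ B ≤ H v v := by
  have := zero_and_nonneg_of_eventually_nonneg (a := q v - A) (b := (H v v - B) / 2) ?_
  · exact ⟨by linarith [this.1], by linarith [this.2]⟩
  intro ε hε
  have hc : Tendsto (fun s : ℝ => s • v) (𝓝 0) (𝓝 0) := by
    have : Continuous (fun s : ℝ => s • v) := by fun_prop
    simpa using this.tendsto 0
  filter_upwards [hc.eventually (h3 (ε / 2 / (‖v‖ ^ 2 + 1)) (by positivity)),
    hx (ε / 2) (by positivity)] with s h1 h2
  have h4 := h2.trans h1
  simp only [map_smul, smul_apply, smul_eq_mul, norm_smul, Real.norm_eq_abs,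
      mul_pow, sq_abs] at h4
  have h5 : ε / 2 / (‖v‖ ^ 2 + 1) * (s ^ 2 * ‖v‖ ^ 2) ≤ ε / 2 * s ^ 2 := by
    rw [div_mul_eq_mul_div, div_le_iff₀ (by positivity)]
    have : 0 ≤ ε / 2 * s ^ 2 := by positivity
    nlinarith
  nlinarith

lemma touch_vertical {m : ℕ} {w : Spc m × ℝ → ℝ} {p : Spc m × ℝ} {b c : ℝ}
    (h4 : ∀ ε > 0, ∀ᶠ s in 𝓝[>] (0 : ℝ), w (p.1, p.2 - s) ≤ w p - b * s + ε * s)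
    (ht : ∀ ε > 0, ∀ᶠ s in 𝓝[>] (0 : ℝ), w p - c * s - ε * s ≤ w (p.1, p.2 - s)) :
    b ≤ c := by
  refine le_of_eventually_mul_le fun ε hε => ?_
  filter_upwards [h4 (ε / 2) (by positivity), ht (ε / 2) (by positivity)] with s h1 h2
  linarith

/-- A smooth function touching a pointwise supersolution from below is a supersolution there. -/
lemma SupAt.touch {m : ℕ} {lam Lam : ℝ} {w : Spc m × ℝ → ℝ} {p : Spc m × ℝ} (hl : 0 ≤ lam)
    (h : SupAt lam Lam w p) {A B : Spc m → ℝ} {c : ℝ}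
    (hx : ∀ v, ‖v‖ = 1 → ∀ ε > 0, ∀ᶠ s in 𝓝 (0 : ℝ),
      w p + s * A v + s ^ 2 * B v / 2 - ε * s ^ 2 ≤ w (p.1 + s • v, p.2))
    (ht : ∀ ε > 0, ∀ᶠ s in 𝓝[>] (0 : ℝ), w p - c * s - ε * s ≤ w (p.1, p.2 - s)) :
    ∃ (e : OrthonormalBasis (Fin (m + 1)) ℝ (Spc m)) (μ : Fin (m + 1) → ℝ),
      (∀ k, lam ≤ μ k ∧ μ k ≤ Lam) ∧ ∑ k, μ k * B (e k) ≤ c := by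
  obtain ⟨e, μ, q, H, b, h1, h2, h3, h4⟩ := h
  refine ⟨e, μ, h1, ?_⟩
  refine le_trans (Finset.sum_le_sum fun k _ => ?_) (h2.trans (touch_vertical h4 ht))
  exact mul_le_mul_of_nonneg_left (touch_horizontal h3 (hx (e k) (e.orthonormal.1 k))).2
    (hl.trans (h1 k).1)

/-- The open backward parabolic cylinder. -/
def bcyl {m : ℕ} (X : Spc m × ℝ) (r : ℝ) : Set (Spc m × ℝ) :=
  Metric.ball X.1 r ×ˢ Ioo (X.2 - r ^ 2) X.2

/-- The volume of the unit ball. -/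
def unitVol (m : ℕ) : ENNReal := volume (Metric.ball (0 : Spc m) 1)

lemma unitVol_pos (m : ℕ) : 0 < unitVol m := Metric.measure_ball_pos _ _ one_pos
lemma unitVol_lt_top (m : ℕ) : unitVol m < ⊤ := measure_ball_lt_top

lemma isOpen_bcyl {m : ℕ} (X : Spc m × ℝ) (r : ℝ) : IsOpen (bcyl X r) :=
  Metric.isOpen_ball.prod isOpen_Ioo

lemma bcyl_nonempty {m : ℕ} (X : Spc m × ℝ) {r : ℝ} (hr : 0 < r) : (bcyl X r).Nonempty :=
  ⟨(X.1, X.2 - r ^ 2 / 2), by simpa using hr, by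
    have : 0 < r ^ 2 := by positivity
    constructor <;> simp <;> linarith⟩

lemma volume_ball_prod_Ioo {m : ℕ} (x : Spc m) {r : ℝ} (hr : 0 < r) (a b : ℝ) :
    volume (Metric.ball x r ×ˢ Ioo a b) = ENNReal.ofReal (r ^ (m + 1) * (b - a)) * unitVol m := by
  rw [Measure.volume_eq_prod, Measure.prod_prod, Measure.addHaar_ball_of_pos _ _ hr,
    Real.volume_Ioo, ENNReal.ofReal_mul (by positivity)]
  simp only [finrank_euclideanSpace, Fintype.card_fin, unitVol]
  ring

lemma volume_bcyl {m : ℕ} (X : Spc m × ℝ) {r : ℝ} (hr : 0 < r) :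
    volume (bcyl X r) = ENNReal.ofReal (r ^ (m + 3)) * unitVol m := by
  rw [bcyl, volume_ball_prod_Ioo _ hr]
  congr 2
  ring

lemma volume_pscale_preimage {m : ℕ} (P : Spc m × ℝ) {r : ℝ} (hr : 0 < r)
    (S : Set (Spc m × ℝ)) :
    volume (pscale P r ⁻¹' S) = ENNReal.ofReal (r ^ (m + 3))⁻¹ * volume S := by
  have e1 : Measure.map (fun x : Spc m => P.1 + r • x) volume =
      ENNReal.ofReal (r ^ (m + 1))⁻¹ • volume := by
    have : (fun x : Spc m => P.1 + r • x) = (fun x => P.1 + x) ∘ fun x => r • x := rfl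
    rw [this, ← Measure.map_map (by fun_prop) (by fun_prop), Measure.map_addHaar_smul _ hr.ne',
      Measure.map_smul, map_add_left_eq_self]
    simp only [finrank_euclideanSpace, Fintype.card_fin]
    rw [abs_of_pos (by positivity)]
  have e2 : Measure.map (fun x : ℝ => P.2 + r ^ 2 * x) volume =
      ENNReal.ofReal (r ^ 2)⁻¹ • volume := by
    have : (fun x : ℝ => P.2 + r ^ 2 * x) = (fun x => P.2 + x) ∘ fun x => r ^ 2 • x := rfl
    rw [this, ← Measure.map_map (by fun_prop) (by fun_prop),
      Measure.map_addHaar_smul _ (by positivity), Measure.map_smul, map_add_left_eq_self]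
    simp only [Module.finrank_self]
    rw [abs_of_pos (by positivity)]
    simp
  have e3 : Measure.map (pscale P r) volume = ENNReal.ofReal (r ^ (m + 3))⁻¹ • volume := by
    have : pscale P r = Prod.map (fun x : Spc m => P.1 + r • x) (fun x : ℝ => P.2 + r ^ 2 * x) := rfl
    rw [this, Measure.volume_eq_prod, ← Measure.map_prod_map _ _ (by fun_prop) (by fun_prop), e1, e2,
      Measure.prod_smul_left, Measure.prod_smul_right, smul_smul,
      ← ENNReal.ofReal_mul (by positivity)]
    congr 2
    rw [← mul_inv, ← pow_add]
  let f : Spc m × ℝ ≃ₜ Spc m × ℝ :=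
    { toFun := pscale P r
      invFun := fun z => (r⁻¹ • (z.1 - P.1), (r ^ 2)⁻¹ * (z.2 - P.2))
      left_inv := fun z => by
        simp only [pscale, add_sub_cancel_left]
        rw [smul_smul, inv_mul_cancel₀ hr.ne', one_smul, ← mul_assoc,
          inv_mul_cancel₀ (by positivity), one_mul]
      right_inv := fun z => by
        simp only [pscale]
        rw [smul_smul, mul_inv_cancel₀ hr.ne', one_smul, ← mul_assoc,
          mul_inv_cancel₀ (by positivity), one_mul]
        simp
      continuous_toFun := continuous_pscale P r
      continuous_invFun := by fun_prop }
  have e4 : Measure.map f.toMeasurableEquiv volume S = ENNReal.ofReal (r ^ (m + 3))⁻¹ * volume S := by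
    change Measure.map (pscale P r) volume S = _
    rw [e3]; simp
  rw [MeasurableEquiv.map_apply] at e4
  exact e4

lemma exists_parabolic_vitali {m : ℕ} {ι : Type*} (T : Set ι) (X : ι → Spc m × ℝ) (ρ : ι → ℝ)
    (R : ℝ) (hρ : ∀ a ∈ T, 0 < ρ a ∧ ρ a ≤ R) :
    ∃ u ⊆ T, u.Countable ∧ u.PairwiseDisjoint (fun a => bcyl (X a) (ρ a)) ∧
      ∀ a ∈ T, ∃ b ∈ u, ρ a ≤ 2 * ρ b ∧ ‖(X a).1 - (X b).1‖ ≤ 3 * ρ b ∧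
        |(X a).2 - (X b).2| ≤ 5 * ρ b ^ 2 := by
  obtain ⟨u, hu, hd, h⟩ := Vitali.exists_disjoint_subfamily_covering_enlargement
    (fun a => bcyl (X a) (ρ a)) T ρ 2 one_lt_two (fun a ha => (hρ a ha).1.le) R
    (fun a ha => (hρ a ha).2) (fun a ha => bcyl_nonempty _ (hρ a ha).1)
  refine ⟨u, hu, hd.countable_of_isOpen (fun _ _ => isOpen_bcyl _ _)
    (fun a ha => bcyl_nonempty _ (hρ a (hu ha)).1), hd, fun a ha => ?_⟩
  obtain ⟨b, hb, ⟨z, hza, hzb⟩, hle⟩ := h a ha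
  refine ⟨b, hb, hle, ?_, ?_⟩
  · have h1 : dist z.1 (X a).1 < ρ a := hza.1
    have h2 : dist z.1 (X b).1 < ρ b := hzb.1
    rw [← dist_eq_norm]
    have := dist_triangle_left (X a).1 (X b).1 z.1
    linarith
  · have h1 := hza.2
    have h2 := hzb.2
    simp only [mem_Ioo] at h1 h2
    have ha0 := (hρ a ha).1
    have : ρ a ^ 2 ≤ 4 * ρ b ^ 2 := by nlinarith
    rw [abs_le]; constructor <;> nlinarith

/-- The test paraboloid with vertex `y` and height `h`. -/
def para {m : ℕ} (p z : Spc m × ℝ) : ℝ := p.2 + z.2 - 4 * ‖z.1 - p.1‖ ^ 2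

lemma continuous_para {m : ℕ} (p : Spc m × ℝ) : Continuous (para p) := by
  unfold para; fun_prop

/-- `w` touches the paraboloid `para p` from above at `X`, up to time `X.2`, in the unit cylinder. -/
def Contact {m : ℕ} (w : Spc m × ℝ → ℝ) (p X : Spc m × ℝ) : Prop :=
  X.1 ∈ Metric.ball 0 1 ∧ X.2 ∈ Ioc (-1) 0 ∧ w X = para p X ∧
    ∀ z : Spc m × ℝ, z.1 ∈ Metric.closedBall 0 1 → z.2 ∈ Icc (-1) X.2 → para p z ≤ w z

lemma exists_contact {m : ℕ} {w : Spc m × ℝ → ℝ}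
    (hw : ContinuousOn w (Metric.closedBall 0 1 ×ˢ Icc (-1) 0))
    (h0 : ∀ z ∈ Metric.closedBall (0 : Spc m) 1 ×ˢ Icc (-1 : ℝ) 0, 0 ≤ w z) {κ : ℝ} (hκ : 0 < κ)
    (hκ1 : κ < 1) (hw0 : w (0, 0) ≤ 1 - κ) {p : Spc m × ℝ} (hy : ‖p.1‖ < κ / 8)
    (hh : p.2 ∈ Ioo (1 - κ / 2) 1) : ∃ X, Contact w p X := by
  set Q : Set (Spc m × ℝ) := Metric.closedBall 0 1 ×ˢ Icc (-1) 0 with hQ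
  have hQc : IsCompact Q := (isCompact_closedBall _ _).prod isCompact_Icc
  have hcont : ContinuousOn (fun z => w z - para p z) Q := hw.sub (continuous_para p).continuousOn
  set S : Set (Spc m × ℝ) := Q ∩ (fun z => w z - para p z) ⁻¹' Iic 0 with hS
  have hSc : IsCompact S := hQc.of_isClosed_subset
    (hcont.preimage_isClosed_of_isClosed hQc.isClosed isClosed_Iic) inter_subset_left
  have hSne : S.Nonempty := by
    refine ⟨(0, 0), ⟨by simp [hQ], ?_⟩⟩
    simp only [mem_preimage, mem_Iic, para, zero_sub, norm_neg]
    have : ‖p.1‖ ^ 2 ≤ (κ / 8) ^ 2 := by gcongr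
    have := hh.1
    nlinarith
  obtain ⟨X, hXS, hXmin⟩ := hSc.exists_isMinOn hSne (f := fun z => z.2) continuous_snd.continuousOn
  have hXQ := hXS.1
  have hXle : w X ≤ para p X := by have := hXS.2; simp only [mem_preimage, mem_Iic] at this; linarith
  have hXw := h0 X hXQ
  have hX1 : ‖X.1‖ ≤ 1 := by simpa using hXQ.1
  have hX2 := hXQ.2
  have hpos : 0 ≤ para p X := hXw.trans hXle
  have hlt1 : ‖X.1‖ < 1 := by
    refine lt_of_le_of_ne hX1 fun h1 => ?_
    have h2 : (7 : ℝ) / 8 ≤ ‖X.1 - p.1‖ := by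
      have := norm_sub_norm_le X.1 p.1
      linarith
    have h3 : (7 / 8 : ℝ) ^ 2 ≤ ‖X.1 - p.1‖ ^ 2 := by gcongr
    simp only [para] at hpos
    have := hh.2; have := hX2.2
    linarith
  have hgt : -1 < X.2 := by
    refine lt_of_le_of_ne hX2.1 fun h1 => ?_
    simp only [para] at hpos
    have := hh.2
    have : 0 ≤ ‖X.1 - p.1‖ ^ 2 := by positivity
    linarith
  have hbefore : ∀ z ∈ Q, z.2 < X.2 → para p z < w z := by
    intro z hz hlt
    by_contra hcon
    have : z ∈ S := ⟨hz, by simp only [mem_preimage, mem_Iic]; linarith [not_lt.1 hcon]⟩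
    have := hXmin this
    simp only [mem_ofPred_eq] at this
    linarith
  have hle : ∀ z : Spc m × ℝ, z.1 ∈ Metric.closedBall 0 1 → z.2 ∈ Icc (-1) X.2 → para p z ≤ w z := by
    intro z hz1 hz2
    rcases hz2.2.lt_or_eq with hlt | heq
    · exact (hbefore z ⟨hz1, hz2.1, hz2.2.trans hX2.2⟩ hlt).le
    have hzQ : z ∈ Q := ⟨hz1, hz2.1, hz2.2.trans hX2.2⟩
    have hc : Tendsto (fun s : ℝ => ((z.1, z.2 - s) : Spc m × ℝ)) (𝓝[>] 0) (𝓝[Q] z) := by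
      refine tendsto_nhdsWithin_iff.2 ⟨?_, ?_⟩
      · have : Continuous (fun s : ℝ => ((z.1, z.2 - s) : Spc m × ℝ)) := by fun_prop
        have := this.tendsto 0
        simp only [sub_zero] at this
        exact this.mono_left nhdsWithin_le_nhds
      · have : ∀ᶠ s in 𝓝[>] (0 : ℝ), s < z.2 + 1 :=
          nhdsWithin_le_nhds (Iio_mem_nhds (by linarith))
        filter_upwards [this, self_mem_nhdsWithin] with s hs hs0
        have hs0 : 0 < s := hs0
        exact ⟨hz1, by constructor <;> simp <;> linarith [hX2.2]⟩
    have h1 := (hcont z hzQ).tendsto.comp hc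
    have h2 : 0 ≤ w z - para p z := by
      refine ge_of_tendsto h1 ?_
      have h3 := hc.eventually self_mem_nhdsWithin
      filter_upwards [h3, self_mem_nhdsWithin] with s hs hs0
      have hs0 : 0 < s := hs0
      have := hbefore _ hs (by simp; linarith)
      simp only [Function.comp_apply]
      linarith
    linarith
  exact ⟨X, by simpa using hlt1, ⟨hgt, hX2.2⟩,
    le_antisymm hXle (hle X hXQ.1 ⟨hX2.1, le_rfl⟩), hle⟩

lemma quadratic_sum_le {m : ℕ} {N : Spc m → ℝ} (h0 : ∀ v, 0 ≤ N v)
    (hadd : ∀ v w, N (v + w) ≤ 2 * N v + 2 * N w) {ι : Type*} (s : Finset ι) (f : ι → Spc m)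
    (hz : N 0 = 0) : N (∑ i ∈ s, f i) ≤ 2 ^ s.card * ∑ i ∈ s, N (f i) := by
  induction s using Finset.induction_on with
  | empty => simp [hz]
  | insert a s ha ih =>
    rw [Finset.sum_insert ha, Finset.sum_insert ha, Finset.card_insert_of_notMem ha, pow_succ]
    refine (hadd _ _).trans ?_
    have h1 : (1 : ℝ) ≤ 2 ^ s.card := one_le_pow₀ (by norm_num)
    have := h0 (f a)
    nlinarith

lemma contact_expansion {m : ℕ} {lam Lam : ℝ} (hl : 0 < lam) (hL : lam ≤ Lam) :
    ∃ C > 0, ∀ (w : Spc m × ℝ → ℝ) (p X : Spc m × ℝ), SupAt lam Lam w X → Contact w p X →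
      ∃ δ > 0, (∀ v, ‖v‖ < δ →
        w (X.1 + v, X.2) ≤ w X - 8 * inner ℝ (X.1 - p.1) v + C * ‖v‖ ^ 2) ∧
        ∀ s, 0 ≤ s → s < δ → w (X.1, X.2 - s) ≤ w X + C * s := by
  set n : ℝ := (m : ℝ) + 1 with hn
  have hn0 : 0 < n := by positivity
  have hLam : 0 < Lam := hl.trans_le hL
  set M : ℝ := (1 + 8 * (n * Lam)) / lam with hM
  have hM0 : 0 < M := by positivity
  set C : ℝ := 2 ^ (m + 1) * M + 1 + (8 * (n * Lam) + 1) with hC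
  refine ⟨C, by positivity, fun w p X hs hc => ?_⟩
  obtain ⟨e, μ, q, H, b, h1, h2, h3, h4⟩ := hs
  obtain ⟨hX1, hX2, hwX, hle⟩ := hc
  have hX1' : ‖X.1‖ < 1 := by simpa using hX1
  have hpx : ∀ v : Spc m, para p (X.1 + v, X.2) =
      para p X - 8 * inner ℝ (X.1 - p.1) v - 4 * ‖v‖ ^ 2 := by
    intro v
    simp only [para]
    rw [show X.1 + v - p.1 = (X.1 - p.1) + v by abel, norm_add_sq_real]
    ring
  have hqH : ∀ v : Spc m, q v = -8 * inner ℝ (X.1 - p.1) v ∧ -8 * ‖v‖ ^ 2 ≤ H v v := by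
    intro v
    refine touch_horizontal h3 fun ε hε => ?_
    have hev : ∀ᶠ s in 𝓝 (0 : ℝ), X.1 + s • v ∈ Metric.ball (0 : Spc m) 1 := by
      have : Continuous (fun s : ℝ => X.1 + s • v) := by fun_prop
      refine this.continuousAt.eventually_mem (Metric.isOpen_ball.mem_nhds ?_)
      simpa using hX1'
    filter_upwards [hev] with s hs
    have := hle (X.1 + s • v, X.2) (Metric.ball_subset_closedBall hs) ⟨hX2.1.le, le_rfl⟩
    rw [hpx, inner_smul_right, norm_smul, mul_pow, Real.norm_eq_abs, sq_abs] at this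
    have : 0 ≤ ε * s ^ 2 := by positivity
    linarith
  have hb : b ≤ 1 := by
    refine touch_vertical h4 fun ε hε => ?_
    have : ∀ᶠ s in 𝓝[>] (0 : ℝ), s < X.2 + 1 :=
      nhdsWithin_le_nhds (Iio_mem_nhds (by linarith [hX2.1]))
    filter_upwards [this, self_mem_nhdsWithin] with s hs hs0
    have hs0 : 0 < s := hs0
    have := hle (X.1, X.2 - s) (Metric.ball_subset_closedBall hX1) ⟨by simp; linarith, by simp; linarith⟩
    simp only [para] at this hwX
    have : 0 ≤ ε * s := by positivity
    linarith
  set N : Spc m → ℝ := fun v => H v v + 8 * ‖v‖ ^ 2 with hNdef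
  have hN0 : ∀ v, 0 ≤ N v := fun v => by simp only [hNdef]; linarith [(hqH v).2]
  have hNadd : ∀ v w, N (v + w) ≤ 2 * N v + 2 * N w := by
    intro v w
    have h5 := hN0 (v - w)
    have h6 : N (v + w) + N (v - w) = 2 * N v + 2 * N w := by
      simp only [hNdef]
      have := parallelogram_law_with_norm ℝ v w
      simp only [map_add, map_sub, add_apply, sub_apply]
      linarith
    linarith
  have hNsmul : ∀ (c : ℝ) v, N (c • v) = c ^ 2 * N v := by
    intro c v
    simp only [hNdef, map_smul, smul_apply, smul_eq_mul, norm_smul, mul_pow, Real.norm_eq_abs, sq_abs]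
    ring
  have hNsum : ∑ k, N (e k) ≤ M := by
    rw [hM, le_div_iff₀ hl, Finset.sum_mul]
    have h5 : ∀ k ∈ Finset.univ, N (e k) * lam ≤ μ k * H (e k) (e k) + 8 * Lam := by
      intro k _
      have h6 : N (e k) * lam ≤ N (e k) * μ k := mul_le_mul_of_nonneg_left (h1 k).1 (hN0 _)
      have h7 : N (e k) * μ k = μ k * H (e k) (e k) + 8 * μ k := by
        simp only [hNdef, e.orthonormal.1 k]; ring
      have := (h1 k).2
      linarith
    refine (Finset.sum_le_sum h5).trans ?_
    rw [Finset.sum_add_distrib]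
    simp only [Finset.sum_const, Finset.card_univ, Fintype.card_fin, nsmul_eq_mul]
    push_cast
    rw [← hn]
    linarith
  have hHle : ∀ v, H v v ≤ 2 ^ (m + 1) * M * ‖v‖ ^ 2 := by
    intro v
    have h5 : H v v ≤ N v := by
      have : 0 ≤ ‖v‖ ^ 2 := by positivity
      simp only [hNdef]; linarith
    refine h5.trans ?_
    have h6 := quadratic_sum_le hN0 hNadd Finset.univ (fun k => inner ℝ (e k) v • e k)
      (by simp [hNdef])
    rw [e.sum_repr' v] at h6
    refine h6.trans ?_
    rw [Finset.card_univ, Fintype.card_fin, mul_assoc]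
    refine mul_le_mul_of_nonneg_left ?_ (by positivity)
    refine le_trans (Finset.sum_le_sum (g := fun k => N (e k) * ‖v‖ ^ 2) fun k _ => ?_) ?_
    · rw [hNsmul, mul_comm]
      refine mul_le_mul_of_nonneg_left ?_ (hN0 _)
      have := abs_real_inner_le_norm (e k) v
      rw [e.orthonormal.1 k, one_mul] at this
      exact sq_le_sq' (by linarith [neg_abs_le (inner ℝ (e k) v : ℝ)])
        ((le_abs_self _).trans this)
    · rw [← Finset.sum_mul]
      gcongr
  have hb2 : -(8 * (n * Lam)) ≤ b := by
    refine le_trans ?_ h2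
    have h5 : ∀ k ∈ Finset.univ, -(8 * Lam) ≤ μ k * H (e k) (e k) := by
      intro k _
      have h6 := (hqH (e k)).2
      rw [e.orthonormal.1 k] at h6
      have h7 := h1 k
      have h8 : 0 ≤ μ k := hl.le.trans h7.1
      nlinarith
    have h6 := Finset.sum_le_sum h5
    simp only [Finset.sum_const, Finset.card_univ, Fintype.card_fin, nsmul_eq_mul] at h6
    push_cast at h6
    rw [← hn] at h6
    linarith
  obtain ⟨δ₁, hδ₁, h5⟩ := Metric.eventually_nhds_iff.1 (h3 1 one_pos)
  obtain ⟨δ₂, hδ₂, h6⟩ := Metric.eventually_nhds_iff.1 (eventually_nhdsWithin_iff.1 (h4 1 one_pos))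
  refine ⟨min δ₁ δ₂, lt_min hδ₁ hδ₂, fun v hv => ?_, fun s hs hsδ => ?_⟩
  · have h7 := h5 (y := v) (by simpa using hv.trans_le (min_le_left _ _))
    rw [(hqH v).1] at h7
    refine h7.trans ?_
    have h8 := hHle v
    have h9 : 0 ≤ ‖v‖ ^ 2 := by positivity
    have h10 : 0 ≤ 2 ^ (m + 1) * M * ‖v‖ ^ 2 := by positivity
    have h11 : 0 ≤ (8 * (n * Lam) + 1) * ‖v‖ ^ 2 := by positivity
    have h12 : C * ‖v‖ ^ 2 = 2 ^ (m + 1) * M * ‖v‖ ^ 2 + ‖v‖ ^ 2 + (8 * (n * Lam) + 1) * ‖v‖ ^ 2 := by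
      rw [hC]; ring
    linarith
  · rcases hs.eq_or_lt with rfl | hs
    · simp
    have h7 := h6 (y := s) (by simpa [abs_of_pos hs] using hsδ.trans_le (min_le_right _ _)) hs
    refine h7.trans ?_
    have h8 : -b * s ≤ 8 * (n * Lam) * s := by
      apply mul_le_mul_of_nonneg_right _ hs.le; linarith
    have h10 : 0 ≤ 2 ^ (m + 1) * M * s := by positivity
    have h12 : C * s = 2 ^ (m + 1) * M * s + s + (8 * (n * Lam) + 1) * s := by
      rw [hC]; ring
    linarith

/-- Quantitative second order expansion from above at a contact point. -/
def Expands {m : ℕ} (C δ : ℝ) (w : Spc m × ℝ → ℝ) (p X : Spc m × ℝ) : Prop :=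
  (∀ v, ‖v‖ < δ → w (X.1 + v, X.2) ≤ w X - 8 * inner ℝ (X.1 - p.1) v + C * ‖v‖ ^ 2) ∧
    ∀ s, 0 ≤ s → s < δ → w (X.1, X.2 - s) ≤ w X + C * s

/-- The difference of two test paraboloids, an affine function of the space variable. -/
def paraDiff {m : ℕ} (p p' : Spc m × ℝ) (z : Spc m) : ℝ :=
  (p.2 - 4 * ‖z - p.1‖ ^ 2) - (p'.2 - 4 * ‖z - p'.1‖ ^ 2)

lemma paraDiff_sub {m : ℕ} (p p' : Spc m × ℝ) (z x : Spc m) :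
    paraDiff p p' z = paraDiff p p' x + 8 * inner ℝ (p.1 - p'.1) (z - x) := by
  have h : ∀ y : Spc m, ‖z - y‖ ^ 2 = ‖x - y‖ ^ 2 + 2 * inner ℝ (x - y) (z - x) + ‖z - x‖ ^ 2 := by
    intro y
    rw [show z - y = (x - y) + (z - x) by abel, norm_add_sq_real]
  have h2 : inner ℝ (p.1 - p'.1) (z - x) = inner ℝ (x - p'.1) (z - x) - inner ℝ (x - p.1) (z - x) := by
    rw [← inner_sub_left]; congr 1; abel
  simp only [paraDiff]
  rw [h p.1, h p'.1, h2]
  ring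

lemma paraDiff_swap {m : ℕ} (p p' : Spc m × ℝ) (z : Spc m) :
    paraDiff p p' z = -paraDiff p' p z := by
  simp only [paraDiff]; ring

lemma two_contacts_aux {m : ℕ} {C δ ρ : ℝ} (hC : 0 < C) {w : Spc m × ℝ → ℝ}
    {p X p' X' : Spc m × ℝ} (hc : Contact w p X) (hc' : Contact w p' X')
    (he : Expands C δ w p X) (he' : Expands C δ w p' X') (hρ : 0 < ρ) (hρδ : 5 * ρ < δ)
    (hρδ2 : 5 * ρ ^ 2 < δ) (hx : ‖X.1 - X'.1‖ ≤ 3 * ρ) (ht : |X.2 - X'.2| ≤ 5 * ρ ^ 2)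
    (hb : ‖X.1‖ + ρ ≤ 1) (hle : X'.2 ≤ X.2) :
    ‖p.1 - p'.1‖ ≤ 100 * (C + 4) * ρ ∧ |paraDiff p p' X.1| ≤ 100 * (C + 4) * ρ ^ 2 ∧
      |paraDiff p p' X'.1| ≤ 100 * (C + 4) * ρ ^ 2 := by
  have hρ2 : 0 < ρ ^ 2 := by positivity
  have ht' : X.2 - X'.2 ≤ 5 * ρ ^ 2 := (le_abs_self _).trans ht
  have up : ∀ z : Spc m, ‖z‖ ≤ 1 → ‖z - X'.1‖ < δ →
      paraDiff p p' z ≤ (C + 4) * ‖z - X'.1‖ ^ 2 := by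
    intro z hz hzd
    have h1 := hc.2.2.2 (z, X'.2) (by simpa using hz) ⟨hc'.2.1.1.le, hle⟩
    have h2 := he'.1 (z - X'.1) hzd
    rw [add_sub_cancel, hc'.2.2.1] at h2
    have h3 := h1.trans h2
    have h4 : ‖z - p'.1‖ ^ 2 = ‖X'.1 - p'.1‖ ^ 2 + 2 * inner ℝ (X'.1 - p'.1) (z - X'.1) +
        ‖z - X'.1‖ ^ 2 := by
      rw [show z - p'.1 = (X'.1 - p'.1) + (z - X'.1) by abel, norm_add_sq_real]
    simp only [para, paraDiff] at h3 ⊢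
    rw [h4]
    linarith
  have lo : -(5 * (C + 1) * ρ ^ 2) ≤ paraDiff p p' X.1 := by
    have h1 := he.2 (X.2 - X'.2) (by linarith) (by linarith)
    rw [sub_sub_cancel, hc.2.2.1] at h1
    have h2 := hc'.2.2.2 (X.1, X'.2) (Metric.ball_subset_closedBall hc.1) ⟨hc'.2.1.1.le, le_rfl⟩
    have h3 := h2.trans h1
    simp only [para, paraDiff] at h3 ⊢
    have : (C + 1) * (X.2 - X'.2) ≤ (C + 1) * (5 * ρ ^ 2) := by gcongr
    linarith
  have hK : ‖p.1 - p'.1‖ ≤ (21 * C + 69) / 8 * ρ := by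
    rcases eq_or_ne (p.1 - p'.1) 0 with h0 | h0
    · rw [h0, norm_zero]; positivity
    have hn : 0 < ‖p.1 - p'.1‖ := norm_pos_iff.2 h0
    set v : Spc m := (ρ / ‖p.1 - p'.1‖) • (p.1 - p'.1) with hv
    have hvn : ‖v‖ = ρ := by
      rw [hv, norm_smul, Real.norm_of_nonneg (by positivity)]; field_simp
    have hzX : ‖X.1 + v - X'.1‖ ≤ 4 * ρ := by
      rw [show X.1 + v - X'.1 = (X.1 - X'.1) + v by abel]
      have := norm_add_le (X.1 - X'.1) v
      linarith
    have h1 := up (X.1 + v) ((norm_add_le _ _).trans (by linarith)) (by linarith)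
    have h2 : (C + 4) * ‖X.1 + v - X'.1‖ ^ 2 ≤ (C + 4) * (4 * ρ) ^ 2 := by gcongr
    rw [paraDiff_sub p p' (X.1 + v) X.1, add_sub_cancel_left] at h1
    have h3 : inner ℝ (p.1 - p'.1) v = ρ * ‖p.1 - p'.1‖ := by
      rw [hv, inner_smul_right, real_inner_self_eq_norm_sq]; field_simp
    rw [h3] at h1
    have h4 : ρ * (8 * ‖p.1 - p'.1‖) ≤ ρ * ((21 * C + 69) * ρ) := by nlinarith
    have h5 := le_of_mul_le_mul_left h4 hρ
    linarith
  have hX : ‖X.1‖ ≤ 1 := by linarith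
  have hup := up X.1 hX (by linarith)
  have hup2 : (C + 4) * ‖X.1 - X'.1‖ ^ 2 ≤ (C + 4) * (3 * ρ) ^ 2 := by gcongr
  have hCρ : 0 < C * ρ ^ 2 := by positivity
  have hD : |paraDiff p p' X.1| ≤ (9 * C + 36) * ρ ^ 2 := by
    rw [abs_le]; constructor <;> nlinarith
  refine ⟨hK.trans ?_, hD.trans ?_, ?_⟩
  · gcongr; linarith
  · gcongr; linarith
  · rw [paraDiff_sub p p' X'.1 X.1]
    have h1 := abs_real_inner_le_norm (p.1 - p'.1) (X'.1 - X.1)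
    rw [norm_sub_rev X'.1 X.1] at h1
    have h2 : ‖p.1 - p'.1‖ * ‖X.1 - X'.1‖ ≤ (21 * C + 69) / 8 * ρ * (3 * ρ) := by gcongr
    refine (abs_add_le _ _).trans ?_
    rw [abs_mul, abs_of_pos (by norm_num : (0 : ℝ) < 8)]
    nlinarith

lemma two_contacts {m : ℕ} {C δ ρ : ℝ} (hC : 0 < C) {w : Spc m × ℝ → ℝ}
    {p X p' X' : Spc m × ℝ} (hc : Contact w p X) (hc' : Contact w p' X')
    (he : Expands C δ w p X) (he' : Expands C δ w p' X') (hρ : 0 < ρ) (hρδ : 5 * ρ < δ)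
    (hρδ2 : 5 * ρ ^ 2 < δ) (hx : ‖X.1 - X'.1‖ ≤ 3 * ρ) (ht : |X.2 - X'.2| ≤ 5 * ρ ^ 2)
    (hb : ‖X'.1‖ + 4 * ρ ≤ 1) :
    ‖p.1 - p'.1‖ ≤ 100 * (C + 4) * ρ ∧ |paraDiff p p' X'.1| ≤ 100 * (C + 4) * ρ ^ 2 := by
  rcases le_total X'.2 X.2 with h | h
  · have hX : ‖X.1‖ + ρ ≤ 1 := by
      have := norm_le_norm_add_norm_sub' X.1 X'.1
      linarith
    have := two_contacts_aux hC hc hc' he he' hρ hρδ hρδ2 hx ht hX h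
    exact ⟨this.1, this.2.2⟩
  · have := two_contacts_aux hC hc' hc he' he hρ hρδ hρδ2 (by rwa [norm_sub_rev])
      (by rwa [abs_sub_comm]) (by linarith) h
    exact ⟨by rw [norm_sub_rev]; exact this.1, by rw [paraDiff_swap, abs_neg]; exact this.2.1⟩

lemma volume_paraDiff_le {m : ℕ} (p' : Spc m × ℝ) (x : Spc m) {r s : ℝ} (hr : 0 ≤ r) :
    volume {p : Spc m × ℝ | ‖p.1 - p'.1‖ ≤ r ∧ |paraDiff p p' x| ≤ s} ≤
      ENNReal.ofReal (r ^ (m + 1) * (2 * s)) * unitVol m := by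
  set S := {p : Spc m × ℝ | ‖p.1 - p'.1‖ ≤ r ∧ |paraDiff p p' x| ≤ s} with hS
  have hSm : MeasurableSet S := by
    refine IsClosed.measurableSet ?_
    have h1 : Continuous fun p : Spc m × ℝ => ‖p.1 - p'.1‖ := by fun_prop
    have h2 : Continuous fun p : Spc m × ℝ => |paraDiff p p' x| := by unfold paraDiff; fun_prop
    exact (isClosed_le h1 continuous_const).inter (isClosed_le h2 continuous_const)
  rw [Measure.volume_eq_prod, Measure.prod_apply hSm]
  have h1 : ∀ y : Spc m, volume (Prod.mk y ⁻¹' S) ≤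
      (Metric.closedBall p'.1 r).indicator (fun _ => ENNReal.ofReal (2 * s)) y := by
    intro y
    by_cases hy : y ∈ Metric.closedBall p'.1 r
    · rw [indicator_of_mem hy]
      set c : ℝ := 4 * ‖x - y‖ ^ 2 + (p'.2 - 4 * ‖x - p'.1‖ ^ 2)
      have : Prod.mk y ⁻¹' S ⊆ Icc (c - s) (c + s) := by
        rintro h ⟨_, hh⟩
        simp only [paraDiff, abs_le] at hh
        simp only [c]
        constructor <;> linarith [hh.1, hh.2]
      refine (measure_mono this).trans ?_
      rw [Real.volume_Icc]
      gcongr; linarith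
    · rw [indicator_of_notMem hy]
      have : Prod.mk y ⁻¹' S = ∅ := by
        refine eq_empty_iff_forall_notMem.2 fun h hh => hy ?_
        rw [mem_closedBall_iff_norm]; exact hh.1
      rw [this]; simp
  refine (lintegral_mono h1).trans ?_
  rw [lintegral_indicator_const Metric.isClosed_closedBall.measurableSet,
    Measure.addHaar_closedBall _ _ hr, ENNReal.ofReal_mul (q := 2 * s) (by positivity)]
  simp only [finrank_euclideanSpace, Fintype.card_fin, unitVol]
  rw [← mul_assoc, mul_comm (ENNReal.ofReal (2 * s))]

lemma volume_contacts_le {m : ℕ} {C δ : ℝ} (hC : 0 < C) (hδ : 0 < δ) {w : Spc m × ℝ → ℝ}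
    (hw : ContinuousOn w (Metric.closedBall 0 1 ×ˢ Icc (-1) 0)) (V : Set (Spc m × ℝ))
    (X : Spc m × ℝ → Spc m × ℝ) (hV : ∀ p ∈ V, p.2 < 1 ∧ Contact w p (X p) ∧ Expands C δ w p (X p)) :
    volume V ≤ ENNReal.ofReal (2 * (100 * (C + 4)) ^ (m + 2)) *
      volume {z : Spc m × ℝ | z ∈ Metric.ball (0 : Spc m) 1 ×ˢ Ioc (-1 : ℝ) 0 ∧ w z < 1} := by
  set O := {z : Spc m × ℝ | z ∈ Metric.ball (0 : Spc m) 1 ×ˢ Ioc (-1 : ℝ) 0 ∧ w z < 1} with hO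
  set K : ℝ := 100 * (C + 4) with hK
  have hK0 : 0 < K := by positivity
  have hex : ∀ p ∈ V, ∃ ρ, 0 < ρ ∧ ρ ≤ 1 ∧ 5 * ρ < δ ∧ ‖(X p).1‖ + 4 * ρ ≤ 1 ∧ bcyl (X p) ρ ⊆ O := by
    intro p hp
    obtain ⟨hp1, ⟨hx1, hx2, hwX, -⟩, -⟩ := hV p hp
    have hx1' : ‖(X p).1‖ < 1 := by simpa using hx1
    have hlt : w (X p) < 1 := by
      rw [hwX, para]
      have : 0 ≤ ‖(X p).1 - p.1‖ ^ 2 := by positivity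
      linarith [hx2.2]
    have hcw := hw (X p) ⟨Metric.ball_subset_closedBall hx1, hx2.1.le, hx2.2⟩
    obtain ⟨ε, hε, hεw⟩ := Metric.mem_nhdsWithin_iff.1 (hcw.preimage_mem_nhdsWithin (Iio_mem_nhds hlt))
    have hx2' := hx2.1
    refine ⟨min (min (1 / 2) (δ / 10)) (min ((1 - ‖(X p).1‖) / 4) (min (ε / 2) (((X p).2 + 1) / 2))),
      ?_, ?_, ?_, ?_, ?_⟩
    · refine lt_min (lt_min (by norm_num) (by positivity)) (lt_min (by linarith) (lt_min (by positivity)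
        (by linarith)))
    · exact (min_le_left _ _).trans ((min_le_left _ _).trans (by norm_num))
    · have := (min_le_left _ _).trans (min_le_right _ _) |>.trans_eq' (rfl :
        min (min (1 / 2) (δ / 10)) (min ((1 - ‖(X p).1‖) / 4) (min (ε / 2) (((X p).2 + 1) / 2))) = _)
      linarith
    · have := (min_le_right _ _).trans (min_le_left _ _) |>.trans_eq' (rfl :
        min (min (1 / 2) (δ / 10)) (min ((1 - ‖(X p).1‖) / 4) (min (ε / 2) (((X p).2 + 1) / 2))) = _)
      linarith
    · set ρ := min (min (1 / 2) (δ / 10)) (min ((1 - ‖(X p).1‖) / 4) (min (ε / 2) (((X p).2 + 1) / 2)))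
        with hρdef
      have hρ0 : 0 < ρ := lt_min (lt_min (by norm_num) (by positivity)) (lt_min (by linarith)
        (lt_min (by positivity) (by linarith)))
      have a1 : ρ ≤ 1 / 2 := (min_le_left _ _).trans (min_le_left _ _)
      have a2 : ρ ≤ (1 - ‖(X p).1‖) / 4 := (min_le_right _ _).trans (min_le_left _ _)
      have a3 : ρ ≤ ε / 2 := (min_le_right _ _).trans ((min_le_right _ _).trans (min_le_left _ _))
      have a4 : ρ ≤ ((X p).2 + 1) / 2 :=
        (min_le_right _ _).trans ((min_le_right _ _).trans (min_le_right _ _))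
      have hsq : ρ ^ 2 ≤ ρ := by nlinarith
      rintro z ⟨hz1, hz2⟩
      have hz1' : dist z.1 (X p).1 < ρ := hz1
      have hzn : ‖z.1‖ < 1 := by
        have := norm_le_norm_add_norm_sub' z.1 (X p).1
        rw [dist_eq_norm] at hz1'
        linarith
      have hzt : z.2 ∈ Ioc (-1) 0 := ⟨by linarith [hz2.1], by linarith [hz2.2, hx2.2]⟩
      refine ⟨⟨by simpa using hzn, hzt⟩, ?_⟩
      refine hεw ⟨?_, by simpa using hzn.le, hzt.1.le, hzt.2⟩
      rw [Metric.mem_ball, Prod.dist_eq, max_lt_iff]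
      refine ⟨by linarith, ?_⟩
      rw [Real.dist_eq, abs_lt]; constructor <;> linarith [hz2.1, hz2.2]
  choose! ρ h1 h2 h3 h4 h5 using hex
  obtain ⟨u, huV, huc, hud, hucov⟩ := exists_parabolic_vitali V X ρ 1 fun p hp => ⟨h1 p hp, h2 p hp⟩
  have hcov : V ⊆ ⋃ b ∈ u, {p : Spc m × ℝ | ‖p.1 - b.1‖ ≤ K * ρ b ∧
      |paraDiff p b (X b).1| ≤ K * ρ b ^ 2} := by
    intro p hp
    obtain ⟨b, hb, -, hb1, hb2⟩ := hucov p hp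
    refine mem_iUnion₂.2 ⟨b, hb, ?_⟩
    have hbV := huV hb
    have hρb := h1 b hbV
    have hρb1 := h2 b hbV
    exact two_contacts hC (hV p hp).2.1 (hV b hbV).2.1 (hV p hp).2.2 (hV b hbV).2.2 hρb (h3 b hbV)
      (by nlinarith [h3 b hbV]) hb1 hb2 (h4 b hbV)
  have hsub : ⋃ b ∈ u, bcyl (X b) (ρ b) ⊆ O := iUnion₂_subset fun b hb => h5 b (huV hb)
  calc volume V ≤ ∑' b : u, volume {p : Spc m × ℝ | ‖p.1 - b.1.1‖ ≤ K * ρ b ∧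
      |paraDiff p b (X b).1| ≤ K * ρ b ^ 2} :=
        (measure_mono hcov).trans (measure_biUnion_le _ huc _)
    _ ≤ ∑' b : u, ENNReal.ofReal (2 * K ^ (m + 2)) * volume (bcyl (X b) (ρ b)) := by
        refine ENNReal.tsum_le_tsum fun b => ?_
        have hρb := h1 b (huV b.2)
        refine (volume_paraDiff_le _ _ (by positivity)).trans (le_of_eq ?_)
        rw [volume_bcyl _ hρb, ← mul_assoc (ENNReal.ofReal (2 * K ^ (m + 2))),
          ← ENNReal.ofReal_mul (by positivity)]
        congr 2
        ring
    _ = ENNReal.ofReal (2 * K ^ (m + 2)) * volume (⋃ b ∈ u, bcyl (X b) (ρ b)) := by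
        rw [ENNReal.tsum_mul_left, measure_biUnion huc hud fun b _ => (isOpen_bcyl _ _).measurableSet]
    _ ≤ _ := by gcongr

lemma abp_unit {m : ℕ} {lam Lam : ℝ} (hl : 0 < lam) (hL : lam ≤ Lam) :
    ∃ c > 0, ∀ κ, 0 < κ → κ < 1 → ∀ w : Spc m × ℝ → ℝ,
      ContinuousOn w (Metric.closedBall 0 1 ×ˢ Icc (-1) 0) →
      (∀ z ∈ Metric.closedBall (0 : Spc m) 1 ×ˢ Icc (-1 : ℝ) 0, 0 ≤ w z) →
      (∀ z ∈ Metric.ball (0 : Spc m) 1 ×ˢ Ioc (-1 : ℝ) 0, SupAt lam Lam w z) →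
      w (0, 0) ≤ 1 - κ → ENNReal.ofReal (c * κ ^ (m + 2)) ≤
        volume {z : Spc m × ℝ | z ∈ Metric.ball (0 : Spc m) 1 ×ˢ Ioc (-1 : ℝ) 0 ∧ w z < 1} := by
  obtain ⟨C, hC, hexp⟩ := contact_expansion (m := m) hl hL
  set K : ℝ := 2 * (100 * (C + 4)) ^ (m + 2) with hK
  have hK0 : 0 < K := by positivity
  set ω := (unitVol m).toReal with hω
  have hω0 : 0 < ω := ENNReal.toReal_pos (unitVol_pos m).ne' (unitVol_lt_top m).ne
  have hωe : unitVol m = ENNReal.ofReal ω := (ENNReal.ofReal_toReal (unitVol_lt_top m).ne).symm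
  refine ⟨(1 / 8) ^ (m + 1) * (1 / 2) * ω / K, by positivity, ?_⟩
  intro κ hκ hκ1 w hw h0 hs hw0
  set O := {z : Spc m × ℝ | z ∈ Metric.ball (0 : Spc m) 1 ×ˢ Ioc (-1 : ℝ) 0 ∧ w z < 1} with hO
  set V : Set (Spc m × ℝ) := Metric.ball 0 (κ / 8) ×ˢ Ioo (1 - κ / 2) 1 with hV
  have hex : ∀ p ∈ V, ∃ X, Contact w p X := fun p hp =>
    exists_contact hw h0 hκ hκ1 hw0 (by simpa using hp.1) hp.2
  choose! X hX using hex
  have hex2 : ∀ p ∈ V, ∃ δ > 0, Expands C δ w p (X p) := fun p hp =>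
    hexp w p (X p) (hs _ ⟨(hX p hp).1, (hX p hp).2.1⟩) (hX p hp)
  choose! δ hδ hE using hex2
  set W : ℕ → Set (Spc m × ℝ) := fun j => {p | p ∈ V ∧ 1 / ((j : ℝ) + 1) ≤ δ p} with hW
  have hWm : Monotone W := by
    intro i j hij p hp
    refine ⟨hp.1, le_trans ?_ hp.2⟩
    have : (i : ℝ) ≤ j := by exact_mod_cast hij
    gcongr
  have hWU : ⋃ j, W j = V := by
    refine Subset.antisymm (iUnion_subset fun j p hp => hp.1) fun p hp => ?_
    obtain ⟨j, hj⟩ := exists_nat_one_div_lt (hδ p hp)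
    exact mem_iUnion.2 ⟨j, hp, hj.le⟩
  have hWle : ∀ j, volume (W j) ≤ ENNReal.ofReal K * volume O := by
    intro j
    refine volume_contacts_le hC (δ := 1 / ((j : ℝ) + 1)) (by positivity) hw (W j) X fun p hp => ?_
    refine ⟨hp.1.2.2, hX p hp.1, fun v hv => (hE p hp.1).1 v (hv.trans_le hp.2),
      fun s hs0 hs1 => (hE p hp.1).2 s hs0 (hs1.trans_le hp.2)⟩
  have hVle : volume V ≤ ENNReal.ofReal K * volume O := by
    rw [← hWU, hWm.measure_iUnion]
    exact iSup_le hWle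
  rw [hV, volume_ball_prod_Ioo _ (by positivity), hωe, ← ENNReal.ofReal_mul
    (mul_nonneg (by positivity) (by linarith))] at hVle
  have h1 : ENNReal.ofReal ((1 / 8) ^ (m + 1) * (1 / 2) * ω / K * κ ^ (m + 2)) =
      ENNReal.ofReal K⁻¹ *
        ENNReal.ofReal ((κ / 8) ^ (m + 1) * (1 - (1 - κ / 2)) * ω) := by
    rw [← ENNReal.ofReal_mul (by positivity)]
    congr 1
    rw [div_pow, div_pow, one_pow]
    field_simp
    ring
  rw [h1]
  calc _ ≤ ENNReal.ofReal K⁻¹ * (ENNReal.ofReal K * volume O) := by gcongr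
    _ = volume O := by
      rw [← mul_assoc, ← ENNReal.ofReal_mul (by positivity), inv_mul_cancel₀ hK0.ne']
      simp

/-- Pointwise-to-measure estimate: a nonnegative supersolution that is at least `ℓ` outside a small
part of a cylinder is not much smaller than `ℓ` at the centre of its top. -/
lemma small_measure (m : ℕ) {lam Lam : ℝ} (hl : 0 < lam) (hL : lam ≤ Lam) {κ : ℝ} (hκ : 0 < κ)
    (hκ1 : κ < 1) :
    ∃ ε > 0, ∀ (w : Spc m × ℝ → ℝ) (P : Spc m × ℝ) (r ℓ : ℝ), 0 < r → 0 < ℓ →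
      ContinuousOn w (Metric.closedBall P.1 r ×ˢ Icc (P.2 - r ^ 2) P.2) →
      (∀ z ∈ Metric.closedBall P.1 r ×ˢ Icc (P.2 - r ^ 2) P.2, 0 ≤ w z) →
      (∀ z ∈ Metric.ball P.1 r ×ˢ Ioc (P.2 - r ^ 2) P.2, SupAt lam Lam w z) →
      volume {z | z ∈ Metric.ball P.1 r ×ˢ Ioc (P.2 - r ^ 2) P.2 ∧ w z < ℓ} ≤
        ENNReal.ofReal (ε * r ^ (m + 3)) → (1 - κ) * ℓ < w P := by
  obtain ⟨c, hc, habp⟩ := abp_unit (m := m) hl hL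
  refine ⟨c * κ ^ (m + 2) / 2, by positivity, fun w P r ℓ hr hℓ hw h0 hs hvol => ?_⟩
  by_contra hcon
  push Not at hcon
  set v : Spc m × ℝ → ℝ := fun z => ℓ⁻¹ * w (pscale P r z) + 0 with hv
  have hmap1 : ∀ z : Spc m × ℝ, z ∈ Metric.closedBall 0 1 ×ˢ Icc (-1) 0 →
      pscale P r z ∈ Metric.closedBall P.1 r ×ˢ Icc (P.2 - r ^ 2) P.2 := by
    rintro z ⟨h1, h2⟩
    have hr2 : 0 < r ^ 2 := by positivity
    simp only [Metric.mem_closedBall, dist_zero_right] at h1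
    refine ⟨?_, ?_, ?_⟩
    · simp only [pscale, Metric.mem_closedBall, dist_self_add_left, norm_smul,
        Real.norm_of_nonneg hr.le]
      nlinarith
    · simp only [pscale]; nlinarith [h2.1]
    · simp only [pscale]; nlinarith [h2.2]
  have hmap2 : ∀ z : Spc m × ℝ, z ∈ Metric.ball 0 1 ×ˢ Ioc (-1) 0 →
      pscale P r z ∈ Metric.ball P.1 r ×ˢ Ioc (P.2 - r ^ 2) P.2 := by
    rintro z ⟨h1, h2⟩
    have hr2 : 0 < r ^ 2 := by positivity
    simp only [Metric.mem_ball, dist_zero_right] at h1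
    refine ⟨?_, ?_, ?_⟩
    · simp only [pscale, Metric.mem_ball, dist_self_add_left, norm_smul,
        Real.norm_of_nonneg hr.le]
      nlinarith
    · simp only [pscale]; nlinarith [h2.1]
    · simp only [pscale]; nlinarith [h2.2]
  have h1 := habp κ hκ hκ1 v ?_ ?_ ?_ ?_
  · have hsub : {z : Spc m × ℝ | z ∈ Metric.ball (0 : Spc m) 1 ×ˢ Ioc (-1 : ℝ) 0 ∧ v z < 1} ⊆
        pscale P r ⁻¹' {z | z ∈ Metric.ball P.1 r ×ˢ Ioc (P.2 - r ^ 2) P.2 ∧ w z < ℓ} := by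
      rintro z ⟨hz1, hz2⟩
      refine ⟨hmap2 z hz1, ?_⟩
      simp only [hv, add_zero] at hz2
      rwa [inv_mul_lt_iff₀ hℓ, mul_one] at hz2
    have h2 := h1.trans (measure_mono hsub)
    rw [volume_pscale_preimage P hr] at h2
    have h3 : ENNReal.ofReal (c * κ ^ (m + 2)) ≤ ENNReal.ofReal (c * κ ^ (m + 2) / 2) := by
      refine h2.trans ?_
      refine (mul_le_mul_right hvol _).trans (le_of_eq ?_)
      rw [← ENNReal.ofReal_mul (by positivity)]
      congr 1
      field_simp
    rw [ENNReal.ofReal_le_ofReal_iff (by positivity)] at h3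
    have : 0 < c * κ ^ (m + 2) := by positivity
    linarith
  · have : ContinuousOn (fun z => w (pscale P r z)) (Metric.closedBall 0 1 ×ˢ Icc (-1) 0) :=
      hw.comp (continuous_pscale P r).continuousOn hmap1
    exact (this.const_smul ℓ⁻¹).add continuousOn_const
  · intro z hz
    have := h0 _ (hmap1 z hz)
    simp only [hv]; positivity
  · intro z hz
    exact ((hs _ (hmap2 z hz)).pscale hr).affine (inv_pos.2 hℓ) 0
  · simp only [hv, pscale, smul_zero, mul_zero, add_zero]
    rw [inv_mul_le_iff₀ hℓ]
    linarith

/-- The Gaussian barrier. -/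
def gbar {m : ℕ} (lam s : ℝ) (q : ℕ) (x : Spc m) (τ : ℝ) : ℝ :=
  (s ^ 2 / τ) ^ q * Real.exp (-(‖x‖ ^ 2 / (4 * lam * τ)))

lemma pow_mul_exp_neg_le {lam y : ℝ} (hl : 0 < lam) (hy : 0 ≤ y) (q : ℕ) :
    y ^ q * Real.exp (-(y / (4 * lam))) ≤ q.factorial * (4 * lam) ^ q := by
  have h := Real.pow_div_factorial_le_exp (y / (4 * lam)) (by positivity) q
  rw [Real.exp_neg, ← div_eq_mul_inv, div_le_iff₀ (Real.exp_pos _)]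
  rw [div_pow, div_div, div_le_iff₀ (by positivity)] at h
  linarith

lemma exp_taylor_two (a b : ℝ) {ε : ℝ} (hε : 0 < ε) :
    ∀ᶠ σ in 𝓝 (0 : ℝ), 1 + σ * a + σ ^ 2 * (b + a ^ 2 / 2) - ε * σ ^ 2 ≤
      Real.exp (σ * a + σ ^ 2 * b) := by
  have h1 : ∀ᶠ σ in 𝓝 (0 : ℝ), |σ * a + σ ^ 2 * b| < 1 := by
    have : Continuous fun σ : ℝ => |σ * a + σ ^ 2 * b| := by fun_prop
    refine this.continuousAt.eventually_lt continuousAt_const (by simp)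
  have h2 : ∀ᶠ σ in 𝓝 (0 : ℝ), -ε < σ * (a * b) + σ ^ 2 * b ^ 2 / 2 - |σ| * |a + σ * b| ^ 3 := by
    have : Continuous fun σ : ℝ => σ * (a * b) + σ ^ 2 * b ^ 2 / 2 - |σ| * |a + σ * b| ^ 3 := by
      fun_prop
    refine continuousAt_const.eventually_lt this.continuousAt (by simpa using hε)
  filter_upwards [h1, h2] with σ hσ1 hσ2
  have h3 := Real.exp_bound hσ1.le (n := 3) (by norm_num)
  simp only [Finset.sum_range_succ, Finset.range_zero, Finset.sum_empty, Nat.factorial] at h3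
  norm_num at h3
  have h4 : |σ * a + σ ^ 2 * b| ^ 3 = σ ^ 2 * (|σ| * |a + σ * b| ^ 3) := by
    rw [show σ * a + σ ^ 2 * b = σ * (a + σ * b) by ring, abs_mul, mul_pow, ← sq_abs σ]; ring
  have h5 := (abs_le.1 h3).1
  have h6 : 0 ≤ |σ * a + σ ^ 2 * b| ^ 3 := by positivity
  have h7 : σ ^ 2 * (-ε) ≤ σ ^ 2 * (σ * (a * b) + σ ^ 2 * b ^ 2 / 2 - |σ| * |a + σ * b| ^ 3) :=
    mul_le_mul_of_nonneg_left hσ2.le (sq_nonneg _)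
  nlinarith

lemma gbar_horizontal {m : ℕ} {lam s τ : ℝ} (hl : 0 < lam) (hs : 0 < s) (hτ : 0 < τ) (q : ℕ)
    (x v : Spc m) (hv : ‖v‖ = 1) {ε : ℝ} (hε : 0 < ε) :
    ∀ᶠ σ in 𝓝 (0 : ℝ), gbar lam s q x τ + σ * (gbar lam s q x τ * -(inner ℝ x v / (2 * lam * τ))) +
      σ ^ 2 * (gbar lam s q x τ * ((inner ℝ x v) ^ 2 / (4 * lam ^ 2 * τ ^ 2) - 1 / (2 * lam * τ))) / 2
        - ε * σ ^ 2 ≤ gbar lam s q (x + σ • v) τ := by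
  have hg : 0 < gbar lam s q x τ := by unfold gbar; positivity
  filter_upwards [exp_taylor_two (-(inner ℝ x v / (2 * lam * τ))) (-(1 / (4 * lam * τ)))
    (ε := ε / gbar lam s q x τ) (by positivity)] with σ h
  have h1 : gbar lam s q (x + σ • v) τ = gbar lam s q x τ *
      Real.exp (σ * -(inner ℝ x v / (2 * lam * τ)) + σ ^ 2 * -(1 / (4 * lam * τ))) := by
    unfold gbar
    rw [mul_assoc ((s ^ 2 / τ) ^ q), ← Real.exp_add, norm_add_sq_real, inner_smul_right, norm_smul,
      hv, mul_one, Real.norm_eq_abs, sq_abs]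
    congr 2
    field_simp
    ring
  rw [h1]
  refine le_trans (le_of_eq ?_) (mul_le_mul_of_nonneg_left h hg.le)
  field_simp
  ring

lemma gbar_vertical {m : ℕ} {lam s τ : ℝ} (hl : 0 < lam) (hτ : 0 < τ) (q : ℕ)
    (hq : 1 ≤ q) (x : Spc m) {ε : ℝ} (hε : 0 < ε) :
    ∀ᶠ σ in 𝓝[>] (0 : ℝ), gbar lam s q x τ -
      gbar lam s q x τ * (‖x‖ ^ 2 / (4 * lam * τ ^ 2) - q / τ) * σ - ε * σ ≤
        gbar lam s q x (τ - σ) := by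
  have hd : HasDerivAt (fun σ : ℝ => gbar lam s q x (τ - σ))
      (-(gbar lam s q x τ * (‖x‖ ^ 2 / (4 * lam * τ ^ 2) - q / τ))) 0 := by
    have h0 : HasDerivAt (fun σ : ℝ => τ - σ) (-1) 0 := by
      simpa using (hasDerivAt_id (0 : ℝ)).const_sub τ
    have h1 : HasDerivAt (fun σ : ℝ => (τ - σ)⁻¹) (1 / τ ^ 2) 0 :=
      (h0.fun_inv (by simpa using hτ.ne')).congr_deriv (by simp)
    have h2 := ((h1.const_mul (s ^ 2)).fun_pow q).fun_mul
      ((h1.const_mul (-(‖x‖ ^ 2 / (4 * lam)))).exp)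
    have hfun : (fun σ : ℝ => gbar lam s q x (τ - σ)) = fun σ : ℝ => (s ^ 2 * (τ - σ)⁻¹) ^ q *
        Real.exp (-(‖x‖ ^ 2 / (4 * lam)) * (τ - σ)⁻¹) := by
      funext σ
      simp only [gbar, div_eq_mul_inv]
      congr 2
      rw [mul_inv]; ring
    rw [hfun]
    refine h2.congr_deriv ?_
    simp only [gbar, sub_zero]
    obtain ⟨k, rfl⟩ : ∃ k, q = k + 1 := ⟨q - 1, by omega⟩
    rw [show -(‖x‖ ^ 2 / (4 * lam)) * τ⁻¹ = -(‖x‖ ^ 2 / (4 * lam * τ)) by field_simp]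
    simp only [Nat.add_sub_cancel]
    push_cast
    rw [div_eq_mul_inv (s ^ 2) τ, pow_succ (s ^ 2 * τ⁻¹) k]
    field_simp
    ring
  have h3 := (hasDerivAt_iff_isLittleO.1 hd).bound hε
  filter_upwards [nhdsWithin_le_nhds h3, self_mem_nhdsWithin] with σ h hσ
  have hσ : 0 < σ := hσ
  simp only [sub_zero, smul_eq_mul, Real.norm_eq_abs, abs_of_pos hσ] at h
  have := (abs_le.1 h).1
  linarith

/-- Normalising constant of the Gaussian barrier. -/
def barC (lam : ℝ) (q : ℕ) : ℝ := max 1 (q.factorial * (4 * lam) ^ q)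

lemma barC_pos (lam : ℝ) (q : ℕ) : 0 < barC lam q := lt_of_lt_of_le one_pos (le_max_left _ _)

lemma gbar_eq {m : ℕ} {lam s τ ρ : ℝ} (hτ : 0 < τ) (hρ : 0 < ρ) (q : ℕ) (x : Spc m)
    (hx : ‖x‖ = ρ) :
    gbar lam s q x τ = (s / ρ) ^ (2 * q) * ((ρ ^ 2 / τ) ^ q * Real.exp (-((ρ ^ 2 / τ) / (4 * lam)))) := by
  unfold gbar
  rw [hx, ← mul_assoc]
  congr 1
  · rw [pow_mul, ← mul_pow]; congr 1; field_simp
  · congr 2; field_simp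

lemma gbar_le_radius {m : ℕ} {lam s τ ρ : ℝ} (hl : 0 < lam) (hs : 0 < s) (hτ : 0 < τ) (hρ : 0 < ρ)
    (q : ℕ) (x : Spc m) (hx : ‖x‖ = ρ) : gbar lam s q x τ ≤ barC lam q * (s / ρ) ^ (2 * q) := by
  rw [gbar_eq hτ hρ q x hx, mul_comm (barC lam q)]
  gcongr
  exact (pow_mul_exp_neg_le hl (by positivity) q).trans (le_max_right _ _)

lemma continuousOn_gbar {m : ℕ} {lam s : ℝ} (hl : 0 < lam) (q : ℕ) (P : Spc m × ℝ)
    (D : Set (Spc m × ℝ)) (hD : ∀ z ∈ D, 0 < z.2 - P.2) :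
    ContinuousOn (fun z : Spc m × ℝ => gbar lam s q (z.1 - P.1) (z.2 - P.2)) D := by
  unfold gbar
  refine ((continuousOn_const.div (by fun_prop) fun z hz => (hD z hz).ne').pow q).mul
    (Real.continuous_exp.comp_continuousOn ((ContinuousOn.div (by fun_prop) (by fun_prop)
      fun z hz => ?_).neg))
  have := hD z hz
  positivity

lemma spread_lower {m : ℕ} {lam Lam : ℝ} (hl : 0 < lam) {q : ℕ} (hq1 : 1 ≤ q)
    (hq : (m + 1) * Lam / (2 * lam) < q) {w : Spc m × ℝ → ℝ} {P : Spc m × ℝ} {s R T ℓ : ℝ}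
    (hs : 0 < s) (hsR : s ≤ R) (hℓ : 0 < ℓ)
    (hw : ContinuousOn w (Metric.closedBall P.1 R ×ˢ Icc P.2 (P.2 + T)))
    (h0 : ∀ z ∈ Metric.closedBall P.1 R ×ˢ Icc P.2 (P.2 + T), 0 ≤ w z)
    (hS : ∀ z ∈ Metric.ball P.1 R ×ˢ Ioc P.2 (P.2 + T), SupAt lam Lam w z)
    (hb : ∀ z ∈ Metric.closedBall P.1 s ×ˢ Icc P.2 (P.2 + s ^ 2), ℓ ≤ w z)
    {z : Spc m × ℝ} (hz : z ∈ Metric.closedBall P.1 R ×ˢ Icc (P.2 + s ^ 2) (P.2 + T)) :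
    ℓ * (gbar lam s q (z.1 - P.1) (z.2 - P.2) / barC lam q - (s / R) ^ (2 * q)) ≤ w z := by
  by_contra hcon
  push Not at hcon
  have hR : 0 < R := hs.trans_le hsR
  have hC := barC_pos lam q
  set C := barC lam q with hCdef
  set G : Spc m × ℝ → ℝ := fun z => gbar lam s q (z.1 - P.1) (z.2 - P.2) with hG
  obtain ⟨δ, hδ, hδ1⟩ : ∃ δ > 0, w z < ℓ * (G z / C - (s / R) ^ (2 * q) - δ) := by
    refine ⟨(ℓ * (G z / C - (s / R) ^ (2 * q)) - w z) / (2 * ℓ), by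
      have : 0 < ℓ * (G z / C - (s / R) ^ (2 * q)) - w z := by linarith
      positivity, ?_⟩
    have e1 : ℓ * (G z / C - (s / R) ^ (2 * q) - (ℓ * (G z / C - (s / R) ^ (2 * q)) - w z) / (2 * ℓ))
      = (ℓ * (G z / C - (s / R) ^ (2 * q)) + w z) / 2 := by field_simp; ring
    rw [e1]; linarith
  obtain ⟨η, hη, hηs, hη1⟩ : ∃ η > 0, η < s ^ 2 ∧
      ((q + 1).factorial * (4 * lam) ^ (q + 1)) * (η / s ^ 2) ≤ C * δ := by
    set D : ℝ := (q + 1).factorial * (4 * lam) ^ (q + 1) with hD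
    have hDpos : 0 < D := by positivity
    refine ⟨min (s ^ 2 / 2) (C * δ * s ^ 2 / D), by positivity,
      (min_le_left _ _).trans_lt (by linarith [pow_pos hs 2] : s ^ 2 / 2 < s ^ 2), ?_⟩
    have : D * (C * δ * s ^ 2 / D / s ^ 2) = C * δ := by field_simp
    exact (mul_le_mul_of_nonneg_left (div_le_div_of_nonneg_right (min_le_right _ _) (sq_nonneg s))
      hDpos.le).trans_eq this
  have hs2 : 0 < s ^ 2 := by positivity
  set D : Set (Spc m × ℝ) := (Metric.closedBall P.1 R ×ˢ Icc (P.2 + η) (P.2 + T)) ∩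
    ({z | s ≤ ‖z.1 - P.1‖} ∪ {z | s ^ 2 ≤ z.2 - P.2}) with hDdef
  have hDc : IsCompact D := by
    refine ((isCompact_closedBall _ _).prod isCompact_Icc).inter_right ?_
    exact (isClosed_le (by fun_prop) (by fun_prop)).union (isClosed_le (by fun_prop) (by fun_prop))
  have hDsub : D ⊆ Metric.closedBall P.1 R ×ˢ Icc P.2 (P.2 + T) := by
    rintro z ⟨⟨h1, h2⟩, -⟩
    exact ⟨h1, by linarith [h2.1], h2.2⟩
  have hDτ : ∀ z ∈ D, 0 < z.2 - P.2 := by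
    rintro z ⟨⟨h1, h2⟩, -⟩
    linarith [h2.1]
  set ψ : Spc m × ℝ → ℝ := fun z => w z - ℓ * (G z / C - (s / R) ^ (2 * q) - δ) with hψ
  have hψc : ContinuousOn ψ D := by
    have hGc : ContinuousOn G D := continuousOn_gbar hl q P D hDτ
    exact (hw.mono hDsub).sub (continuousOn_const.mul
      (((hGc.div_const C).sub continuousOn_const).sub continuousOn_const))
  have hzD : z ∈ D := by
    refine ⟨⟨hz.1, by linarith [hz.2.1], hz.2.2⟩, Or.inr ?_⟩
    show s ^ 2 ≤ z.2 - P.2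
    linarith [hz.2.1]
  obtain ⟨p, hpD, hpmin⟩ := hDc.exists_isMinOn ⟨z, hzD⟩ hψc
  have hpneg : ψ p < 0 := lt_of_le_of_lt (hpmin hzD) (by simp only [hψ]; linarith)
  have hτ := hDτ p hpD
  have hw0 := h0 p (hDsub hpD)
  have hGpos : 0 < G p := by simp only [hG, gbar]; positivity
  have hsR0 : 0 ≤ (s / R) ^ (2 * q) := by positivity
  have hGbig : C * ((s / R) ^ (2 * q) + δ) < G p := by
    by_contra h
    push Not at h
    have h1 : G p / C ≤ (s / R) ^ (2 * q) + δ := by rwa [div_le_iff₀ hC, mul_comm]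
    have h2 : ℓ * (G p / C - (s / R) ^ (2 * q) - δ) ≤ 0 :=
      mul_nonpos_of_nonneg_of_nonpos hℓ.le (by linarith)
    simp only [hψ] at hpneg
    linarith
  have hpR : ‖p.1 - P.1‖ ≤ R := by simpa [dist_eq_norm] using hpD.1.1
  have hpR' : ‖p.1 - P.1‖ < R := by
    refine lt_of_le_of_ne hpR fun h => ?_
    have := gbar_le_radius hl hs hτ hR q (p.1 - P.1) h
    have h3 : 0 < C * δ := by positivity
    simp only [hG] at hGbig
    linarith
  have hgood : s < ‖p.1 - P.1‖ ∨ s ^ 2 < p.2 - P.2 := by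
    by_contra h
    push Not at h
    have hwl := hb p ⟨by simpa [dist_eq_norm] using h.1, by linarith, by linarith [h.2]⟩
    have hGC : G p ≤ C := by
      rcases hpD.2 with h1 | h1
      · have := gbar_le_radius hl hs hτ hs q (p.1 - P.1) (le_antisymm h.1 h1)
        rw [div_self hs.ne', one_pow, mul_one] at this
        exact this
      · have h2 : s ^ 2 / (p.2 - P.2) = 1 := by
          rw [le_antisymm h.2 h1, div_self hs2.ne']
        simp only [hG, gbar, h2, one_pow, one_mul]
        refine le_trans (Real.exp_le_one_iff.2 ?_) (le_max_left _ _)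
        have : 0 ≤ ‖p.1 - P.1‖ ^ 2 / (4 * lam * (p.2 - P.2)) := by positivity
        linarith
    have h1 : G p / C ≤ 1 := by rwa [div_le_one hC]
    have h2 : ℓ * (G p / C - (s / R) ^ (2 * q) - δ) ≤ ℓ * 1 :=
      mul_le_mul_of_nonneg_left (by linarith) hℓ.le
    simp only [hψ] at hpneg
    linarith
  have hpη : η < p.2 - P.2 := by
    refine lt_of_le_of_ne (by linarith [hpD.1.2.1]) fun h => ?_
    have hsx : s < ‖p.1 - P.1‖ := by
      rcases hgood with h1 | h1
      · exact h1
      · linarith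
    set y := ‖p.1 - P.1‖ ^ 2 / (p.2 - P.2) with hy
    have hx0 : 0 < ‖p.1 - P.1‖ := hs.trans hsx
    have hy0 : 0 < y := by positivity
    have h1 := gbar_eq (lam := lam) (s := s) hτ hx0 q (p.1 - P.1) rfl
    have h2 := pow_mul_exp_neg_le hl hy0.le (q + 1)
    have h3 : (s / ‖p.1 - P.1‖) ^ (2 * q) ≤ 1 :=
      pow_le_one₀ (by positivity) (by rw [div_le_one hx0]; exact hsx.le)
    have h4 : 0 ≤ y ^ q * Real.exp (-(y / (4 * lam))) := by positivity
    have h5 : G p ≤ y ^ q * Real.exp (-(y / (4 * lam))) := by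
      simp only [hG]; rw [h1]; exact mul_le_of_le_one_left h4 h3
    have h6 : y⁻¹ ≤ η / s ^ 2 := by
      rw [hy, ← h, inv_div]
      gcongr
    have h7 : y ^ q * Real.exp (-(y / (4 * lam))) =
        (y ^ (q + 1) * Real.exp (-(y / (4 * lam)))) * y⁻¹ := by
      rw [pow_succ]; field_simp
    have h8 : G p ≤ C * δ := by
      refine h5.trans (le_trans (le_of_eq h7) (le_trans ?_ hη1))
      exact mul_le_mul h2 h6 (by positivity) (by positivity)
    have : 0 ≤ C * (s / R) ^ (2 * q) := by positivity
    linarith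
  -- the minimum is interior, so the barrier touches `w` from below
  have hnear : ∀ᶠ z in 𝓝 p, z.2 ≤ P.2 + T → z ∈ D := by
    have h1 : ∀ᶠ z : Spc m × ℝ in 𝓝 p, ‖z.1 - P.1‖ < R :=
      (by fun_prop : Continuous fun z : Spc m × ℝ => ‖z.1 - P.1‖).continuousAt.eventually_lt
        continuousAt_const hpR'
    have h2 : ∀ᶠ z : Spc m × ℝ in 𝓝 p, η < z.2 - P.2 :=
      continuousAt_const.eventually_lt
        (by fun_prop : Continuous fun z : Spc m × ℝ => z.2 - P.2).continuousAt hpη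
    have h3 : ∀ᶠ z : Spc m × ℝ in 𝓝 p, s ≤ ‖z.1 - P.1‖ ∨ s ^ 2 ≤ z.2 - P.2 := by
      rcases hgood with h | h
      · filter_upwards [continuousAt_const.eventually_lt
          (by fun_prop : Continuous fun z : Spc m × ℝ => ‖z.1 - P.1‖).continuousAt h] with z hz
        exact Or.inl hz.le
      · filter_upwards [continuousAt_const.eventually_lt
          (by fun_prop : Continuous fun z : Spc m × ℝ => z.2 - P.2).continuousAt h] with z hz
        exact Or.inr hz.le
    filter_upwards [h1, h2, h3] with z h1 h2 h3 h4
    exact ⟨⟨by simpa [dist_eq_norm] using h1.le, by linarith, h4⟩, h3⟩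
  have hpT : p.2 ≤ P.2 + T := hpD.1.2.2
  set k := ℓ / C with hk
  have hkpos : 0 < k := by positivity
  have hcmp : ∀ z ∈ D, w p + k * (G z - G p) ≤ w z := by
    intro z hz
    have h := hpmin hz
    simp only [hψ] at h
    have e1 : k * (G z - G p) = ℓ * (G z / C - (s / R) ^ (2 * q) - δ) -
        ℓ * (G p / C - (s / R) ^ (2 * q) - δ) := by rw [hk]; field_simp; ring
    have h' : w p - ℓ * (G p / C - (s / R) ^ (2 * q) - δ) ≤
      w z - ℓ * (G z / C - (s / R) ^ (2 * q) - δ) := h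
    linarith
  set ξ := p.1 - P.1 with hξ
  set τ := p.2 - P.2 with hτdef
  have hGp : G p = gbar lam s q ξ τ := rfl
  have hsup := hS p ⟨by simpa [dist_eq_norm] using hpR', by linarith, hpT⟩
  obtain ⟨e, μ, hμ, hsum⟩ := SupAt.touch (A := fun v => k * (G p * -(inner ℝ ξ v / (2 * lam * τ))))
    (B := fun v => k * (G p * ((inner ℝ ξ v) ^ 2 / (4 * lam ^ 2 * τ ^ 2) - 1 / (2 * lam * τ))))
    (c := k * (G p * (‖ξ‖ ^ 2 / (4 * lam * τ ^ 2) - q / τ))) hl.le hsup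
    (by
      intro v hv ε hε
      have hc : Tendsto (fun σ : ℝ => ((p.1 + σ • v, p.2) : Spc m × ℝ)) (𝓝 0) (𝓝 p) := by
        have : Continuous (fun σ : ℝ => ((p.1 + σ • v, p.2) : Spc m × ℝ)) := by fun_prop
        simpa using this.tendsto 0
      filter_upwards [hc.eventually hnear, gbar_horizontal hl hs hτ q ξ v hv
        (ε := ε / k) (by positivity)] with σ h1 h2
      have h3 := hcmp _ (h1 hpT)
      have h4 : G (p.1 + σ • v, p.2) = gbar lam s q (ξ + σ • v) τ := by
        simp only [hG, hξ]; congr 1; abel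
      rw [h4] at h3
      rw [← hGp] at h2
      have h5 := mul_le_mul_of_nonneg_left h2 hkpos.le
      refine le_trans (le_of_eq ?_) (le_trans (add_le_add_right (sub_le_sub_right h5 (k * G p)) (w p))
        (le_trans (le_of_eq ?_) h3))
      · field_simp; ring
      · ring)
    (by
      intro ε hε
      have hc : Tendsto (fun σ : ℝ => ((p.1, p.2 - σ) : Spc m × ℝ)) (𝓝[>] 0) (𝓝 p) := by
        have : Continuous (fun σ : ℝ => ((p.1, p.2 - σ) : Spc m × ℝ)) := by fun_prop
        have := this.tendsto 0
        simp only [sub_zero] at this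
        exact this.mono_left nhdsWithin_le_nhds
      filter_upwards [hc.eventually hnear, gbar_vertical (s := s) hl hτ q hq1 ξ
        (ε := ε / k) (by positivity), self_mem_nhdsWithin] with σ h1 h2 h0
      have h0 : 0 < σ := h0
      have h3 := hcmp _ (h1 (by show p.2 - σ ≤ P.2 + T; linarith))
      have h4 : G (p.1, p.2 - σ) = gbar lam s q ξ (τ - σ) := by
        simp only [hG, hξ, hτdef]; congr 1; ring
      rw [h4] at h3
      rw [← hGp] at h2
      have h5 := mul_le_mul_of_nonneg_left h2 hkpos.le
      refine le_trans (le_of_eq ?_) (le_trans (add_le_add_right (sub_le_sub_right h5 (k * G p)) (w p))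
        (le_trans (le_of_eq ?_) h3))
      · field_simp; ring
      · ring)
  have hpars : ∑ i, (inner ℝ ξ (e i)) ^ 2 = ‖ξ‖ ^ 2 := by
    have := e.sum_sq_norm_inner_left ξ
    simpa using this
  have hlow : ‖ξ‖ ^ 2 / (4 * lam * τ ^ 2) - (m + 1) * Lam / (2 * lam * τ) ≤
      ∑ i, μ i * ((inner ℝ ξ (e i)) ^ 2 / (4 * lam ^ 2 * τ ^ 2) - 1 / (2 * lam * τ)) := by
    have h1 : ∀ i, lam * ((inner ℝ ξ (e i)) ^ 2 / (4 * lam ^ 2 * τ ^ 2)) - Lam / (2 * lam * τ) ≤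
        μ i * ((inner ℝ ξ (e i)) ^ 2 / (4 * lam ^ 2 * τ ^ 2) - 1 / (2 * lam * τ)) := by
      intro i
      have h2 : 0 ≤ (inner ℝ ξ (e i)) ^ 2 / (4 * lam ^ 2 * τ ^ 2) := by positivity
      have h3 : 0 ≤ 1 / (2 * lam * τ) := by positivity
      have h4 := mul_le_mul_of_nonneg_right (hμ i).1 h2
      have h5 := mul_le_mul_of_nonneg_right (hμ i).2 h3
      rw [div_eq_mul_one_div Lam, mul_sub (μ i)]
      exact sub_le_sub h4 h5
    refine le_trans (le_of_eq ?_) (Finset.sum_le_sum fun i _ => h1 i)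
    rw [Finset.sum_sub_distrib, ← Finset.mul_sum, ← Finset.sum_div, hpars, Finset.sum_const,
      Finset.card_univ, Fintype.card_fin, nsmul_eq_mul]
    push_cast
    field_simp
  have hsum2 : ∑ i, μ i * (k * (G p * ((inner ℝ ξ (e i)) ^ 2 / (4 * lam ^ 2 * τ ^ 2) -
      1 / (2 * lam * τ)))) = k * G p *
      ∑ i, μ i * ((inner ℝ ξ (e i)) ^ 2 / (4 * lam ^ 2 * τ ^ 2) - 1 / (2 * lam * τ)) := by
    rw [Finset.mul_sum]; exact Finset.sum_congr rfl fun i _ => by ring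
  rw [hsum2, ← mul_assoc k] at hsum
  have hkG : 0 < k * G p := by positivity
  have h1 := le_of_mul_le_mul_left hsum hkG
  have h2 : (m + 1) * Lam / (2 * lam * τ) < q / τ := by
    rw [← div_div]; gcongr
  linarith

/-- Propagation of a lower bound from a small cylinder to a later one. -/
lemma spread (m : ℕ) {lam Lam : ℝ} (hl : 0 < lam) (hL : lam ≤ Lam) :
    ∃ γ : ℕ, 1 ≤ γ ∧ ∀ σ τ₀ T : ℝ, 0 < σ → 0 < τ₀ → τ₀ ≤ T → ∃ c R : ℝ, 0 < c ∧ σ ≤ R ∧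
      ∀ (w : Spc m × ℝ → ℝ) (P : Spc m × ℝ) (s ρ ℓ T' : ℝ), 0 < s → 0 < ρ → 0 < ℓ → s ≤ R →
      s ^ 2 ≤ τ₀ → T' ≤ T →
      ContinuousOn w (Metric.closedBall P.1 (R * ρ) ×ˢ Icc P.2 (P.2 + T' * ρ ^ 2)) →
      (∀ z ∈ Metric.closedBall P.1 (R * ρ) ×ˢ Icc P.2 (P.2 + T' * ρ ^ 2), 0 ≤ w z) →
      (∀ z ∈ Metric.ball P.1 (R * ρ) ×ˢ Ioc P.2 (P.2 + T' * ρ ^ 2), SupAt lam Lam w z) →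
      (∀ z ∈ Metric.closedBall P.1 (s * ρ) ×ˢ Icc P.2 (P.2 + (s * ρ) ^ 2), ℓ ≤ w z) →
      ∀ z ∈ Metric.closedBall P.1 (σ * ρ) ×ˢ Icc (P.2 + τ₀ * ρ ^ 2) (P.2 + T' * ρ ^ 2),
        c * s ^ γ * ℓ ≤ w z := by
  obtain ⟨q, hq⟩ := exists_nat_gt ((m + 1) * Lam / (2 * lam))
  have hLam : 0 < Lam := hl.trans_le hL
  have hq1 : 1 ≤ q := by
    have h1 : 0 < (m + 1) * Lam / (2 * lam) := by positivity
    have : (0 : ℝ) < q := h1.trans hq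
    exact_mod_cast this
  refine ⟨2 * q, by omega, fun σ τ₀ T hσ hτ₀ hT => ?_⟩
  have hTpos : 0 < T := hτ₀.trans_le hT
  have hC := barC_pos lam q
  set a : ℝ := (1 / T) ^ q * Real.exp (-(σ ^ 2 / (4 * lam * τ₀))) / barC lam q with ha
  have hapos : 0 < a := by positivity
  set R : ℝ := max σ (max 1 (2 / a)) with hR
  have hR1 : 1 ≤ R := (le_max_left _ _).trans (le_max_right _ _)
  have hRa : (1 / R) ^ (2 * q) ≤ a / 2 := by
    have h1 : 2 / a ≤ R := (le_max_right _ _).trans (le_max_right _ _)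
    have h2 : 1 / R ≤ a / 2 := by
      rw [div_le_div_iff₀ (by positivity) (by positivity)]
      rw [div_le_iff₀ hapos] at h1
      linarith
    refine le_trans ?_ h2
    refine pow_le_of_le_one (by positivity) ?_ (by omega)
    rw [div_le_one (by positivity)]; exact hR1
  refine ⟨a / 2, R, by positivity, le_max_left _ _, ?_⟩
  intro w P s ρ ℓ T' hs hρ hℓ hsR hsτ hT' hw h0 hS hb z hz
  have hz' : z ∈ Metric.closedBall P.1 (R * ρ) ×ˢ Icc (P.2 + (s * ρ) ^ 2) (P.2 + T' * ρ ^ 2) := by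
    refine ⟨Metric.closedBall_subset_closedBall ?_ hz.1, ?_, hz.2.2⟩
    · gcongr; exact le_max_left _ _
    · refine le_trans ?_ hz.2.1
      rw [mul_pow]; gcongr
  have h := spread_lower hl hq1 hq (s := s * ρ) (R := R * ρ) (by positivity) (by gcongr) hℓ hw h0 hS
    hb hz'
  refine le_trans ?_ h
  rw [mul_comm _ ℓ]
  refine mul_le_mul_of_nonneg_left ?_ hℓ.le
  have hτ1 : τ₀ * ρ ^ 2 ≤ z.2 - P.2 := by linarith [hz.2.1]
  have hτ2 : z.2 - P.2 ≤ T * ρ ^ 2 := by nlinarith [hz.2.2, sq_nonneg ρ]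
  have hτp : 0 < z.2 - P.2 := lt_of_lt_of_le (by positivity) hτ1
  have hx : ‖z.1 - P.1‖ ≤ σ * ρ := by simpa [dist_eq_norm] using hz.1
  have h1 : s ^ (2 * q) * a ≤ gbar lam (s * ρ) q (z.1 - P.1) (z.2 - P.2) / barC lam q := by
    rw [ha, ← mul_div_assoc]
    refine div_le_div_of_nonneg_right ?_ hC.le
    unfold gbar
    rw [← mul_assoc]
    refine mul_le_mul ?_ (Real.exp_le_exp.2 (neg_le_neg ?_)) (by positivity) (by positivity)
    · rw [pow_mul, ← mul_pow]
      gcongr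
      rw [mul_one_div, div_le_div_iff₀ hTpos hτp, mul_pow]
      nlinarith [sq_nonneg s]
    · rw [div_le_div_iff₀ (by positivity) (by positivity)]
      have h2 : ‖z.1 - P.1‖ ^ 2 ≤ (σ * ρ) ^ 2 := by gcongr
      calc ‖z.1 - P.1‖ ^ 2 * (4 * lam * τ₀) ≤ (σ * ρ) ^ 2 * (4 * lam * τ₀) := by gcongr
        _ = σ ^ 2 * (4 * lam * (τ₀ * ρ ^ 2)) := by ring
        _ ≤ σ ^ 2 * (4 * lam * (z.2 - P.2)) := by gcongr
  have h2 : (s * ρ / (R * ρ)) ^ (2 * q) ≤ s ^ (2 * q) * (a / 2) := by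
    rw [mul_div_mul_right _ _ hρ.ne', div_eq_mul_one_div, mul_pow]
    gcongr
  linarith

/-- A nonnegative continuous supersolution on `D`. -/
def PosSup {m : ℕ} (lam Lam : ℝ) (w : Spc m × ℝ → ℝ) (D : Set (Spc m × ℝ)) : Prop :=
  ContinuousOn w D ∧ (∀ z ∈ D, 0 ≤ w z) ∧ ∀ z ∈ D, SupAt lam Lam w z

lemma PosSup.mono {m : ℕ} {lam Lam : ℝ} {w : Spc m × ℝ → ℝ} {D D' : Set (Spc m × ℝ)}
    (h : PosSup lam Lam w D) (hD : D' ⊆ D) : PosSup lam Lam w D' :=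
  ⟨h.1.mono hD, fun z hz => h.2.1 z (hD hz), fun z hz => h.2.2 z (hD hz)⟩

/-- The closed symmetric box of size `a` in space and `b` in time. -/
def box {m : ℕ} (X : Spc m × ℝ) (a b : ℝ) : Set (Spc m × ℝ) :=
  Metric.closedBall X.1 a ×ˢ Icc (X.2 - b) (X.2 + b)

lemma mem_box {m : ℕ} {X z : Spc m × ℝ} {a b : ℝ} :
    z ∈ box X a b ↔ ‖z.1 - X.1‖ ≤ a ∧ |z.2 - X.2| ≤ b := by
  simp only [box, mem_prod, Metric.mem_closedBall, dist_eq_norm, mem_Icc, abs_le]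
  constructor
  · rintro ⟨h1, h2, h3⟩; exact ⟨h1, by linarith, by linarith⟩
  · rintro ⟨h1, h2, h3⟩; exact ⟨h1, by linarith, by linarith⟩

lemma box_trans {m : ℕ} {X Y z : Spc m × ℝ} {a b a' b' : ℝ} (h : Y ∈ box X a b)
    (h' : z ∈ box Y a' b') : z ∈ box X (a + a') (b + b') := by
  rw [mem_box] at *
  constructor
  · have : z.1 - X.1 = (Y.1 - X.1) + (z.1 - Y.1) := by abel
    rw [this]; exact (norm_add_le _ _).trans (add_le_add h.1 h'.1)
  · have : z.2 - X.2 = (Y.2 - X.2) + (z.2 - Y.2) := by ring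
    rw [this]; exact (abs_add_le _ _).trans (add_le_add h.2 h'.2)

lemma box_mono {m : ℕ} {X : Spc m × ℝ} {a b a' b' : ℝ} (h : a ≤ a') (hb : b ≤ b') :
    box X a b ⊆ box X a' b' := by
  intro z hz
  rw [mem_box] at *
  exact ⟨hz.1.trans h, hz.2.trans hb⟩

/-- Consequences of `{w > ℓ}` filling most of a backward cylinder. -/
lemma dense_forward (m : ℕ) {lam Lam : ℝ} (hl : 0 < lam) (hL : lam ≤ Lam) :
    ∃ ε c L : ℝ, 0 < ε ∧ 0 < c ∧ c ≤ 1 / 2 ∧ 1 ≤ L ∧ ∀ (w : Spc m × ℝ → ℝ) (D E : Set (Spc m × ℝ))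
      (Y : Spc m × ℝ) (ρ ℓ : ℝ), 0 < ρ → 0 < ℓ → PosSup lam Lam w D → (∀ z ∈ E, ℓ < w z) →
      box Y (L * ρ) (L * ρ ^ 2) ⊆ D →
      volume (bcyl Y ρ \ E) ≤ ENNReal.ofReal (ε * ρ ^ (m + 3)) →
      (∀ z ∈ Metric.closedBall Y.1 (ρ / 2) ×ˢ Icc (Y.2 - ρ ^ 2 / 2) (Y.2 - ρ ^ 2 / 4),
        c * ℓ ≤ w z) ∧
      (∀ z ∈ bcyl (Y.1, Y.2 + 5 * ρ ^ 2) (2 * ρ), c * ℓ < w z) := by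
  obtain ⟨ε, hε, hsm⟩ := small_measure m hl hL (κ := 1 / 2) (by norm_num) (by norm_num)
  obtain ⟨γ, hγ, hsp⟩ := spread m hl hL
  obtain ⟨c, R, hc, hR, hsp⟩ := hsp 2 1 6 (by norm_num) (by norm_num) (by norm_num)
  refine ⟨ε / 2 ^ (m + 3), min (1 / 2) (c * (1 / 2) ^ γ / 4), R + 10, by positivity, by positivity,
    min_le_left _ _, by linarith, ?_⟩
  intro w D E Y ρ ℓ hρ hℓ hw hE hD hvol
  have hρ2 : 0 < ρ ^ 2 := by positivity
  have hlow : ∀ z ∈ Metric.closedBall Y.1 (ρ / 2) ×ˢ Icc (Y.2 - ρ ^ 2 / 2) (Y.2 - ρ ^ 2 / 4),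
      ℓ / 2 ≤ w z := by
    rintro P ⟨hP1, hP2⟩
    have hP1' : ‖P.1 - Y.1‖ ≤ ρ / 2 := by simpa [dist_eq_norm] using hP1
    have hsub : Metric.closedBall P.1 (ρ / 2) ×ˢ Icc (P.2 - (ρ / 2) ^ 2) P.2 ⊆ D := by
      rintro z ⟨h1, h2⟩
      refine hD (mem_box.2 ⟨?_, ?_⟩)
      · have h1' : ‖z.1 - P.1‖ ≤ ρ / 2 := by simpa [dist_eq_norm] using h1
        have : z.1 - Y.1 = (z.1 - P.1) + (P.1 - Y.1) := by abel
        rw [this]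
        refine (norm_add_le _ _).trans ?_
        nlinarith
      · rw [abs_le]
        constructor <;> nlinarith [h2.1, h2.2, hP2.1, hP2.2]
    have h := hsm w P (ρ / 2) ℓ (by positivity) hℓ (hw.1.mono hsub) (fun z hz => hw.2.1 z (hsub hz))
      (fun z hz => hw.2.2 z (hsub ⟨Metric.ball_subset_closedBall hz.1, Ioc_subset_Icc_self hz.2⟩)) ?_
    · linarith
    · refine (measure_mono ?_).trans (hvol.trans (le_of_eq ?_))
      · rintro z ⟨⟨h1, h2⟩, h3⟩
        have h1' : ‖z.1 - P.1‖ < ρ / 2 := by simpa [dist_eq_norm] using h1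
        refine ⟨⟨?_, ?_, ?_⟩, fun hz => (hE z hz).not_gt h3⟩
        · rw [Metric.mem_ball, dist_eq_norm]
          have : z.1 - Y.1 = (z.1 - P.1) + (P.1 - Y.1) := by abel
          rw [this]
          refine (norm_add_le _ _).trans_lt ?_
          linarith
        · nlinarith [h2.1, hP2.1]
        · nlinarith [h2.2, hP2.2]
      · congr 1; rw [div_pow]; ring
  refine ⟨fun z hz => le_trans ?_ (hlow z hz), ?_⟩
  · have : min (1 / 2) (c * (1 / 2) ^ γ / 4) * ℓ ≤ 1 / 2 * ℓ :=
      mul_le_mul_of_nonneg_right (min_le_left _ _) hℓ.le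
    linarith
  · rintro z ⟨hz1, hz2⟩
    have hsub : Metric.closedBall Y.1 (R * ρ) ×ˢ Icc (Y.2 - ρ ^ 2 / 2) (Y.2 - ρ ^ 2 / 2 + 6 * ρ ^ 2)
        ⊆ D := by
      rintro z ⟨h1, h2⟩
      refine hD (mem_box.2 ⟨?_, ?_⟩)
      · have h1' : ‖z.1 - Y.1‖ ≤ R * ρ := by simpa [dist_eq_norm] using h1
        nlinarith
      · rw [abs_le]
        constructor <;> nlinarith [h2.1, h2.2]
    have h := hsp w (Y.1, Y.2 - ρ ^ 2 / 2) (1 / 2) ρ (ℓ / 2) 6 (by norm_num) hρ (by positivity)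
      (by linarith) (by norm_num) le_rfl (hw.1.mono hsub) (fun z hz => hw.2.1 z (hsub hz))
      (fun z hz => hw.2.2 z (hsub ⟨Metric.ball_subset_closedBall hz.1, Ioc_subset_Icc_self hz.2⟩))
      (fun z hz => hlow z ⟨by simpa [mul_comm, div_eq_mul_inv] using hz.1, hz.2.1, by
        have := hz.2.2
        simp only at this ⊢
        nlinarith⟩) z ⟨Metric.ball_subset_closedBall hz1, ?_, ?_⟩
    · refine lt_of_lt_of_le ?_ h
      have : min (1 / 2) (c * (1 / 2) ^ γ / 4) * ℓ ≤ c * (1 / 2) ^ γ / 4 * ℓ :=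
        mul_le_mul_of_nonneg_right (min_le_right _ _) hℓ.le
      have h2 : 0 < c * (1 / 2) ^ γ * ℓ := by positivity
      linarith
    · have := hz2.1
      simp only at this ⊢
      nlinarith
    · have := hz2.2
      simp only at this ⊢
      nlinarith

lemma growth_step (m : ℕ) {lam Lam : ℝ} (hl : 0 < lam) (hL : lam ≤ Lam) :
    ∃ c δ L : ℝ, 0 < c ∧ c ≤ 1 / 2 ∧ 0 < δ ∧ 1 ≤ L ∧ ∀ (w : Spc m × ℝ → ℝ) (D E : Set (Spc m × ℝ))
      (r ℓ : ℝ), 0 < r → 0 < ℓ → PosSup lam Lam w D → IsOpen E → volume E < ⊤ →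
      (∀ z ∈ E, ℓ < w z) → (∀ X ∈ E, box X (L * r) (L * r ^ 2) ⊆ D) →
      (∃ X ∈ E, ∃ Y, Y ∈ box X (2 * r) (2 * r ^ 2) ∧
        ∀ z ∈ Metric.closedBall Y.1 (r / 2) ×ˢ Icc (Y.2 - r ^ 2 / 2) (Y.2 - r ^ 2 / 4),
          c * ℓ ≤ w z) ∨
      ∃ E' : Set (Spc m × ℝ), IsOpen E' ∧ (∀ z ∈ E', c * ℓ < w z) ∧
        (∀ z ∈ E', ∃ X ∈ E, z ∈ box X (L * r) (L * r ^ 2)) ∧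
        ENNReal.ofReal (1 + δ) * volume E ≤ volume E' := by
  obtain ⟨ε, c, L, hε, hc, hc1, hL1, hdf⟩ := dense_forward m hl hL
  have hV := unitVol_pos m
  have hV' := unitVol_lt_top m
  set V := (unitVol m).toReal with hVdef
  have hVpos : 0 < V := ENNReal.toReal_pos hV.ne' hV'.ne
  have hVeq : unitVol m = ENNReal.ofReal V := (ENNReal.ofReal_toReal hV'.ne).symm
  set B : ℝ := 8 ^ (m + 1) * 28 with hB
  have hBpos : 0 < B := by positivity
  refine ⟨c, ε / (B * V), L + 8, hc, hc1, by positivity, by linarith, ?_⟩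
  intro w D E r ℓ hr hℓ hw hEo hEf hE hD
  have hstep : ∀ X ∈ E, ∀ Y, ∀ ρ, 0 < ρ → ρ ≤ r → X ∈ box Y (2 * ρ) (2 * ρ ^ 2) →
      box Y (L * ρ) (L * ρ ^ 2) ⊆ D := by
    intro X hX Y ρ hρ hρr hXY z hz
    have hYX : Y ∈ box X (2 * ρ) (2 * ρ ^ 2) := by
      rw [mem_box] at hXY ⊢
      rw [norm_sub_rev, abs_sub_comm] at hXY
      exact hXY
    have hρ2 : ρ ^ 2 ≤ r ^ 2 := by gcongr
    refine hD X hX (box_mono ?_ ?_ (box_trans hYX hz)) <;> nlinarith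
  by_contra hcon
  push Not at hcon
  obtain ⟨hcon1, hcon2⟩ := hcon
  set Good : Spc m × ℝ → ℝ → Prop := fun Y ρ =>
    volume (bcyl Y ρ \ E) ≤ ENNReal.ofReal (ε * ρ ^ (m + 3)) with hGood
  set rad : ℕ → ℝ := fun i => r / 2 ^ i with hrad
  have hradpos : ∀ i, 0 < rad i := fun i => by simp only [hrad]; positivity
  have hradle : ∀ i, rad i ≤ r := fun i => div_le_self hr.le (one_le_pow₀ (by norm_num))
  have hselect : ∀ X ∈ E, ∃ (Y : Spc m × ℝ) (ρ : ℝ), 0 < ρ ∧ 2 * ρ ≤ r ∧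
      X ∈ box Y (2 * ρ) (2 * ρ ^ 2) ∧ Good Y ρ ∧ ¬ Good (Y.1, Y.2 + 5 * ρ ^ 2) (2 * ρ) := by
    intro X hX
    have hex : ∃ i, ∃ Y, X ∈ box Y (2 * rad i) (2 * rad i ^ 2) ∧ Good Y (rad i) := by
      obtain ⟨η, hη, hηE⟩ := Metric.isOpen_iff.1 hEo X hX
      have ht : Tendsto rad atTop (𝓝 0) := by
        have := tendsto_const_nhds (x := r).div_atTop
          (tendsto_pow_atTop_atTop_of_one_lt (one_lt_two : (1 : ℝ) < 2))
        exact this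
      obtain ⟨i, hi⟩ := (ht.eventually (gt_mem_nhds (lt_min one_pos hη))).exists
      have hi1 := hi.trans_le (min_le_left _ _)
      have hi2 := hi.trans_le (min_le_right _ _)
      have hip := hradpos i
      refine ⟨i, X, mem_box.2 ⟨by simp; positivity, by simp; positivity⟩, ?_⟩
      have hsub : bcyl X (rad i) ⊆ E := by
        rintro z ⟨h1, h2⟩
        refine hηE ?_
        rw [Metric.mem_ball, Prod.dist_eq]
        refine max_lt ((Metric.mem_ball.1 h1).trans hi2) ?_
        rw [Real.dist_eq, abs_lt]
        constructor <;> nlinarith [h2.1, h2.2]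
      simp only [hGood]
      rw [sdiff_eq_empty.2 hsub, measure_empty]
      exact zero_le
    obtain ⟨Y, hXY, hY⟩ := Nat.find_spec hex
    set i := Nat.find hex with hi
    rcases Nat.eq_zero_or_pos i with h0 | hpos
    · exfalso
      have hr0 : rad i = r := by simp only [hrad, h0]; simp
      rw [hr0] at hXY hY
      obtain ⟨z, hz, hzlt⟩ := hcon1 X hX Y (by
        rw [mem_box] at hXY ⊢
        rw [norm_sub_rev, abs_sub_comm] at hXY
        exact hXY)
      exact absurd ((hdf w D E Y r ℓ hr hℓ hw hE (hstep X hX Y r hr le_rfl hXY) hY).1 z hz)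
        (not_le.2 hzlt)
    · have h2 : 2 * rad i = rad (i - 1) := by
        obtain ⟨j, hj⟩ : ∃ j, i = j + 1 := ⟨i - 1, by omega⟩
        rw [hj]; simp only [hrad, Nat.add_sub_cancel, pow_succ]; field_simp
      refine ⟨Y, rad i, hradpos i, by rw [h2]; exact hradle _, hXY, hY, fun hg => ?_⟩
      refine Nat.find_min hex (m := i - 1) (by omega) ⟨_, ?_, h2 ▸ hg⟩
      rw [← h2]
      rw [mem_box] at hXY ⊢
      have := hradpos i
      refine ⟨by simpa using hXY.1.trans (by linarith), ?_⟩
      have h3 := abs_le.1 hXY.2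
      simp only
      rw [abs_le]
      constructor <;> nlinarith
  choose! Y ρ hρ hρr hXY hgood hbad using hselect
  set Z : Spc m × ℝ → Spc m × ℝ := fun X => ((Y X).1, (Y X).2 + 5 * ρ X ^ 2) with hZ
  obtain ⟨u, huE, huc, hud, hucov⟩ := exists_parabolic_vitali E Z (fun X => 2 * ρ X) r
    (fun X hX => ⟨by have := hρ X hX; positivity, hρr X hX⟩)
  set S : Spc m × ℝ → Set (Spc m × ℝ) := fun X => bcyl (Z X) (2 * ρ X) with hS
  have hSw : ∀ X ∈ E, ∀ z ∈ S X, c * ℓ < w z := fun X hX =>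
    (hdf w D E (Y X) (ρ X) ℓ (hρ X hX) hℓ hw hE (hstep X hX _ _ (hρ X hX)
      (by linarith [hρ X hX, hρr X hX]) (hXY X hX)) (hgood X hX)).2
  have hSo : ∀ X, IsOpen (S X) := fun X => isOpen_bcyl _ _
  set E' : Set (Spc m × ℝ) := E ∪ ⋃ X ∈ u, S X with hE'
  refine absurd ?_ (not_le.2 (hcon2 E' (hEo.union (isOpen_biUnion fun X _ => hSo X)) ?_ ?_))
  · have hEcov : E ⊆ ⋃ b ∈ u, Metric.ball (Z b).1 (8 * (2 * ρ b)) ×ˢ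
        Ioo ((Z b).2 - 14 * (2 * ρ b) ^ 2) ((Z b).2 + 14 * (2 * ρ b) ^ 2) := by
      intro X hX
      obtain ⟨b, hb, h1, h2, h3⟩ := hucov X hX
      have hρX := hρ X hX
      have hρb := hρ b (huE hb)
      have h4 := mem_box.1 (hXY X hX)
      refine mem_biUnion hb ⟨?_, ?_⟩
      · rw [Metric.mem_ball, dist_eq_norm]
        have e1 : X.1 - (Z b).1 = (X.1 - (Y X).1) + ((Z X).1 - (Z b).1) := by
          simp only [hZ]; abel
        rw [e1]
        refine (norm_add_le _ _).trans_lt ?_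
        linarith [h4.1]
      · have h5 := abs_le.1 h4.2
        have h6 := abs_le.1 h3
        have h7 : (Z X).2 = (Y X).2 + 5 * ρ X ^ 2 := rfl
        have h8 : ρ X ^ 2 ≤ (2 * ρ b) ^ 2 := by
          refine pow_le_pow_left₀ hρX.le ?_ 2
          linarith
        have h9 : 0 < (2 * ρ b) ^ 2 := by positivity
        constructor <;> linarith [h5.1, h5.2, h6.1, h6.2]
    have hvolcov : volume E ≤ ∑' b : u, ENNReal.ofReal (B * V * (2 * ρ b) ^ (m + 3)) := by
      refine (measure_mono hEcov).trans ((measure_biUnion_le _ huc _).trans (le_of_eq ?_))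
      refine tsum_congr fun b => ?_
      have hρb := hρ b (huE b.2)
      rw [volume_ball_prod_Ioo _ (by positivity), hVeq, ← ENNReal.ofReal_mul (by
        have : (Z b).2 + 14 * (2 * ρ b) ^ 2 - ((Z b).2 - 14 * (2 * ρ b) ^ 2) =
          28 * (2 * ρ b) ^ 2 := by ring
        rw [this]; positivity)]
      congr 1
      rw [hB, mul_pow 8]; ring
    have hvolS : ∑' b : u, ENNReal.ofReal (ε * (2 * ρ b) ^ (m + 3)) ≤
        volume ((⋃ X ∈ u, S X) \ E) := by
      have e1 : (⋃ X ∈ u, S X) \ E = ⋃ X ∈ u, (S X \ E) := by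
        ext z; simp only [Set.mem_sdiff, mem_iUnion, exists_prop]; tauto
      rw [e1, measure_biUnion huc (hud.mono fun X => sdiff_subset)
        (fun X _ => (hSo X).measurableSet.diff hEo.measurableSet)]
      refine ENNReal.tsum_le_tsum fun b => ?_
      have := hbad b (huE b.2)
      exact (not_le.1 this).le
    have hE'vol : volume E' = volume E + volume ((⋃ X ∈ u, S X) \ E) := by
      rw [hE', ← union_sdiff_self, measure_union disjoint_sdiff_right]
      exact (isOpen_biUnion fun X _ => hSo X).measurableSet.diff hEo.measurableSet
    have hprop : ENNReal.ofReal (ε / (B * V)) * volume E ≤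
        ∑' b : u, ENNReal.ofReal (ε * (2 * ρ b) ^ (m + 3)) := by
      refine (mul_le_mul_right hvolcov _).trans (le_of_eq ?_)
      rw [← ENNReal.tsum_mul_left]
      refine tsum_congr fun b => ?_
      rw [← ENNReal.ofReal_mul (by positivity)]
      congr 1
      field_simp
    rw [hE'vol, ENNReal.ofReal_add zero_le_one (by positivity), add_mul, ENNReal.ofReal_one, one_mul]
    exact add_le_add le_rfl (hprop.trans hvolS)
  · rintro z (hz | hz)
    · have := hE z hz
      nlinarith
    · obtain ⟨X, hX, hz⟩ := mem_iUnion₂.1 hz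
      exact hSw X (huE hX) z hz
  · rintro z (hz | hz)
    · exact ⟨z, hz, mem_box.2 ⟨by simp; positivity, by simp; positivity⟩⟩
    · obtain ⟨X, hX, hz⟩ := mem_iUnion₂.1 hz
      have hρX := hρ X (huE hX)
      have hρX2 := hρr X (huE hX)
      have h1 := mem_box.1 (hXY X (huE hX))
      refine ⟨X, huE hX, mem_box.2 ⟨?_, ?_⟩⟩
      · have h2 : ‖z.1 - (Y X).1‖ < 2 * ρ X := by simpa [dist_eq_norm, hS, bcyl] using hz.1
        have e1 : z.1 - X.1 = (z.1 - (Y X).1) - (X.1 - (Y X).1) := by abel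
        rw [e1]
        refine (norm_sub_le _ _).trans ?_
        nlinarith [h1.1]
      · have h3 := abs_le.1 h1.2
        have h4 : (Y X).2 + 5 * ρ X ^ 2 - (2 * ρ X) ^ 2 < z.2 := hz.2.1
        have h5 : z.2 < (Y X).2 + 5 * ρ X ^ 2 := hz.2.2
        have h6 : (2 * ρ X) ^ 2 ≤ r ^ 2 := by gcongr
        rw [abs_le]
        constructor <;> nlinarith

set_option maxHeartbeats 800000 in
/-- A supersolution which is large on a set of positive measure is bounded below on a cylinder. -/
lemma exists_lower_cylinder (m : ℕ) {lam Lam : ℝ} (hl : 0 < lam) (hL : lam ≤ Lam) {μ θ : ℝ}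
    (hμ : 0 < μ) (hθ : 0 < θ) (hθ1 : θ ≤ 1) :
    ∃ c s : ℝ, 0 < c ∧ 0 < s ∧ s ≤ 1 ∧ ∀ (w : Spc m × ℝ → ℝ) (D E : Set (Spc m × ℝ))
      (X : Spc m × ℝ) (r ℓ : ℝ), 0 < r → 0 < ℓ → PosSup lam Lam w D → IsOpen E → E ⊆ bcyl X r →
      (∀ z ∈ E, ℓ < w z) → (∀ Z ∈ E, box Z (θ * r) (θ * r ^ 2) ⊆ D) →
      ENNReal.ofReal (μ * r ^ (m + 3)) ≤ volume E →
      ∃ Z ∈ E, ∃ Y ∈ box Z (θ * r) (θ * r ^ 2),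
        ∀ z ∈ Metric.closedBall Y.1 (s * r) ×ˢ Icc Y.2 (Y.2 + (s * r) ^ 2), c * ℓ ≤ w z := by
  obtain ⟨c, δ, L, hc, hc1, hδ, hL1, hgs⟩ := growth_step m hl hL
  have hV := unitVol_pos m
  have hV' := unitVol_lt_top m
  set V := (unitVol m).toReal with hVdef
  have hVpos : 0 < V := ENNReal.toReal_pos hV.ne' hV'.ne
  have hVeq : unitVol m = ENNReal.ofReal V := (ENNReal.ofReal_toReal hV'.ne).symm
  obtain ⟨N, hN⟩ := pow_unbounded_of_one_lt (2 ^ (m + 1) * 4 * V / μ) (show 1 < 1 + δ by linarith)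
  rw [div_lt_iff₀ hμ] at hN
  set s : ℝ := θ / ((N + 4) * L) with hs
  have hLpos : 0 < L := by linarith
  have hspos : 0 < s := by positivity
  have hsL : (N + 4) * L * s = θ := by rw [hs]; field_simp
  have hs1 : s ≤ 1 := by
    rw [hs, div_le_one (by positivity)]
    have : (0 : ℝ) ≤ N := Nat.cast_nonneg N
    nlinarith
  refine ⟨c ^ (N + 1), s / 2, by positivity, by positivity, by linarith, ?_⟩
  intro w D E X r ℓ hr hℓ hw hEo hEX hE hD hvol
  have hss : s ^ 2 ≤ s := by nlinarith
  have hr2 : 0 < r ^ 2 := by positivity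
  have hNL : ∀ k ≤ N, (k + 4) * L * s ≤ θ := by
    intro k hk
    rw [← hsL]; gcongr
  by_contra hcon
  push Not at hcon
  have hkN : ∀ k ≤ N, ∀ a : ℝ, 0 ≤ a → a ≤ 4 → (k + a) * L * (s * r) ≤ θ * r ∧
      (k + a) * L * (s * r) ^ 2 ≤ θ * r ^ 2 := by
    intro k hk a ha0 ha
    have h1 : (k + a) * L * s ≤ θ := (show (k + a) * L * s ≤ (k + 4) * L * s by gcongr).trans
      (hNL k hk)
    constructor
    · calc (k + a) * L * (s * r) = (k + a) * L * s * r := by ring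
        _ ≤ θ * r := by gcongr
    · calc (k + a) * L * (s * r) ^ 2 = (k + a) * L * s ^ 2 * r ^ 2 := by ring
        _ ≤ (k + a) * L * s * r ^ 2 := by gcongr
        _ ≤ θ * r ^ 2 := by gcongr
  have hbd : ∀ k ≤ N, ∀ E' : Set (Spc m × ℝ),
      (∀ z ∈ E', ∃ Z ∈ E, z ∈ box Z (k * (L * (s * r))) (k * (L * (s * r) ^ 2))) →
      volume E' ≤ ENNReal.ofReal (2 ^ (m + 1) * 4 * V * r ^ (m + 3)) := by
    intro k hk E' hE'
    have hsub : E' ⊆ Metric.ball X.1 (2 * r) ×ˢ Ioo (X.2 - 2 * r ^ 2) (X.2 + 2 * r ^ 2) := by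
      intro z hz
      obtain ⟨Z, hZ, hzZ⟩ := hE' z hz
      obtain ⟨h1, h2⟩ := hEX hZ
      have h3 := hkN k hk 0 le_rfl (by norm_num)
      have h4 := mem_box.1 hzZ
      have h5 := abs_le.1 h4.2
      have h6 : ‖Z.1 - X.1‖ < r := by simpa [dist_eq_norm] using h1
      refine ⟨?_, ?_, ?_⟩
      · rw [Metric.mem_ball, dist_eq_norm]
        have e1 : z.1 - X.1 = (z.1 - Z.1) + (Z.1 - X.1) := by abel
        rw [e1]
        refine (norm_add_le _ _).trans_lt ?_
        nlinarith
      · nlinarith [h2.1]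
      · nlinarith [h2.2]
    refine (measure_mono hsub).trans (le_of_eq ?_)
    rw [volume_ball_prod_Ioo _ (by positivity), hVeq, ← ENNReal.ofReal_mul (by
      have : X.2 + 2 * r ^ 2 - (X.2 - 2 * r ^ 2) = 4 * r ^ 2 := by ring
      rw [this]; positivity)]
    congr 1
    rw [mul_pow 2 r]; ring
  have hiter : ∀ k ≤ N, ∃ E' : Set (Spc m × ℝ), IsOpen E' ∧ (∀ z ∈ E', c ^ k * ℓ < w z) ∧
      (∀ z ∈ E', ∃ Z ∈ E, z ∈ box Z (k * (L * (s * r))) (k * (L * (s * r) ^ 2))) ∧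
      ENNReal.ofReal ((1 + δ) ^ k * (μ * r ^ (m + 3))) ≤ volume E' := by
    intro k
    induction k with
    | zero =>
      intro _
      refine ⟨E, hEo, fun z hz => by simpa using hE z hz,
        fun z hz => ⟨z, hz, mem_box.2 (by simp)⟩, by simpa using hvol⟩
    | succ k ih =>
      intro hk
      obtain ⟨E', h1, h2, h3, h4⟩ := ih (by omega)
      have hkr := hkN k (by omega)
      have hsr : 0 < s * r := by positivity
      have hD' : ∀ X' ∈ E', box X' (L * (s * r)) (L * (s * r) ^ 2) ⊆ D := by
        intro X' hX'
        obtain ⟨Z, hZ, hXZ⟩ := h3 X' hX'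
        have h6 := hkr 1 (by norm_num) (by norm_num)
        refine fun z hz => hD Z hZ (box_mono ?_ ?_ (box_trans hXZ hz))
        · refine le_trans (le_of_eq ?_) h6.1; ring
        · refine le_trans (le_of_eq ?_) h6.2; ring
      rcases hgs w D E' (s * r) (c ^ k * ℓ) hsr (by positivity) hw h1
        ((hbd k (by omega) E' h3).trans_lt ENNReal.ofReal_lt_top) h2 hD' with
        ⟨X', hX', Y, hY, hYw⟩ | ⟨E'', g1, g2, g3, g4⟩
      · exfalso
        obtain ⟨Z, hZ, hXZ⟩ := h3 X' hX'
        obtain ⟨z, hz, hzlt⟩ := hcon Z hZ (Y.1, Y.2 - (s * r) ^ 2 / 2) (by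
          have h5 := mem_box.1 (box_trans hXZ hY)
          have h6 := hkr 4 (by norm_num) le_rfl
          have h7 : 0 < (s * r) ^ 2 := by positivity
          have h8 := abs_le.1 h5.2
          have e1 : (k + 4) * L * (s * r) = k * (L * (s * r)) + 4 * (L * (s * r)) := by ring
          have e2 : (k + 4) * L * (s * r) ^ 2 = k * (L * (s * r) ^ 2) + 4 * (L * (s * r) ^ 2) := by
            ring
          have a1 : s * r ≤ L * (s * r) := le_mul_of_one_le_left hsr.le hL1
          have a2 : (s * r) ^ 2 ≤ L * (s * r) ^ 2 := le_mul_of_one_le_left h7.le hL1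
          rw [e1, e2] at h6
          refine mem_box.2 ⟨h5.1.trans (by linarith [h6.1]), ?_⟩
          simp only
          rw [abs_le]
          constructor <;> linarith [h6.2, h8.1, h8.2])
        have h5 := hYw z ⟨Metric.closedBall_subset_closedBall (by linarith) hz.1, hz.2.1, by
          have := hz.2.2
          have e1 : (s / 2 * r) ^ 2 = (s * r) ^ 2 / 4 := by ring
          rw [e1] at this
          simp only at this
          linarith⟩
        have h6 : c ^ (N + 1) * ℓ ≤ c * (c ^ k * ℓ) := by
          rw [← mul_assoc, ← pow_succ']
          exact mul_le_mul_of_nonneg_right (pow_le_pow_of_le_one hc.le (by linarith) (by omega)) hℓ.le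
        linarith
      · refine ⟨E'', g1, fun z hz => ?_, fun z hz => ?_, ?_⟩
        · have := g2 z hz
          rwa [← mul_assoc, ← pow_succ'] at this
        · obtain ⟨X', hX', hzX⟩ := g3 z hz
          obtain ⟨Z, hZ, hXZ⟩ := h3 X' hX'
          refine ⟨Z, hZ, ?_⟩
          have := box_trans hXZ hzX
          push_cast
          rw [add_mul, add_mul, one_mul, one_mul]
          exact this
        · refine le_trans (le_of_eq ?_) ((mul_le_mul_right h4 _).trans g4)
          rw [← ENNReal.ofReal_mul (by positivity)]
          congr 1; ring
  obtain ⟨E', -, -, hE'n, hE'v⟩ := hiter N le_rfl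
  have h := hE'v.trans (hbd N le_rfl E' hE'n)
  rw [ENNReal.ofReal_le_ofReal_iff (by positivity)] at h
  have hrm : 0 < r ^ (m + 3) := by positivity
  have h2 := mul_lt_mul_of_pos_right hN hrm
  linarith

/-- A nonnegative continuous solution on `D`, in the pointwise superjet sense. -/
def PosSol {m : ℕ} (lam Lam : ℝ) (u : Spc m × ℝ → ℝ) (D : Set (Spc m × ℝ)) : Prop :=
  PosSup lam Lam u D ∧ ∀ z ∈ D, SupAt lam Lam (fun z => -u z) z

lemma PosSol.mono {m : ℕ} {lam Lam : ℝ} {w : Spc m × ℝ → ℝ} {D D' : Set (Spc m × ℝ)}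
    (h : PosSol lam Lam w D) (hD : D' ⊆ D) : PosSol lam Lam w D' :=
  ⟨h.1.mono hD, fun z hz => h.2 z (hD hz)⟩

/-- The weight used in the Harnack inequality. -/
def hweight {m : ℕ} (ω : ℝ) (z : Spc m × ℝ) : ℝ := min (1 / 2 - ‖z.1‖) (√z.2 + ω)

lemma hweight_half {m : ℕ} {ω : ℝ} {X z : Spc m × ℝ} (hd : 0 ≤ hweight ω X)
    (h1 : ‖z.1 - X.1‖ ≤ hweight ω X / 2) (h2 : X.2 - (hweight ω X / 2) ^ 2 ≤ z.2) (hz : 0 ≤ z.2) :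
    hweight ω X / 2 ≤ hweight ω z := by
  set d := hweight ω X with hdef
  have ha : d ≤ 1 / 2 - ‖X.1‖ := min_le_left _ _
  have hb : d ≤ √X.2 + ω := min_le_right _ _
  refine le_min ?_ ?_
  · have : ‖z.1‖ ≤ ‖z.1 - X.1‖ + ‖X.1‖ := by
      have := norm_add_le (z.1 - X.1) X.1
      simpa using this
    linarith
  · have : √X.2 ≤ √z.2 + d / 2 := by
      rw [Real.sqrt_le_left (by positivity)]
      have := Real.sq_sqrt hz
      nlinarith [Real.sqrt_nonneg z.2]
    linarith

lemma continuous_hweight {m : ℕ} (ω : ℝ) : Continuous (hweight (m := m) ω) := by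
  unfold hweight; fun_prop

/-- Measure estimate at a maximum point: the set where `u` exceeds half of its value is large. -/
lemma measure_at_max (m : ℕ) {lam Lam : ℝ} (hl : 0 < lam) (hL : lam ≤ Lam) (γ : ℕ) :
    ∃ ε > 0, ∀ (v : Spc m × ℝ → ℝ) (X : Spc m × ℝ) (r M : ℝ), 0 < r → 0 < M → v X = M →
      ContinuousOn v (Metric.closedBall X.1 r ×ˢ Icc (X.2 - r ^ 2) X.2) →
      (∀ z ∈ Metric.closedBall X.1 r ×ˢ Icc (X.2 - r ^ 2) X.2, v z ≤ 2 ^ γ * M) →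
      (∀ z ∈ Metric.ball X.1 r ×ˢ Ioc (X.2 - r ^ 2) X.2, M / 2 < v z →
        SupAt lam Lam (fun z => -v z) z) →
      ENNReal.ofReal (ε * r ^ (m + 3)) ≤
        volume {z | z ∈ Metric.ball X.1 r ×ˢ Ioc (X.2 - r ^ 2) X.2 ∧ M / 2 < v z} := by
  obtain ⟨ε, hε, hsm⟩ := small_measure m hl hL (κ := 1 / 2 ^ (γ + 1)) (by positivity) (by
    rw [div_lt_one (by positivity)]
    exact one_lt_pow₀ one_lt_two (by omega))
  refine ⟨ε, hε, fun v X r M hr hM hvX hvc hvle hvs => ?_⟩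
  by_contra hcon
  push Not at hcon
  have h2 : (0 : ℝ) < 2 ^ γ * M := by positivity
  set w : Spc m × ℝ → ℝ := fun z => 1 - max (v z - M / 2) 0 / (2 ^ γ * M) with hw
  have hw1 : ∀ z, w z ≤ 1 := fun z => by
    have : 0 ≤ max (v z - M / 2) 0 / (2 ^ γ * M) := by positivity
    simp only [hw]; linarith
  have hwlt : ∀ z, w z < 1 → M / 2 < v z := by
    intro z hz
    by_contra h
    push Not at h
    simp only [hw, max_eq_right (show v z - M / 2 ≤ 0 by linarith)] at hz
    simp at hz
  have h := hsm w X r 1 hr one_pos ?_ ?_ ?_ ?_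
  · simp only [hw, hvX, max_eq_left (show 0 ≤ M - M / 2 by linarith)] at h
    have e1 : (M - M / 2) / (2 ^ γ * M) = 1 / 2 ^ (γ + 1) := by rw [pow_succ]; field_simp; ring
    rw [e1] at h
    linarith
  · exact continuousOn_const.sub (((hvc.sub continuousOn_const).sup continuousOn_const).div_const _)
  · intro z hz
    simp only [hw, sub_nonneg]
    rw [div_le_one h2]
    exact max_le (by linarith [hvle z hz]) h2.le
  · intro z hz
    rcases lt_or_ge (M / 2) (v z) with h | h
    · have := (hvs z hz h).affine (c := 1 / (2 ^ γ * M)) (by positivity) (1 + M / 2 / (2 ^ γ * M))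
      refine this.mono ?_ (Eventually.of_forall fun y => ?_)
      · simp only [hw, max_eq_left (show 0 ≤ v z - M / 2 by linarith)]; field_simp; ring
      · have : (v y - M / 2) / (2 ^ γ * M) ≤ max (v y - M / 2) 0 / (2 ^ γ * M) := by
          gcongr; exact le_max_left _ _
        have e1 : 1 / (2 ^ γ * M) * -v y + (1 + M / 2 / (2 ^ γ * M)) =
          1 - (v y - M / 2) / (2 ^ γ * M) := by field_simp; ring
        simp only [hw]; linarith
    · refine (SupAt.const hL 1 z).mono ?_ (Eventually.of_forall hw1)
      simp only [hw, max_eq_right (show v z - M / 2 ≤ 0 by linarith)]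
      simp
  · refine le_trans (measure_mono ?_) hcon.le
    rintro z ⟨h1, h2⟩
    exact ⟨h1, hwlt z h2⟩

set_option maxHeartbeats 3000000 in
lemma harnack_core (m : ℕ) {lam Lam : ℝ} (hl : 0 < lam) (hL : lam ≤ Lam) {κ : ℝ} (hκ : 0 < κ)
    (hκ1 : κ ≤ 1) :
    ∃ (γ : ℕ) (C R : ℝ), 0 < C ∧ 1 ≤ R ∧ ∀ (u : Spc m × ℝ → ℝ) (ω M₀ : ℝ), 0 ≤ ω → 0 ≤ M₀ →
      PosSol lam Lam u (Metric.closedBall 0 R ×ˢ Ioc 0 κ) →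
      ContinuousOn u (Metric.closedBall 0 (1 / 2) ×ˢ Icc 0 κ) →
      (ω = 0 ∨ ∀ x ∈ Metric.closedBall (0 : Spc m) (1 / 2), u (x, 0) ≤ M₀) →
      ∀ z ∈ Metric.closedBall (0 : Spc m) (1 / 2) ×ˢ Icc 0 (κ / 2),
      ∀ y ∈ Metric.closedBall (0 : Spc m) 1,
        u z * hweight ω z ^ γ ≤ max (2 * M₀) (C * u (y, κ)) := by
  obtain ⟨γ, hγ, hsp⟩ := spread m hl hL
  obtain ⟨c, R, hc, hR, hsp⟩ := hsp 2 (κ / 4) 1 (by norm_num) (by positivity) (by linarith)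
  obtain ⟨ε, hε, hmm⟩ := measure_at_max m hl hL γ
  have hV := unitVol_pos m
  have hV' := unitVol_lt_top m
  set V := (unitVol m).toReal with hVdef
  have hVpos : 0 < V := ENNReal.toReal_pos hV.ne' hV'.ne
  have hVeq : unitVol m = ENNReal.ofReal V := (ENNReal.ofReal_toReal hV'.ne).symm
  set η : ℝ := ε / (2 * V) with hη
  have hηpos : 0 < η := by positivity
  set θ : ℝ := min η κ with hθ
  have hθpos : 0 < θ := lt_min hηpos hκ
  have hθη : θ ≤ η := min_le_left _ _
  have hθκ : θ ≤ κ := min_le_right _ _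
  obtain ⟨c₁, s₀, hc₁, hs₀, hs₀1, hG⟩ := exists_lower_cylinder m hl hL (μ := ε / 2) (θ := θ)
    (by positivity) hθpos (hθκ.trans hκ1)
  set s := min s₀ (κ / 2) with hs
  have hspos : 0 < s := lt_min hs₀ (by positivity)
  have hss₀ : s ≤ s₀ := min_le_left _ _
  have hsκ : s ≤ κ / 2 := min_le_right _ _
  refine ⟨γ, 2 / (c * (s / 2) ^ γ * c₁), R + 1, by positivity, by linarith, ?_⟩
  intro u ω M₀ hω hM₀ hu huc hbot z hz y hy
  obtain ⟨X, hXK, hXmax⟩ := ((isCompact_closedBall (0 : Spc m) (1 / 2)).prod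
    (isCompact_Icc (a := (0 : ℝ)) (b := κ / 2))).exists_isMaxOn ⟨z, hz⟩
    (f := fun z => u z * hweight ω z ^ γ)
    ((huc.mono (prod_mono le_rfl (Icc_subset_Icc_right (by linarith)))).mul
      ((continuous_hweight ω).pow γ).continuousOn)
  refine (hXmax hz).trans ?_
  show u X * hweight ω X ^ γ ≤ _
  by_contra hcon
  push Not at hcon
  obtain ⟨hcon1, hcon2⟩ := max_lt_iff.1 hcon
  set d := hweight ω X with hd
  set M := u X with hM
  have hXn : ‖X.1‖ ≤ 1 / 2 := by simpa using hXK.1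
  have hX0 : 0 ≤ X.2 := hXK.2.1
  have hd0 : 0 ≤ d := le_min (by linarith) (by positivity)
  have hd1 : d ≤ 1 / 2 := (min_le_left _ _).trans (by linarith [norm_nonneg X.1])
  have hdX : ‖X.1‖ ≤ 1 / 2 - d := by
    have : d ≤ 1 / 2 - ‖X.1‖ := min_le_left _ _
    linarith
  have hMd : 0 < M * d ^ γ := lt_of_le_of_lt (by positivity) hcon1
  have hdpos : 0 < d := by
    rcases hd0.eq_or_lt with h | h
    · rw [← h, zero_pow (by omega), mul_zero] at hMd; exact absurd hMd (lt_irrefl _)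
    · exact h
  have hMpos : 0 < M := pos_of_mul_pos_left hMd (by positivity)
  have hM₀M : 2 * M₀ < M :=
    hcon1.trans_le (mul_le_of_le_one_right hMpos.le (pow_le_one₀ hd0 (by linarith)))
  set r := d / 2 with hr
  have hrpos : 0 < r := by positivity
  have hr4 : r ≤ 1 / 4 := by linarith
  have hr2 : r ^ 2 ≤ 1 / 16 := (pow_le_pow_left₀ hrpos.le hr4 2).trans (by norm_num)
  have hr2p : 0 < r ^ 2 := by positivity
  -- the extension of `u` by its initial values
  set v : Spc m × ℝ → ℝ := fun z => u (z.1, max z.2 0) with hv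
  have hball : ∀ x ∈ Metric.closedBall X.1 r, ‖x‖ ≤ 1 / 2 - r := by
    intro x hx
    have h1 : ‖x - X.1‖ ≤ r := by simpa [dist_eq_norm] using hx
    have h2 : ‖x‖ ≤ ‖x - X.1‖ + ‖X.1‖ := by
      have := norm_add_le (x - X.1) X.1
      simpa using this
    linarith
  have hbneg : ∀ z ∈ Metric.closedBall X.1 r ×ˢ Icc (X.2 - r ^ 2) X.2, z.2 ≤ 0 → v z ≤ M₀ := by
    intro z hz hz0
    rcases hbot with h | h
    · exfalso
      have h1 : d ≤ √X.2 + ω := min_le_right _ _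
      rw [h, add_zero] at h1
      have h2 : d ^ 2 ≤ X.2 := by
        have := Real.sq_sqrt hX0
        rw [← this]; exact pow_le_pow_left₀ hd0 h1 2
      have h3 : X.2 - r ^ 2 ≤ z.2 := hz.2.1
      have h4 : r ^ 2 = d ^ 2 / 4 := by rw [hr]; ring
      have h5 := pow_pos hdpos 2
      linarith
    · simp only [hv, max_eq_right hz0]
      exact h _ (by simpa using (hball _ hz.1).trans (by linarith))
  have hvpos : ∀ z : Spc m × ℝ, 0 < z.2 → v z = u z := by
    intro z hz
    simp only [hv, max_eq_left hz.le]
  have hX2 : X.2 ≤ κ / 2 := hXK.2.2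
  have hvX : v X = M := by simp only [hv, max_eq_left hX0, hM]
  have hmeas := hmm v X r M hrpos hMpos hvX ?_ ?_ ?_
  rotate_left
  · refine huc.comp (by fun_prop) ?_
    rintro z ⟨h1, h2⟩
    refine ⟨by simpa using (hball _ h1).trans (by linarith), le_max_right _ _, max_le ?_ hκ.le⟩
    linarith [h2.2]
  · intro z hz
    have h2γ : (1 : ℝ) ≤ 2 ^ γ := one_le_pow₀ one_le_two
    rcases le_or_gt z.2 0 with h | h
    · have h1 := hbneg z hz h
      have h2 : M ≤ 2 ^ γ * M := le_mul_of_one_le_left hMpos.le h2γ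
      linarith
    · rw [hvpos z h]
      have h1 := hball _ hz.1
      have h2 : z ∈ Metric.closedBall (0 : Spc m) (1 / 2) ×ˢ Icc 0 (κ / 2) :=
        ⟨by simpa using h1.trans (by linarith), h.le, hz.2.2.trans hX2⟩
      have h3 : u z * hweight ω z ^ γ ≤ M * d ^ γ := hXmax h2
      have h4 : d / 2 ≤ hweight ω z := hweight_half hd0
        (by simpa [dist_eq_norm] using hz.1) hz.2.1 h.le
      have h5 : 0 ≤ u z := hu.1.2.1 z ⟨Metric.closedBall_subset_closedBall (by linarith) h2.1, h,
        by linarith [h2.2.2]⟩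
      have h6 : u z * (d / 2) ^ γ ≤ M * d ^ γ :=
        le_trans (mul_le_mul_of_nonneg_left (pow_le_pow_left₀ (by positivity) h4 γ) h5) h3
      have h7 : M * d ^ γ = 2 ^ γ * M * (d / 2) ^ γ := by rw [div_pow]; field_simp
      rw [h7] at h6
      exact le_of_mul_le_mul_right h6 (by positivity)
  · intro z hz hzM
    have hz' : z ∈ Metric.closedBall X.1 r ×ˢ Icc (X.2 - r ^ 2) X.2 :=
      ⟨Metric.ball_subset_closedBall hz.1, Ioc_subset_Icc_self hz.2⟩
    have hz0 : 0 < z.2 := by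
      by_contra h
      have := hbneg z hz' (not_lt.1 h)
      linarith
    have h1 := hball _ hz'.1
    have h2 := hu.2 z ⟨by simpa using h1.trans (by linarith), hz0, by linarith [hz.2.2]⟩
    refine h2.mono (by simp only [hvpos z hz0]) ?_
    filter_upwards [(isOpen_lt continuous_const continuous_snd).mem_nhds hz0] with y hy
    rw [hvpos y hy]
  set E : Set (Spc m × ℝ) := (bcyl X r ∩ {z | η * r ^ 2 < z.2}) ∩ u ⁻¹' Ioi (M / 2) with hE
  have hEsub : bcyl X r ∩ {z | η * r ^ 2 < z.2} ⊆ Metric.closedBall 0 (R + 1) ×ˢ Ioc 0 κ := by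
    rintro z ⟨hz1, hz2⟩
    have hz2 : η * r ^ 2 < z.2 := hz2
    have h1 := hball _ (Metric.ball_subset_closedBall hz1.1)
    refine ⟨by simpa using h1.trans (by linarith), lt_trans (by positivity) hz2, ?_⟩
    linarith [hz1.2.2]
  have hEo : IsOpen E := (hu.1.1.mono hEsub).isOpen_inter_preimage
    ((isOpen_bcyl X r).inter (isOpen_lt continuous_const continuous_snd)) isOpen_Ioi
  have hEvol : ENNReal.ofReal (ε / 2 * r ^ (m + 3)) ≤ volume E := by
    have hcov : {z | z ∈ Metric.ball X.1 r ×ˢ Ioc (X.2 - r ^ 2) X.2 ∧ M / 2 < v z} ⊆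
        (E ∪ Metric.ball X.1 r ×ˢ Ioc 0 (η * r ^ 2)) ∪ Metric.ball X.1 r ×ˢ {X.2} := by
      rintro z ⟨⟨hz1, hz2⟩, hz3⟩
      have hz0 : 0 < z.2 := by
        by_contra h
        have := hbneg z ⟨Metric.ball_subset_closedBall hz1, Ioc_subset_Icc_self hz2⟩ (not_lt.1 h)
        linarith
      rcases hz2.2.eq_or_lt with h | h
      · exact Or.inr ⟨hz1, h⟩
      · rcases le_or_gt z.2 (η * r ^ 2) with h' | h'
        · exact Or.inl (Or.inr ⟨hz1, hz0, h'⟩)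
        · refine Or.inl (Or.inl ⟨⟨⟨hz1, hz2.1, h⟩, h'⟩, ?_⟩)
          show M / 2 < u z
          rwa [← hvpos z hz0]
    have hslice : volume (Metric.ball X.1 r ×ˢ ({X.2} : Set ℝ)) = 0 := by
      rw [Measure.volume_eq_prod, Measure.prod_prod]; simp
    have hlayer : volume (Metric.ball X.1 r ×ˢ Ioc 0 (η * r ^ 2)) =
        ENNReal.ofReal (ε / 2 * r ^ (m + 3)) := by
      have h1 : volume (Metric.ball X.1 r ×ˢ Ioc 0 (η * r ^ 2)) =
          volume (Metric.ball X.1 r ×ˢ Ioo 0 (η * r ^ 2)) := by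
        rw [Measure.volume_eq_prod, Measure.prod_prod, Measure.prod_prod]; simp
      rw [h1, volume_ball_prod_Ioo _ hrpos, hVeq, ← ENNReal.ofReal_mul (by
        rw [sub_zero]; positivity)]
      congr 1
      rw [hη]; field_simp; ring
    have h1 := hmeas.trans ((measure_mono hcov).trans ((measure_union_le _ _).trans
      (add_le_add (measure_union_le _ _) le_rfl)))
    rw [hslice, add_zero, hlayer] at h1
    have e1 : ε * r ^ (m + 3) = ε / 2 * r ^ (m + 3) + ε / 2 * r ^ (m + 3) := by ring
    rw [e1, ENNReal.ofReal_add (by positivity) (by positivity)] at h1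
    exact (ENNReal.add_le_add_iff_right ENNReal.ofReal_ne_top).1 h1
  have hbox : ∀ Z ∈ E, ∀ z ∈ box Z (θ * r) (θ * r ^ 2), ‖z.1‖ ≤ 1 ∧ 0 < z.2 ∧ z.2 ≤ 5 / 8 * κ := by
    intro Z hZ z hz
    have h1 := hball _ (Metric.ball_subset_closedBall hZ.1.1.1)
    have h2 := mem_box.1 hz
    have h3 := abs_le.1 h2.2
    have h4 : η * r ^ 2 < Z.2 := hZ.1.2
    have h5 : Z.2 < X.2 := hZ.1.1.2.2
    have h6 : ‖z.1‖ ≤ ‖z.1 - Z.1‖ + ‖Z.1‖ := by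
      have := norm_add_le (z.1 - Z.1) Z.1
      simpa using this
    have h7 : θ * r ^ 2 ≤ η * r ^ 2 := mul_le_mul_of_nonneg_right hθη hr2p.le
    have h8 : θ * r ^ 2 ≤ κ * (1 / 16) := mul_le_mul hθκ hr2 hr2p.le hκ.le
    have h9 : θ * r ≤ 1 * (1 / 4) := mul_le_mul (hθκ.trans hκ1) hr4 hrpos.le one_pos.le
    refine ⟨?_, ?_, ?_⟩
    · linarith [h2.1]
    · linarith
    · linarith
  obtain ⟨Z, hZ, Y, hY, hlow⟩ := hG u (Metric.closedBall 0 (R + 1) ×ˢ Ioc 0 κ) E X r (M / 2) hrpos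
    (by positivity) hu.1 hEo (fun z hz => hz.1.1) (fun z hz => hz.2) (fun Z hZ z hz => by
      have := hbox Z hZ z hz
      exact ⟨by simpa using this.1.trans (by linarith), this.2.1, by linarith [this.2.2]⟩) hEvol
  obtain ⟨hY1, hY2, hY3⟩ := hbox Z hZ Y hY
  have hyn : ‖y‖ ≤ 1 := by simpa using hy
  have hsub : Metric.closedBall Y.1 (R * 1) ×ˢ Icc Y.2 (Y.2 + (κ - Y.2) * 1 ^ 2) ⊆
      Metric.closedBall 0 (R + 1) ×ˢ Ioc 0 κ := by
    rintro z ⟨h1, h2⟩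
    have h1 : ‖z.1 - Y.1‖ ≤ R * 1 := by simpa [dist_eq_norm] using h1
    have h6 : ‖z.1‖ ≤ ‖z.1 - Y.1‖ + ‖Y.1‖ := by
      have := norm_add_le (z.1 - Y.1) Y.1
      simpa using this
    refine ⟨by rw [mem_closedBall_zero_iff]; linarith, by linarith [h2.1], by linarith [h2.2]⟩
  have hsr : s * r ≤ κ / 2 * (1 / 4) := mul_le_mul hsκ hr4 hrpos.le (by positivity)
  have hsr1 : s * r ≤ R := by linarith
  have hsr2 : (s * r) ^ 2 ≤ κ / 4 := by
    have h1 : (s * r) ^ 2 ≤ s * r * 1 := by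
      rw [sq]; exact mul_le_mul_of_nonneg_left (by linarith) (by positivity)
    linarith
  have hfin := hsp u Y (s * r) 1 (c₁ * (M / 2)) (κ - Y.2) (by positivity) one_pos (by positivity)
    hsr1 hsr2 (by linarith) (hu.1.1.mono hsub) (fun z hz => hu.1.2.1 z (hsub hz))
    (fun z hz => hu.1.2.2 z (hsub ⟨Metric.ball_subset_closedBall hz.1, Ioc_subset_Icc_self hz.2⟩))
    (fun z hz => hlow z ⟨Metric.closedBall_subset_closedBall (by rw [mul_one]; gcongr) hz.1, hz.2.1,
      hz.2.2.trans (by rw [mul_one]; gcongr)⟩) (y, κ) ⟨?_, ?_, ?_⟩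
  · have e1 : M * d ^ γ = 2 / (c * (s / 2) ^ γ * c₁) * (c * (s * r) ^ γ * (c₁ * (M / 2))) := by
      rw [hr, show s * (d / 2) = s / 2 * d by ring, mul_pow]; field_simp
    rw [e1] at hcon2
    exact absurd hcon2 (not_lt.2 (mul_le_mul_of_nonneg_left hfin (by positivity)))
  · rw [Metric.mem_closedBall, dist_eq_norm]
    refine (norm_sub_le _ _).trans ?_
    simp only; linarith
  · simp only; linarith
  · simp only; linarith

lemma PosSol.pscale {m : ℕ} {lam Lam : ℝ} {u : Spc m × ℝ → ℝ} {D D' : Set (Spc m × ℝ)}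
    (h : PosSol lam Lam u D) (P : Spc m × ℝ) {r : ℝ} (hr : 0 < r)
    (hD : ∀ z ∈ D', pscale P r z ∈ D) : PosSol lam Lam (fun z => u (pscale P r z)) D' :=
  ⟨⟨h.1.1.comp (continuous_pscale P r).continuousOn hD, fun z hz => h.1.2.1 _ (hD z hz),
    fun z hz => (h.1.2.2 _ (hD z hz)).pscale hr⟩, fun z hz => (h.2 _ (hD z hz)).pscale hr⟩

lemma pscale_mem_closedBall {m : ℕ} (P : Spc m × ℝ) {r : ℝ} (hr : 0 < r) {a : ℝ}
    {z : Spc m × ℝ} (hz : z.1 ∈ Metric.closedBall 0 a) :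
    (pscale P r z).1 ∈ Metric.closedBall P.1 (a * r) := by
  rw [mem_closedBall_zero_iff] at hz
  rw [mem_closedBall_iff_norm]
  simp only [_root_.pscale, add_sub_cancel_left, norm_smul, Real.norm_of_nonneg hr.le]
  rw [mul_comm]; gcongr

lemma pscale_inv {m : ℕ} (P : Spc m × ℝ) {r : ℝ} (hr : 0 < r) {a : ℝ}
    {x : Spc m} (hx : x ∈ Metric.closedBall P.1 (a * r)) :
    ∃ y ∈ Metric.closedBall (0 : Spc m) a, x = P.1 + r • y := by
  rw [mem_closedBall_iff_norm] at hx
  refine ⟨r⁻¹ • (x - P.1), ?_, ?_⟩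
  · rw [mem_closedBall_zero_iff, norm_smul, Real.norm_of_nonneg (by positivity), inv_mul_le_iff₀ hr]
    linarith
  · rw [smul_inv_smul₀ hr.ne']; abel

lemma harnack_forward (m : ℕ) {lam Lam : ℝ} (hl : 0 < lam) (hL : lam ≤ Lam) {κ : ℝ} (hκ : 0 < κ)
    (hκ1 : κ ≤ 1 / 2) :
    ∃ C R : ℝ, 1 ≤ C ∧ 1 ≤ R ∧ ∀ (u : Spc m × ℝ → ℝ) (P : Spc m × ℝ) (ρ : ℝ), 0 < ρ →
      PosSol lam Lam u
        (Metric.closedBall P.1 (R * ρ) ×ˢ Icc (P.2 - κ * ρ ^ 2) (P.2 + κ * ρ ^ 2)) →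
      ∀ x ∈ Metric.closedBall P.1 ρ, u P ≤ C * u (x, P.2 + κ * ρ ^ 2) := by
  obtain ⟨γ, C, R, hC, hR, h⟩ := harnack_core m hl hL (κ := 2 * κ) (by positivity) (by linarith)
  set q : ℝ := min (1 / 2) √κ with hq
  have hq0 : 0 < q := lt_min (by norm_num) (Real.sqrt_pos.2 hκ)
  refine ⟨max 1 (C / q ^ γ), R, le_max_left _ _, hR, ?_⟩
  intro u P ρ hρ hu x hx
  set P' : Spc m × ℝ := (P.1, P.2 - κ * ρ ^ 2) with hP'
  rw [← one_mul ρ] at hx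
  obtain ⟨y, hy, rfl⟩ := pscale_inv P hρ hx
  have hsub : ∀ z ∈ Metric.closedBall (0 : Spc m) R ×ˢ Icc 0 (2 * κ), _root_.pscale P' ρ z ∈
      Metric.closedBall P.1 (R * ρ) ×ˢ Icc (P.2 - κ * ρ ^ 2) (P.2 + κ * ρ ^ 2) := by
    rintro z ⟨h1, h2, h3⟩
    have h4 : 0 ≤ ρ ^ 2 * z.2 := by positivity
    have h5 : ρ ^ 2 * z.2 ≤ ρ ^ 2 * (2 * κ) := by gcongr
    refine ⟨pscale_mem_closedBall P' hρ h1, ?_, ?_⟩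
    · simp only [_root_.pscale, hP']; linarith
    · simp only [_root_.pscale, hP']; linarith
  have hv := hu.pscale P' hρ hsub
  have h0 := h _ 0 0 le_rfl le_rfl (hv.mono (prod_mono le_rfl Ioc_subset_Icc_self))
    (hv.1.1.mono (prod_mono (Metric.closedBall_subset_closedBall (by linarith)) le_rfl))
    (Or.inl rfl) (0, κ) ⟨by simp, hκ.le, by simp⟩ y hy
  have e1 : _root_.pscale P' ρ (0, κ) = P := by
    refine Prod.ext ?_ ?_
    · simp [_root_.pscale, hP']
    · simp only [_root_.pscale, hP']; ring
  have e2 : _root_.pscale P' ρ (y, 2 * κ) = (P.1 + ρ • y, P.2 + κ * ρ ^ 2) := by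
    refine Prod.ext ?_ ?_
    · simp [_root_.pscale, hP']
    · simp only [_root_.pscale, hP']; ring
  have e3 : hweight 0 ((0 : Spc m), κ) = q := by simp [hweight, hq]
  rw [e1, e2, e3, mul_zero] at h0
  have hu2 : 0 ≤ u (P.1 + ρ • y, P.2 + κ * ρ ^ 2) := by
    rw [← e2]; exact hv.1.2.1 (y, 2 * κ)
      ⟨Metric.closedBall_subset_closedBall hR hy, by positivity, le_rfl⟩
  rw [max_eq_right (by positivity)] at h0
  have h1 : u P ≤ C / q ^ γ * u (P.1 + ρ • y, P.2 + κ * ρ ^ 2) := by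
    rw [div_mul_eq_mul_div, le_div_iff₀ (by positivity)]; exact h0
  exact h1.trans (mul_le_mul_of_nonneg_right (le_max_right _ _) hu2)

lemma harnack_initial (m : ℕ) {lam Lam : ℝ} (hl : 0 < lam) (hL : lam ≤ Lam) {κ : ℝ} (hκ : 0 < κ)
    (hκ1 : κ ≤ 1) :
    ∃ C R : ℝ, 1 ≤ C ∧ 1 ≤ R ∧ ∀ (u : Spc m × ℝ → ℝ) (P : Spc m × ℝ) (ρ M₀ : ℝ), 0 < ρ → 0 ≤ M₀ →
      PosSol lam Lam u (Metric.closedBall P.1 (R * ρ) ×ˢ Ioc P.2 (P.2 + κ * ρ ^ 2)) →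
      ContinuousOn u (Metric.closedBall P.1 (1 / 2 * ρ) ×ˢ Icc P.2 (P.2 + κ * ρ ^ 2)) →
      (∀ x ∈ Metric.closedBall P.1 (1 / 2 * ρ), u (x, P.2) ≤ M₀) →
      ∀ t ∈ Icc P.2 (P.2 + κ / 2 * ρ ^ 2),
      ∀ x ∈ Metric.closedBall P.1 ρ, u (P.1, t) ≤ C * max M₀ (u (x, P.2 + κ * ρ ^ 2)) := by
  obtain ⟨γ, C, R, hC, hR, h⟩ := harnack_core m hl hL (κ := κ) hκ hκ1
  refine ⟨max 2 C * 2 ^ γ, R, ?_, hR, ?_⟩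
  · have h1 : (1 : ℝ) ≤ 2 ^ γ := one_le_pow₀ one_le_two
    have h2 : (2 : ℝ) ≤ max 2 C := le_max_left _ _
    nlinarith
  intro u P ρ M₀ hρ hM₀ hu huc hbot t ht x hx
  rw [← one_mul ρ] at hx
  obtain ⟨y, hy, rfl⟩ := pscale_inv P hρ hx
  have hρ2 : 0 < ρ ^ 2 := by positivity
  have hsub : ∀ z ∈ Metric.closedBall (0 : Spc m) R ×ˢ Ioc 0 κ, _root_.pscale P ρ z ∈
      Metric.closedBall P.1 (R * ρ) ×ˢ Ioc P.2 (P.2 + κ * ρ ^ 2) := by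
    rintro z ⟨h1, h2, h3⟩
    have h4 : 0 < ρ ^ 2 * z.2 := by positivity
    have h5 : ρ ^ 2 * z.2 ≤ ρ ^ 2 * κ := by gcongr
    refine ⟨pscale_mem_closedBall P hρ h1, ?_, ?_⟩
    · simp only [_root_.pscale]; linarith
    · simp only [_root_.pscale]; linarith
  have hsub2 : ∀ z ∈ Metric.closedBall (0 : Spc m) (1 / 2) ×ˢ Icc 0 κ, _root_.pscale P ρ z ∈
      Metric.closedBall P.1 (1 / 2 * ρ) ×ˢ Icc P.2 (P.2 + κ * ρ ^ 2) := by
    rintro z ⟨h1, h2, h3⟩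
    have h4 : 0 ≤ ρ ^ 2 * z.2 := by positivity
    have h5 : ρ ^ 2 * z.2 ≤ ρ ^ 2 * κ := by gcongr
    refine ⟨pscale_mem_closedBall P hρ h1, ?_, ?_⟩
    · simp only [_root_.pscale]; linarith
    · simp only [_root_.pscale]; linarith
  have hv := hu.pscale P hρ hsub
  set τ := (t - P.2) / ρ ^ 2 with hτ
  have hτ0 : 0 ≤ τ := div_nonneg (by linarith [ht.1]) hρ2.le
  have hτ1 : τ ≤ κ / 2 := by rw [hτ, div_le_iff₀ hρ2]; linarith [ht.2]
  have h0 := h _ 1 M₀ zero_le_one hM₀ hv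
    (huc.comp (continuous_pscale P ρ).continuousOn hsub2)
    (Or.inr fun x hx => by
      have e : _root_.pscale P ρ (x, 0) = ((_root_.pscale P ρ (x, 0)).1, P.2) := by
        simp [_root_.pscale]
      rw [e]
      exact hbot _ (pscale_mem_closedBall P hρ hx))
    (0, τ) ⟨by simp, hτ0, hτ1⟩ y hy
  have e1 : _root_.pscale P ρ (0, τ) = (P.1, t) := by
    refine Prod.ext ?_ ?_
    · simp [_root_.pscale]
    · simp only [_root_.pscale, hτ]; field_simp; ring
  have e2 : _root_.pscale P ρ (y, κ) = (P.1 + ρ • y, P.2 + κ * ρ ^ 2) := by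
    refine Prod.ext ?_ ?_
    · simp [_root_.pscale]
    · simp only [_root_.pscale]; ring
  have e3 : hweight 1 ((0 : Spc m), τ) = 1 / 2 := by
    simp only [hweight, norm_zero, sub_zero]
    exact min_eq_left (by linarith [Real.sqrt_nonneg τ])
  rw [e1, e2, e3] at h0
  set b := u (P.1 + ρ • y, P.2 + κ * ρ ^ 2) with hb
  have hb0 : 0 ≤ b := by
    rw [hb, ← e2]; exact hv.1.2.1 (y, κ)
      ⟨Metric.closedBall_subset_closedBall hR hy, hκ, le_rfl⟩
  have h3 : max (2 * M₀) (C * b) ≤ max 2 C * max M₀ b :=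
    max_le (mul_le_mul (le_max_left _ _) (le_max_left _ _) hM₀ (by positivity))
      (mul_le_mul (le_max_right _ _) (le_max_right _ _) hb0 (by positivity))
  have h4 : u (P.1, t) = 2 ^ γ * (u (P.1, t) * (1 / 2) ^ γ) := by
    rw [one_div, inv_pow]; field_simp
  rw [h4]
  calc 2 ^ γ * (u (P.1, t) * (1 / 2) ^ γ) ≤ 2 ^ γ * (max 2 C * max M₀ b) :=
        mul_le_mul_of_nonneg_left (h0.trans h3) (by positivity)
    _ = _ := by ring

lemma taylor_two {E : Type*} [NormedAddCommGroup E] [NormedSpace ℝ E] {φ : E → ℝ} {x : E}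
    (h : ContDiffAt ℝ 2 φ x) {ε : ℝ} (hε : 0 < ε) :
    ∀ᶠ v in 𝓝 (0 : E), φ (x + v) ≤ φ x + fderiv ℝ φ x v + fderiv ℝ (fderiv ℝ φ) x v v / 2 +
      ε * ‖v‖ ^ 2 := by
  set H := fderiv ℝ (fderiv ℝ φ) x with hH
  have hd1 : ∀ᶠ y in 𝓝 x, DifferentiableAt ℝ φ y := by
    filter_upwards [h.eventually (by simp)] with y hy using hy.differentiableAt (by simp)
  have hd2 : HasFDerivAt (fderiv ℝ φ) H x :=
    ((h.fderiv_right (m := 1) (by norm_num)).differentiableAt (by simp)).hasFDerivAt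
  have hsymm : IsSymmSndFDerivAt ℝ φ x := h.isSymmSndFDerivAt (by simp)
  have hb := hd2.isLittleO.bound hε
  obtain ⟨δ, hδ, hball⟩ := Metric.eventually_nhds_iff_ball.1 (hd1.and hb)
  filter_upwards [Metric.ball_mem_nhds (0 : E) hδ] with v hv
  have hv : ‖v‖ < δ := by simpa using hv
  set F : E → ℝ := fun w => φ (x + w) - 1 / 2 * H w w with hF
  have hder : ∀ w ∈ Metric.closedBall (0 : E) ‖v‖,
      HasFDerivWithinAt F (fderiv ℝ φ (x + w) - H w) (Metric.closedBall 0 ‖v‖) w := by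
    intro w hw
    have hw' : ‖w‖ < δ := lt_of_le_of_lt (by simpa using hw) hv
    have h1 := (hball (x + w) (by simpa using hw')).1.hasFDerivAt
    have h2 : HasFDerivAt (fun w => φ (x + w)) (fderiv ℝ φ (x + w)) w :=
      (h1.comp w ((hasFDerivAt_id w).const_add x)).congr_fderiv (ContinuousLinearMap.comp_id _)
    have h3 := (H.hasFDerivAt (x := w)).clm_apply (hasFDerivAt_id w)
    refine ((h2.sub (h3.const_mul (1 / 2))).congr_fderiv ?_).hasFDerivWithinAt
    ext y
    have := hsymm y w
    simp [← hH] at this ⊢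
    rw [this]; ring
  have hbound : ∀ w ∈ Metric.closedBall (0 : E) ‖v‖,
      ‖fderiv ℝ φ (x + w) - H w - fderiv ℝ φ x‖ ≤ ε * ‖v‖ := by
    intro w hw
    have hw1 : ‖w‖ ≤ ‖v‖ := by simpa using hw
    have := (hball (x + w) (by simpa using hw1.trans_lt hv)).2
    simp only [add_sub_cancel_left] at this
    rw [sub_right_comm]
    exact this.trans (by gcongr)
  have hm := (convex_closedBall (0 : E) ‖v‖).norm_image_sub_le_of_norm_hasFDerivWithin_le'
    hder hbound (Metric.mem_closedBall_self (norm_nonneg v)) (y := v) (by simp)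
  simp only [hF, sub_zero, map_zero, add_zero, mul_zero] at hm
  have := (le_abs_self _).trans hm
  nlinarith

lemma exists_spectral (m : ℕ) {lam Lam : ℝ} (M : Matrix (Fin (m + 1)) (Fin (m + 1)) ℝ)
    (hs : M.IsSymm) (hM : ∀ ξ : Spc m, lam * ‖ξ‖ ^ 2 ≤ ∑ i, ∑ j, ξ i * M i j * ξ j ∧
      ∑ i, ∑ j, ξ i * M i j * ξ j ≤ Lam * ‖ξ‖ ^ 2) :
    ∃ (e : OrthonormalBasis (Fin (m + 1)) ℝ (Spc m)) (μ : Fin (m + 1) → ℝ),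
      (∀ k, lam ≤ μ k ∧ μ k ≤ Lam) ∧ ∀ i j, M i j = ∑ k, μ k * (e k i * e k j) := by
  have hH : M.IsHermitian := by
    rw [Matrix.IsHermitian, Matrix.conjTranspose_eq_transpose_of_trivial]; exact hs
  refine ⟨hH.eigenvectorBasis, hH.eigenvalues, fun k => ?_, fun i j => ?_⟩
  · have h1 := hM (hH.eigenvectorBasis k)
    have h2 : ∑ i, ∑ j, hH.eigenvectorBasis k i * M i j * hH.eigenvectorBasis k j =
        hH.eigenvalues k := by
      have h3 : ∀ i, ∑ j, M i j * hH.eigenvectorBasis k j =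
          hH.eigenvalues k * hH.eigenvectorBasis k i := fun i => by
        have := congrFun (hH.mulVec_eigenvectorBasis k) i
        simpa [Matrix.mulVec, dotProduct] using this
      have h4 : ∑ i, hH.eigenvectorBasis k i ^ 2 = 1 := by
        have := hH.eigenvectorBasis.orthonormal.1 k
        rw [EuclideanSpace.norm_eq, Real.sqrt_eq_one] at this
        simpa using this
      calc _ = ∑ i, hH.eigenvectorBasis k i * ∑ j, M i j * hH.eigenvectorBasis k j := by
            refine Finset.sum_congr rfl fun i _ => ?_
            rw [Finset.mul_sum]; refine Finset.sum_congr rfl fun j _ => ?_; ring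
        _ = hH.eigenvalues k * ∑ i, hH.eigenvectorBasis k i ^ 2 := by
            rw [Finset.mul_sum]
            refine Finset.sum_congr rfl fun i _ => ?_
            rw [h3]; ring
        _ = _ := by rw [h4, mul_one]
    rw [h2] at h1
    simpa using h1
  · have h := congrFun (congrFun hH.spectral_theorem i) j
    rw [h, Unitary.conjStarAlgAut_apply]
    simp only [Matrix.mul_apply, Matrix.diagonal_apply, Function.comp, Matrix.star_apply]
    refine Finset.sum_congr rfl fun k _ => ?_
    simp
    ring

lemma SolvesL.neg {m : ℕ} {A : Spc m → Matrix (Fin (m + 1)) (Fin (m + 1)) ℝ}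
    {u : Spc m × ℝ → ℝ} {Ω : Set (Spc m × ℝ)} (h : SolvesL A u Ω) :
    SolvesL A (fun z => -u z) Ω := by
  intro p hp
  obtain ⟨h1, h2⟩ := h p hp
  refine ⟨h1.neg, h2.neg.congr_deriv ?_⟩
  simp only [Lop, ← Finset.sum_neg_distrib]
  refine Finset.sum_congr rfl fun i _ => Finset.sum_congr rfl fun j _ => ?_
  rw [← mul_neg]
  congr 1
  simp only [sHess, fderiv_fun_neg, neg_apply]

lemma SolvesL.supAt {m : ℕ} {lam Lam : ℝ} {A : Spc m → Matrix (Fin (m + 1)) (Fin (m + 1)) ℝ}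
    (hA : IsElliptic lam Lam A) {u : Spc m × ℝ → ℝ} {Ω : Set (Spc m × ℝ)} (h : SolvesL A u Ω)
    {p : Spc m × ℝ} (hp : p ∈ Ω) : SupAt lam Lam u p := by
  obtain ⟨h1, h2⟩ := h p hp
  obtain ⟨e, μ, hμ, hM⟩ := exists_spectral m (A p.1) (hA.1 p.1) (hA.2 p.1)
  set φ : Spc m → ℝ := fun y => u (y, p.2) with hφ
  set H := fderiv ℝ (fderiv ℝ φ) p.1 with hH
  have hd2 : DifferentiableAt ℝ (fderiv ℝ φ) p.1 :=
    (h1.fderiv_right (m := 1) (by norm_num)).differentiableAt (by simp)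
  have hs : ∀ i j, sHess u p i j = H (eVec m i) (eVec m j) := by
    intro i j
    simp only [sHess]
    rw [fderiv_clm_apply hd2 (differentiableAt_const _)]
    simp [hH]
  refine ⟨e, μ, fderiv ℝ φ p.1, H, Lop A u p, hμ, ?_, fun ε hε => ?_, fun ε hε => ?_⟩
  · have hsum : ∀ k, H (e k) (e k) = ∑ i, ∑ j, e k j * (e k i * H (eVec m j) (eVec m i)) := by
      intro k
      have he : e k = ∑ i, e k i • eVec m i := by
        have := (EuclideanSpace.basisFun (Fin (m + 1)) ℝ).sum_repr (e k)
        simpa [eVec] using this.symm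
      conv_lhs => rw [he]
      simp only [map_sum, map_smul, sum_apply, smul_apply, smul_eq_mul, Finset.mul_sum]
      refine Finset.sum_congr rfl fun i _ => Finset.sum_congr rfl fun j _ => ?_
      ring
    refine le_of_eq ?_
    simp only [Lop, hs, hM, hsum, Finset.mul_sum, Finset.sum_mul]
    rw [Finset.sum_comm]
    refine Finset.sum_congr rfl fun i _ => ?_
    rw [Finset.sum_comm]
    refine Finset.sum_congr rfl fun i _ => Finset.sum_congr rfl fun j _ => ?_
    ring
  · exact taylor_two h1 hε
  · have h3 := (hasDerivAt_iff_isLittleO_nhds_zero.1 h2).bound hε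
    have ht : Tendsto (fun s : ℝ => -s) (𝓝[>] 0) (𝓝 0) := by
      have := (continuous_neg (G := ℝ)).tendsto 0
      rw [neg_zero] at this
      exact this.mono_left nhdsWithin_le_nhds
    filter_upwards [ht.eventually h3, self_mem_nhdsWithin] with s hs1 hs2
    have hs2 : 0 < s := hs2
    rw [norm_neg, Real.norm_of_nonneg hs2.le] at hs1
    have := (le_abs_self _).trans hs1
    simp only [smul_eq_mul] at this
    rw [sub_eq_add_neg p.2 s]
    linarith

lemma initial_lower {m : ℕ} {lam Lam : ℝ} (hl : 0 < lam) (hL : lam ≤ Lam) {w : Spc m × ℝ → ℝ}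
    {P : Spc m × ℝ} {ρ T ℓ : ℝ} (hρ : 0 < ρ) (hℓ : 0 ≤ ℓ)
    (hw : ContinuousOn w (Metric.closedBall P.1 ρ ×ˢ Icc P.2 (P.2 + T)))
    (h0 : ∀ z ∈ Metric.closedBall P.1 ρ ×ˢ Icc P.2 (P.2 + T), 0 ≤ w z)
    (hS : ∀ z ∈ Metric.ball P.1 ρ ×ˢ Ioc P.2 (P.2 + T), SupAt lam Lam w z)
    (hb : ∀ x ∈ Metric.closedBall P.1 ρ, ℓ ≤ w (x, P.2))
    {t : ℝ} (ht : t ∈ Icc P.2 (P.2 + T)) :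
    ℓ * (1 - 4 * ((m + 1) * Lam) / ρ ^ 2 * (t - P.2)) ≤ w (P.1, t) := by
  rcases hℓ.eq_or_lt with rfl | hℓ
  · rw [zero_mul]; exact h0 _ ⟨Metric.mem_closedBall_self hρ.le, ht⟩
  have hLp : 0 < Lam := hl.trans_le hL
  set c : ℝ := 4 * ((m + 1) * Lam) / ρ ^ 2 with hc
  have hcpos : 0 < c := by positivity
  by_contra hcon
  push Not at hcon
  set φ : Spc m × ℝ → ℝ := fun z => ℓ * (1 - ‖z.1 - P.1‖ ^ 2 / ρ ^ 2 - c * (z.2 - P.2)) with hφ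
  have hφc : Continuous φ := by fun_prop
  obtain ⟨p, hp, hmin⟩ := ((isCompact_closedBall P.1 ρ).prod
    (isCompact_Icc (a := P.2) (b := P.2 + T))).exists_isMinOn
    ⟨(P.1, t), Metric.mem_closedBall_self hρ.le, ht⟩ (hw.sub hφc.continuousOn)
  have hmin : ∀ z ∈ Metric.closedBall P.1 ρ ×ˢ Icc P.2 (P.2 + T), w p - φ p ≤ w z - φ z :=
    fun z hz => hmin hz
  have hneg : w p - φ p < 0 := by
    refine (hmin (P.1, t) ⟨Metric.mem_closedBall_self hρ.le, ht⟩).trans_lt ?_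
    simp only [hφ, sub_self, norm_zero]
    rw [zero_pow two_ne_zero, zero_div, sub_zero]
    linarith
  have hw0 := h0 p hp
  have hpρ : ‖p.1 - P.1‖ ≤ ρ := by simpa [dist_eq_norm] using hp.1
  have hp2 : 0 ≤ p.2 - P.2 := by linarith [hp.2.1]
  have hpρ' : ‖p.1 - P.1‖ < ρ := by
    refine lt_of_le_of_ne hpρ fun h => ?_
    have : φ p ≤ 0 := by
      simp only [hφ, h]
      rw [div_self (by positivity)]
      exact mul_nonpos_of_nonneg_of_nonpos hℓ.le (by linarith [mul_nonneg hcpos.le hp2])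
    linarith
  have hp2' : 0 < p.2 - P.2 := by
    refine lt_of_le_of_ne hp2 fun h => ?_
    have h1 := hb p.1 hp.1
    have e : p = (p.1, P.2) := Prod.ext rfl (by simp only; linarith)
    rw [← e] at h1
    have : φ p ≤ ℓ := by
      simp only [hφ, ← h]
      refine mul_le_of_le_one_right hℓ.le ?_
      have : 0 ≤ ‖p.1 - P.1‖ ^ 2 / ρ ^ 2 := by positivity
      linarith
    linarith
  have hpS := hS p ⟨by simpa [dist_eq_norm] using hpρ', by linarith, hp.2.2⟩
  have hx : ∀ v, ‖v‖ = 1 → ∀ ε > 0, ∀ᶠ s in 𝓝 (0 : ℝ), w p +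
      s * (-(2 * ℓ / ρ ^ 2) * inner ℝ (p.1 - P.1) v) + s ^ 2 * -(2 * ℓ / ρ ^ 2) / 2 - ε * s ^ 2 ≤
      w (p.1 + s • v, p.2) := by
    intro v hv ε hε
    have hcont : Tendsto (fun s : ℝ => p.1 + s • v) (𝓝 0) (𝓝 p.1) := by
      have : Continuous (fun s : ℝ => p.1 + s • v) := by fun_prop
      simpa using this.tendsto 0
    filter_upwards [hcont.eventually (Metric.isOpen_ball.mem_nhds
      (by simpa [dist_eq_norm] using hpρ' : p.1 ∈ Metric.ball P.1 ρ))] with s hs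
    have h1 := hmin (p.1 + s • v, p.2) ⟨Metric.ball_subset_closedBall hs, hp.2⟩
    have h2 : ‖p.1 + s • v - P.1‖ ^ 2 =
        ‖p.1 - P.1‖ ^ 2 + 2 * (s * inner ℝ (p.1 - P.1) v) + s ^ 2 := by
      rw [add_sub_right_comm, norm_add_sq_real, inner_smul_right, norm_smul, hv, mul_one,
        Real.norm_eq_abs, sq_abs]
    have h3 : φ (p.1 + s • v, p.2) = φ p + s * (-(2 * ℓ / ρ ^ 2) * inner ℝ (p.1 - P.1) v) +
        s ^ 2 * -(2 * ℓ / ρ ^ 2) / 2 := by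
      simp only [hφ, h2]; ring
    rw [h3] at h1
    have : 0 ≤ ε * s ^ 2 := by positivity
    linarith
  have ht : ∀ ε > 0, ∀ᶠ s in 𝓝[>] (0 : ℝ), w p - -(ℓ * c) * s - ε * s ≤ w (p.1, p.2 - s) := by
    intro ε hε
    filter_upwards [Ioo_mem_nhdsGT hp2'] with s hs
    have h1 := hmin (p.1, p.2 - s) ⟨hp.1, by simp only; linarith [hs.2],
      by simp only; linarith [hs.1, hp.2.2]⟩
    have h3 : φ (p.1, p.2 - s) = φ p + ℓ * c * s := by simp only [hφ]; ring
    rw [h3] at h1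
    have : 0 ≤ ε * s := mul_nonneg hε.le hs.1.le
    linarith
  obtain ⟨e, μ, hμ, hsum⟩ := hpS.touch hl.le hx ht
  rw [← Finset.sum_mul] at hsum
  have h1 : ∑ k, μ k ≤ (m + 1) * Lam := by
    refine (Finset.sum_le_sum fun k _ => (hμ k).2).trans (le_of_eq ?_)
    simp
  have h2 : (∑ k, μ k) * (2 * ℓ / ρ ^ 2) ≤ (m + 1) * Lam * (2 * ℓ / ρ ^ 2) :=
    mul_le_mul_of_nonneg_right h1 (by positivity)
  have h3 : ℓ * c = 2 * ((m + 1) * Lam * (2 * ℓ / ρ ^ 2)) := by rw [hc]; ring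
  have h4 : 0 < (m + 1) * Lam * (2 * ℓ / ρ ^ 2) := by positivity
  linarith

/-- A nonnegative solution in a parabolic box around a point of the closed set `B`, outside of which
it is continuous. -/
structure SingBox {m : ℕ} (lam Lam : ℝ) (v : Spc m × ℝ → ℝ) (B : Set (Spc m × ℝ))
    (p : Spc m × ℝ) (η : ℝ) : Prop where
  pos : 0 < η
  closed : IsClosed B
  mem : p ∈ B
  sup : ∀ z ∈ box p η (η ^ 2), SupAt lam Lam v z
  sub : ∀ z ∈ box p η (η ^ 2), SupAt lam Lam (fun z => -v z) z
  nonneg : ∀ z ∈ box p η (η ^ 2), 0 ≤ v z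
  cont : ∀ z ∈ box p η (η ^ 2), z ∉ B → ContinuousAt v z

namespace SingBox

variable {m : ℕ} {lam Lam : ℝ} {v : Spc m × ℝ → ℝ} {B : Set (Spc m × ℝ)} {p : Spc m × ℝ} {η : ℝ}

lemma posSol (h : SingBox lam Lam v B p η) {D : Set (Spc m × ℝ)}
    (hD : ∀ z ∈ D, z ∈ box p η (η ^ 2) ∧ z ∉ B) : PosSol lam Lam v D :=
  ⟨⟨fun z hz => (h.cont z (hD z hz).1 (hD z hz).2).continuousWithinAt,
    fun z hz => h.nonneg z (hD z hz).1, fun z hz => h.sup z (hD z hz).1⟩,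
    fun z hz => h.sub z (hD z hz).1⟩

lemma isCompact_times (h : SingBox lam Lam v B p η) :
    IsCompact (Prod.snd '' (box p η (η ^ 2) ∩ B)) := by
  have : IsCompact (box p η (η ^ 2)) := (isCompact_closedBall _ _).prod isCompact_Icc
  exact (this.inter_right h.closed).image continuous_snd

lemma exists_prev (h : SingBox lam Lam v B p η) {t : ℝ} (ht : p.2 - η ^ 2 ≤ t) :
    ∃ a ≤ t, p.2 - η ^ 2 ≤ a ∧ (a = p.2 - η ^ 2 ∨ ∃ x, (x, a) ∈ box p η (η ^ 2) ∩ B) ∧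
      ∀ z ∈ box p η (η ^ 2), a < z.2 → z.2 ≤ t → z ∉ B := by
  obtain ⟨a, ⟨ha1, ha2⟩, hmax⟩ := ((h.isCompact_times.union
    (isCompact_singleton (x := p.2 - η ^ 2))).inter_right
    (isClosed_Iic (a := t))).exists_isGreatest ⟨p.2 - η ^ 2, Or.inr rfl, ht⟩
  refine ⟨a, ha2, hmax ⟨Or.inr rfl, ht⟩, ?_, ?_⟩
  · rcases ha1 with ⟨z, hz, rfl⟩ | ha1
    · exact Or.inr ⟨z.1, hz⟩
    · exact Or.inl ha1
  · intro z hz h1 h2 h3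
    exact absurd (hmax ⟨Or.inl ⟨z, ⟨hz, h3⟩, rfl⟩, h2⟩) (not_le.2 h1)

lemma exists_next (h : SingBox lam Lam v B p η) {t : ℝ} (ht : t ≤ p.2 + η ^ 2) :
    ∃ b ≥ t, b ≤ p.2 + η ^ 2 ∧ (b = p.2 + η ^ 2 ∨ ∃ x, (x, b) ∈ box p η (η ^ 2) ∩ B) ∧
      ∀ z ∈ box p η (η ^ 2), t ≤ z.2 → z.2 < b → z ∉ B := by
  obtain ⟨a, ⟨ha1, ha2⟩, hmax⟩ := ((h.isCompact_times.union
    (isCompact_singleton (x := p.2 + η ^ 2))).inter_right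
    (isClosed_Ici (a := t))).exists_isLeast ⟨p.2 + η ^ 2, Or.inr rfl, ht⟩
  refine ⟨a, ha2, hmax ⟨Or.inr rfl, ht⟩, ?_, ?_⟩
  · rcases ha1 with ⟨z, hz, rfl⟩ | ha1
    · exact Or.inr ⟨z.1, hz⟩
    · exact Or.inl ha1
  · intro z hz h1 h2 h3
    exact absurd (hmax ⟨Or.inl ⟨z, ⟨hz, h3⟩, rfl⟩, h1⟩) (not_le.2 h2)

lemma self_mem (h : SingBox lam Lam v B p η) : p ∈ box p η (η ^ 2) :=
  mem_box.2 ⟨by simpa using h.pos.le, by simpa using sq_nonneg η⟩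

lemma exists_nearest (h : SingBox lam Lam v B p η) (y : Spc m) (a : ℝ) :
    ∃ z, (∃ τ, (z, τ) ∈ box p η (η ^ 2) ∩ B) ∧ ‖z - y‖ ≤ ‖p.1 - y‖ ∧
      ∀ x, (x, a) ∈ box p η (η ^ 2) → ‖x - y‖ < ‖z - y‖ → (x, a) ∉ B := by
  have hK : IsCompact (box p η (η ^ 2) ∩ B ∩ {z | z.2 = a}) :=
    ((((isCompact_closedBall _ _).prod isCompact_Icc).inter_right h.closed).inter_right
      (isClosed_eq continuous_snd continuous_const) :)
  obtain ⟨z, hz, hmin⟩ := (hK.union (isCompact_singleton (x := p))).exists_isMinOn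
    ⟨p, Or.inr rfl⟩ (f := fun z => ‖z.1 - y‖) (by fun_prop)
  refine ⟨z.1, ?_, hmin (Or.inr rfl), ?_⟩
  · rcases hz with hz | hz
    · exact ⟨z.2, hz.1⟩
    · rw [mem_singleton_iff.1 hz]; exact ⟨p.2, h.self_mem, h.mem⟩
  · intro x h1 h2 h3
    exact absurd (hmin (Or.inl ⟨⟨h1, h3⟩, rfl⟩)) (not_le.2 h2)

end SingBox

lemma norm_sub_le_three {E : Type*} [NormedAddCommGroup E] (x z y p : E) :
    ‖x - p‖ ≤ ‖x - z‖ + ‖z - y‖ + ‖y - p‖ := by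
  have : x - p = (x - z) + (z - y) + (y - p) := by abel
  rw [this]; exact norm_add₃_le

set_option maxHeartbeats 1000000 in
lemma SingBox.lower (m : ℕ) {lam Lam : ℝ} (hl : 0 < lam) (hL : lam ≤ Lam) :
    ∃ c θ : ℝ, 0 < c ∧ 0 < θ ∧ ∀ (v : Spc m × ℝ → ℝ) (B : Set (Spc m × ℝ)) (p : Spc m × ℝ)
      (η ℓ : ℝ), SingBox lam Lam v B p η → 0 ≤ ℓ →
      (∀ z ∈ box p η (η ^ 2) ∩ B, ∀ y, (y, z.2) ∈ box p η (η ^ 2) → ℓ ≤ v (y, z.2)) →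
      (∀ z ∈ box p η (η ^ 2) ∩ B, ∀ τ, (z.1, τ) ∈ box p η (η ^ 2) → ℓ ≤ v (z.1, τ)) →
      ∀ q ∈ box p (θ * η) ((θ * η) ^ 2), c * ℓ ≤ v q := by
  have hLp : 0 < Lam := hl.trans_le hL
  set K : ℝ := (m + 1) * Lam with hK
  have hKp : 0 < K := by positivity
  set κ : ℝ := min (1 / 4) (1 / (64 * K)) with hκ
  have hκp : 0 < κ := by positivity
  have hκ4 : κ ≤ 1 / 4 := min_le_left _ _
  have hκK : κ * (64 * K) ≤ 1 := by
    rw [← le_div_iff₀ (by positivity)]; exact min_le_right _ _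
  obtain ⟨C, R, hC, hR, hH⟩ := harnack_forward m hl hL hκp (by linarith)
  refine ⟨1 / (2 * C), 1 / (R + 4), by positivity, by positivity, ?_⟩
  intro v B p η ℓ h hℓ h1 h2 q hq
  have hη := h.pos
  set e : ℝ := 1 / (R + 4) * η with he
  have hep : 0 < e := by positivity
  have heη : R * e + 4 * e = η := by rw [he]; field_simp
  have hRe : e ≤ R * e := le_mul_of_one_le_left hep.le hR
  have he2 : e ^ 2 ≤ η ^ 2 / 25 := by
    have : e ≤ η / 5 := by linarith
    exact (pow_le_pow_left₀ hep.le this 2).trans_eq (by ring)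
  have hη2 : 0 < η ^ 2 := by positivity
  obtain ⟨hq1, hq2⟩ := mem_box.1 hq
  have hq2 := abs_le.1 hq2
  obtain ⟨y, t⟩ := q
  simp only at hq1 hq2
  have hC1 : 1 / (2 * C) * ℓ ≤ ℓ / 2 := by
    rw [div_mul_eq_mul_div, one_mul]
    exact div_le_div_of_nonneg_left hℓ two_pos (by linarith)
  obtain ⟨a, hat, hpa, haT, hab⟩ := h.exists_prev (t := t) (by linarith)
  obtain ⟨z, ⟨τ, hz⟩, hzy, hnear⟩ := h.exists_nearest y a
  set d := ‖z - y‖ with hd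
  have hde : d ≤ e := by rw [norm_sub_rev] at hzy; linarith
  have hd0 : 0 ≤ d := norm_nonneg _
  have hde2 : d ^ 2 ≤ e ^ 2 := pow_le_pow_left₀ hd0 hde 2
  have hRd : R * d ≤ R * e := mul_le_mul_of_nonneg_left hde (by linarith)
  rcases hd0.eq_or_lt with h0 | hdpos
  · have hzy' : z = y := by rw [hd] at h0; exact sub_eq_zero.1 (norm_eq_zero.1 h0.symm)
    have := h2 _ hz t (mem_box.2 ⟨by simp only [hzy']; linarith, abs_le.2 ⟨by simp only; linarith,
      by simp only; linarith⟩⟩)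
    simp only [hzy'] at this
    linarith
  have hd2 : 0 < d ^ 2 := by positivity
  have hκd : 0 < κ * d ^ 2 := by positivity
  have hκd4 : κ * d ^ 2 ≤ 1 / 4 * d ^ 2 := mul_le_mul_of_nonneg_right hκ4 hd2.le
  rcases le_or_gt (t - a) (2 * (κ * d ^ 2)) with hcase | hcase
  · obtain ⟨x, hx⟩ : ∃ x, (x, a) ∈ box p η (η ^ 2) ∩ B := by
      rcases haT with h | h
      · exfalso; linarith
      · exact h
    have hDbox : ∀ z' ∈ Metric.closedBall y (d / 2) ×ˢ Icc a (a + (t - a)),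
        z' ∈ box p η (η ^ 2) ∧ z' ∉ B := by
      rintro ⟨x', s⟩ ⟨hx', hs1, hs2⟩
      have hx' : ‖x' - y‖ ≤ d / 2 := by simpa [dist_eq_norm] using hx'
      simp only at hs1 hs2
      have hb : (x', s) ∈ box p η (η ^ 2) := by
        refine mem_box.2 ⟨?_, abs_le.2 ⟨?_, ?_⟩⟩
        · have := norm_sub_le_three x' y y p.1
          simp only [sub_self, norm_zero] at this ⊢
          linarith
        · simp only; linarith
        · simp only; linarith
      refine ⟨hb, ?_⟩
      rcases hs1.eq_or_lt with hs | hs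
      · rw [← hs] at hb ⊢
        exact hnear x' hb (by linarith)
      · exact hab _ hb hs (by simp only; linarith)
    have hps := h.posSol hDbox
    have := initial_lower hl hL (P := (y, a)) (w := v) (ρ := d / 2) (T := t - a) (ℓ := ℓ)
      (by positivity) hℓ hps.1.1 hps.1.2.1 (fun z' hz' => hps.1.2.2 z'
        ⟨Metric.ball_subset_closedBall hz'.1, Ioc_subset_Icc_self hz'.2⟩)
      (fun x' hx' => h1 _ hx x' (hDbox (x', a) ⟨hx', le_rfl, by simp only; linarith⟩).1)
      (t := t) ⟨hat, by simp only; linarith⟩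
    refine hC1.trans (le_trans ?_ this)
    have h3 : 4 * K / (d / 2) ^ 2 * (t - a) ≤ 1 / 2 := by
      have : 4 * K / (d / 2) ^ 2 * (t - a) ≤ 4 * K / (d / 2) ^ 2 * (2 * (κ * d ^ 2)) :=
        mul_le_mul_of_nonneg_left hcase (by positivity)
      have e1 : 4 * K / (d / 2) ^ 2 * (2 * (κ * d ^ 2)) = κ * (64 * K) / 2 := by
        field_simp; ring
      linarith
    have := mul_le_mul_of_nonneg_left h3 hℓ
    simp only
    linarith
  · have hDbox : ∀ z' ∈ Metric.closedBall z (R * d) ×ˢ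
        Icc (t - κ * d ^ 2 - κ * d ^ 2) (t - κ * d ^ 2 + κ * d ^ 2),
        z' ∈ box p η (η ^ 2) ∧ z' ∉ B := by
      rintro ⟨x', s⟩ ⟨hx', hs1, hs2⟩
      have hx' : ‖x' - z‖ ≤ R * d := by simpa [dist_eq_norm] using hx'
      simp only at hs1 hs2
      have hb : (x', s) ∈ box p η (η ^ 2) := by
        refine mem_box.2 ⟨?_, abs_le.2 ⟨?_, ?_⟩⟩
        · have := norm_sub_le_three x' z y p.1
          simp only
          linarith
        · simp only; linarith
        · simp only; linarith
      exact ⟨hb, hab _ hb (by simp only; linarith) (by simp only; linarith)⟩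
    have := hH v (z, t - κ * d ^ 2) d hdpos (h.posSol hDbox) y
      (by rw [mem_closedBall_iff_norm, norm_sub_rev])
    simp only [sub_add_cancel] at this
    have h3 := h2 _ hz (t - κ * d ^ 2) (hDbox (z, t - κ * d ^ 2)
      ⟨Metric.mem_closedBall_self (by positivity), by simp only; linarith,
        by simp only; linarith⟩).1
    have h4 : ℓ ≤ C * v (y, t) := h3.trans this
    rw [div_mul_eq_mul_div, one_mul, div_le_iff₀ (by positivity)]
    linarith

set_option maxHeartbeats 2000000 in
lemma SingBox.upper (m : ℕ) {lam Lam : ℝ} (hl : 0 < lam) (hL : lam ≤ Lam) :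
    ∃ C θ : ℝ, 0 < C ∧ 0 < θ ∧ ∀ (v : Spc m × ℝ → ℝ) (B : Set (Spc m × ℝ)) (p : Spc m × ℝ)
      (η ℓ : ℝ), SingBox lam Lam v B p η → 0 ≤ ℓ →
      (∀ z ∈ box p η (η ^ 2) ∩ B, ∀ y, (y, z.2) ∈ box p η (η ^ 2) → v (y, z.2) ≤ ℓ) →
      (∀ z ∈ box p η (η ^ 2) ∩ B, ∀ τ, (z.1, τ) ∈ box p η (η ^ 2) → v (z.1, τ) ≤ ℓ) →
      (∀ z ∈ box p η (η ^ 2), ContinuousAt (fun s => v (z.1, s)) z.2) →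
      ∀ q ∈ box p (θ * η) ((θ * η) ^ 2), v q ≤ C * ℓ := by
  obtain ⟨C₁, R₁, hC₁, hR₁, hH₁⟩ := harnack_forward m hl hL (κ := 1 / 4) (by norm_num) (by norm_num)
  obtain ⟨C₂, R₂, hC₂, hR₂, hH₂⟩ := harnack_initial m hl hL (κ := 1) (by norm_num) (by norm_num)
  refine ⟨C₁ + C₂, 1 / (2 * R₁ + 2 * R₂ + 8), by positivity, by positivity, ?_⟩
  intro v B p η ℓ h hℓ h1 h2 hct q hq
  have hη := h.pos
  set e : ℝ := 1 / (2 * R₁ + 2 * R₂ + 8) * η with he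
  have hep : 0 < e := by positivity
  have heη : 2 * (R₁ * e) + 2 * (R₂ * e) + 8 * e = η := by rw [he]; field_simp
  have hRe₁ : e ≤ R₁ * e := le_mul_of_one_le_left hep.le hR₁
  have hRe₂ : e ≤ R₂ * e := le_mul_of_one_le_left hep.le hR₂
  have he2 : e ^ 2 ≤ η ^ 2 / 144 := by
    have : e ≤ η / 12 := by linarith
    exact (pow_le_pow_left₀ hep.le this 2).trans_eq (by ring)
  have hη2 : 0 < η ^ 2 := by positivity
  have he2p : 0 < e ^ 2 := by positivity
  have hw₁ : C₁ * ℓ ≤ (C₁ + C₂) * ℓ := mul_le_mul_of_nonneg_right (by linarith) hℓ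
  have hw₂ : C₂ * ℓ ≤ (C₁ + C₂) * ℓ := mul_le_mul_of_nonneg_right (by linarith) hℓ
  obtain ⟨hq1, hq2⟩ := mem_box.1 hq
  have hq2 := abs_le.1 hq2
  obtain ⟨y, t⟩ := q
  simp only at hq1 hq2
  have hpt : ∀ x s, ‖x - y‖ ≤ 2 * (R₁ * e) + 2 * (R₂ * e) → |s - t| ≤ 3 * e ^ 2 →
      (x, s) ∈ box p η (η ^ 2) := by
    intro x s hx hs
    have hs := abs_le.1 hs
    refine mem_box.2 ⟨?_, abs_le.2 ⟨?_, ?_⟩⟩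
    · have := norm_sub_le_three x y y p.1
      simp only [sub_self, norm_zero] at this ⊢
      linarith
    · simp only; linarith
    · simp only; linarith
  obtain ⟨a, hat, hpa, haT, hab⟩ := h.exists_prev (t := t) (by linarith)
  obtain ⟨b, hbt, hpb, hbT, hbb⟩ := h.exists_next (t := t) (by linarith)
  have hgood : ∀ x s, ‖x - y‖ ≤ 2 * (R₁ * e) + 2 * (R₂ * e) → |s - t| ≤ 3 * e ^ 2 → a < s → s < b →
      (x, s) ∈ box p η (η ^ 2) ∧ (x, s) ∉ B := by
    intro x s hx hs h3 h4
    have hb := hpt x s hx hs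
    refine ⟨hb, ?_⟩
    rcases le_total s t with h5 | h5
    · exact hab _ hb h3 h5
    · exact hbb _ hb h5 h4
  have haT' : t - a ≤ e ^ 2 → ∀ x, ‖x - y‖ ≤ 2 * (R₁ * e) + 2 * (R₂ * e) → v (x, a) ≤ ℓ := by
    intro h3 x hx
    rcases haT with h4 | ⟨x', h4⟩
    · exfalso; linarith
    · exact h1 _ h4 x (hpt x a hx (abs_le.2 ⟨by linarith, by linarith⟩))
  have hyy : ‖y - y‖ ≤ 2 * (R₁ * e) + 2 * (R₂ * e) := by rw [sub_self, norm_zero]; positivity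
  have hbT' : b - t ≤ e ^ 2 → v (y, b) ≤ ℓ := by
    intro h3
    rcases hbT with h4 | ⟨x', h4⟩
    · exfalso; linarith
    · exact h1 _ h4 y (hpt y b hyy (abs_le.2 ⟨by linarith, by linarith⟩))
  have hlim : ∀ C s₀, 0 ≤ C → s₀ < b → b - t ≤ e ^ 2 →
      (∀ s, s₀ < s → s < b → v (y, t) ≤ C * max ℓ (v (y, s))) → v (y, t) ≤ C * ℓ := by
    intro C s₀ hC hs₀ hbe hs
    have hc := hct (y, b) (hpt y b hyy (abs_le.2 ⟨by linarith, by linarith⟩))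
    have hc2 : Tendsto (fun s => C * max ℓ (v (y, s))) (𝓝[<] b) (𝓝 (C * max ℓ (v (y, b)))) :=
      ((tendsto_const_nhds.max (hc.tendsto.mono_left nhdsWithin_le_nhds)).const_mul C)
    have := ge_of_tendsto hc2 (by
      filter_upwards [Ioo_mem_nhdsLT hs₀] with s hs' using hs s hs'.1 hs'.2)
    rwa [max_eq_left (hbT' hbe)] at this
  rcases hat.eq_or_lt with hta | hta
  · have h3 := haT' (by rw [hta, sub_self]; exact he2p.le) y hyy
    rw [hta] at h3
    have : ℓ ≤ C₁ * ℓ := le_mul_of_one_le_left hℓ hC₁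
    linarith
  rcases (show t ≤ b from hbt).eq_or_lt with htb | htb
  · have h3 := hbT' (by rw [← htb, sub_self]; exact he2p.le)
    rw [← htb] at h3
    have : ℓ ≤ C₁ * ℓ := le_mul_of_one_le_left hℓ hC₁
    linarith
  have hor : p.2 ≤ a ∨ b ≤ p.2 := by
    rcases le_total p.2 t with h3 | h3
    · left
      by_contra! h4
      exact hab p h.self_mem h4 h3 h.mem
    · right
      by_contra! h4
      exact hbb p h.self_mem h3 h4 h.mem
  rcases le_or_gt (b - t) (t - a) with hcase | hcase
  · have hbe : b - t ≤ e ^ 2 := by rcases hor with h3 | h3 <;> linarith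
    refine (hlim C₁ t (by linarith) htb hbe ?_).trans hw₁
    intro s hs1 hs2
    set ρ := √(4 * (s - t)) with hρ
    have hρ2 : ρ ^ 2 = 4 * (s - t) := Real.sq_sqrt (by linarith)
    have hρp : 0 < ρ := Real.sqrt_pos.2 (by linarith)
    have hρe : ρ ≤ 2 * e := abs_le_of_sq_le_sq' (by nlinarith) (by linarith) |>.2
    have hRρ : R₁ * ρ ≤ R₁ * (2 * e) := mul_le_mul_of_nonneg_left hρe (by linarith)
    have hps : PosSol lam Lam v (Metric.closedBall y (R₁ * ρ) ×ˢ
        Icc (t - 1 / 4 * ρ ^ 2) (t + 1 / 4 * ρ ^ 2)) := by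
      refine h.posSol ?_
      rintro ⟨x', s'⟩ ⟨hx', hs'1, hs'2⟩
      have hx' : ‖x' - y‖ ≤ R₁ * ρ := by simpa [dist_eq_norm] using hx'
      simp only at hs'1 hs'2
      exact hgood x' s' (by linarith) (abs_le.2 ⟨by linarith, by linarith⟩) (by linarith)
        (by linarith)
    have h3 := hH₁ v (y, t) ρ hρp hps y (Metric.mem_closedBall_self hρp.le)
    have h4 : t + 1 / 4 * ρ ^ 2 = s := by rw [hρ2]; ring
    simp only [h4] at h3
    exact h3.trans (mul_le_mul_of_nonneg_left (le_max_right _ _) (by linarith))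
  have hae : t - a ≤ e ^ 2 := by rcases hor with h3 | h3 <;> linarith
  obtain ⟨z, ⟨τ, hz⟩, hzy, hnear⟩ := h.exists_nearest y a
  set d := ‖z - y‖ with hd
  have hde : d ≤ e := by rw [norm_sub_rev] at hzy; linarith
  have hd0 : 0 ≤ d := norm_nonneg _
  have hde2 : d ^ 2 ≤ e ^ 2 := pow_le_pow_left₀ hd0 hde 2
  rcases le_or_gt (d ^ 2) (2 * (t - a)) with hB1 | hB1
  · set ρ := √(2 * (t - a)) with hρ
    have hρ2 : ρ ^ 2 = 2 * (t - a) := Real.sq_sqrt (by linarith)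
    have hρp : 0 < ρ := Real.sqrt_pos.2 (by linarith)
    have hρe : ρ ≤ 2 * e := abs_le_of_sq_le_sq' (by nlinarith) (by linarith) |>.2
    have hdρ : d ≤ ρ := abs_le_of_sq_le_sq' (by linarith) hρp.le |>.2
    have hRρ : R₁ * ρ ≤ R₁ * (2 * e) := mul_le_mul_of_nonneg_left hρe (by linarith)
    have hps : PosSol lam Lam v (Metric.closedBall y (R₁ * ρ) ×ˢ
        Icc (t - 1 / 4 * ρ ^ 2) (t + 1 / 4 * ρ ^ 2)) := by
      refine h.posSol ?_
      rintro ⟨x', s'⟩ ⟨hx', hs'1, hs'2⟩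
      have hx' : ‖x' - y‖ ≤ R₁ * ρ := by simpa [dist_eq_norm] using hx'
      simp only at hs'1 hs'2
      exact hgood x' s' (by linarith) (abs_le.2 ⟨by linarith, by linarith⟩) (by linarith)
        (by linarith)
    have h3 := hH₁ v (y, t) ρ hρp hps z (by rw [mem_closedBall_iff_norm]; exact hdρ)
    have h4 := h2 _ hz (t + 1 / 4 * ρ ^ 2) (hpt z _ (by linarith)
      (abs_le.2 ⟨by linarith, by linarith⟩))
    simp only at h3 h4
    have h5 : C₁ * v (z, t + 1 / 4 * ρ ^ 2) ≤ C₁ * ℓ := mul_le_mul_of_nonneg_left h4 (by linarith)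
    linarith
  have hinit : ∀ ρ, 0 < ρ → ρ ≤ d → a + ρ ^ 2 < b → 2 * (t - a) ≤ ρ ^ 2 →
      ∀ x ∈ Metric.closedBall y ρ, v (y, t) ≤ C₂ * max ℓ (v (x, a + ρ ^ 2)) := by
    intro ρ hρ hρd hρb hρt
    have hρ2 : ρ ^ 2 ≤ d ^ 2 := pow_le_pow_left₀ hρ.le hρd 2
    have hRρ : R₂ * ρ ≤ R₂ * e := mul_le_mul_of_nonneg_left (by linarith) (by linarith)
    have hps : PosSol lam Lam v (Metric.closedBall y (R₂ * ρ) ×ˢ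
        Ioc a (a + 1 * ρ ^ 2)) := by
      refine h.posSol ?_
      rintro ⟨x', s'⟩ ⟨hx', hs'1, hs'2⟩
      have hx' : ‖x' - y‖ ≤ R₂ * ρ := by simpa [dist_eq_norm] using hx'
      simp only at hs'1 hs'2
      exact hgood x' s' (by linarith) (abs_le.2 ⟨by linarith, by linarith⟩) (by linarith)
        (by linarith)
    have hcont : ContinuousOn v (Metric.closedBall y (1 / 2 * ρ) ×ˢ Icc a (a + 1 * ρ ^ 2)) := by
      rintro ⟨x', s'⟩ ⟨hx', hs'1, hs'2⟩
      have hx' : ‖x' - y‖ ≤ 1 / 2 * ρ := by simpa [dist_eq_norm] using hx'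
      simp only at hs'1 hs'2
      refine (h.cont _ (hpt x' s' (by linarith) (abs_le.2 ⟨by linarith, by linarith⟩)) ?_
        ).continuousWithinAt
      rcases hs'1.eq_or_lt with h3 | h3
      · rw [← h3]
        exact hnear x' (hpt x' a (by linarith) (abs_le.2 ⟨by linarith, by linarith⟩))
          (by linarith)
      · exact (hgood x' s' (by linarith) (abs_le.2 ⟨by linarith, by linarith⟩) h3
          (by linarith)).2
    intro x hx
    have := hH₂ v (y, a) ρ ℓ hρ hℓ hps hcont (fun x' hx' => haT' hae x' (by
      have hx' : ‖x' - y‖ ≤ 1 / 2 * ρ := by simpa [dist_eq_norm] using hx'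
      linarith)) t ⟨hat, by simp only; linarith⟩ x hx
    simpa only [one_mul] using this
  have hdp : 0 < d := by
    rcases hd0.eq_or_lt with h3 | h3
    · rw [← h3] at hB1; exfalso; norm_num at hB1; linarith
    · exact h3
  rcases lt_or_ge (a + d ^ 2) b with hB2 | hB3
  · have h3 := hinit d hdp le_rfl hB2 hB1.le z (by rw [mem_closedBall_iff_norm])
    have h4 := h2 _ hz (a + d ^ 2) (hpt z _ (by linarith)
      (abs_le.2 ⟨by linarith, by linarith⟩))
    simp only at h4
    rw [max_eq_left h4] at h3
    linarith
  · refine (hlim C₂ (2 * t - a) (by linarith) (by linarith) (by linarith) ?_).trans hw₂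
    intro s hs1 hs2
    have hρ2 : √(s - a) ^ 2 = s - a := Real.sq_sqrt (by linarith)
    have hρp : 0 < √(s - a) := Real.sqrt_pos.2 (by linarith)
    have h3 := hinit √(s - a) hρp
      (abs_le_of_sq_le_sq' (by linarith) hd0 |>.2) (by linarith) (by linarith) y
      (Metric.mem_closedBall_self hρp.le)
    rwa [hρ2, add_sub_cancel] at h3

lemma exists_box_of_eventually {m : ℕ} {p : Spc m × ℝ} {P : Spc m × ℝ → Prop}
    (h : ∀ᶠ z in 𝓝 p, P z) {η : ℝ} (hη : 0 < η) :
    ∃ δ, 0 < δ ∧ δ ≤ η ∧ ∀ z ∈ box p δ (δ ^ 2), P z := by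
  obtain ⟨ε, hε, hP⟩ := Metric.eventually_nhds_iff.1 h
  refine ⟨min (min η 1) (ε / 2), by positivity, (min_le_left _ _).trans (min_le_left _ _), ?_⟩
  set δ := min (min η 1) (ε / 2) with hδ
  have h0 : 0 < δ := by positivity
  have h1 : δ ≤ 1 := (min_le_left _ _).trans (min_le_right _ _)
  have h2 : δ ≤ ε / 2 := min_le_right _ _
  intro z hz
  obtain ⟨hz1, hz2⟩ := mem_box.1 hz
  refine hP ?_
  rw [Prod.dist_eq, dist_eq_norm, Real.dist_eq]
  have : δ ^ 2 ≤ δ := by nlinarith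
  exact max_lt (by linarith) (by linarith)

lemma box_mem_nhds {m : ℕ} (p : Spc m × ℝ) {a b : ℝ} (ha : 0 < a) (hb : 0 < b) :
    box p a b ∈ 𝓝 p := by
  have := prod_mem_nhds (Metric.closedBall_mem_nhds p.1 ha) (Icc_mem_nhds
    (show p.2 - b < p.2 by linarith) (show p.2 < p.2 + b by linarith))
  exact this

/-- The value at `p` dominates the lower limit at `p`, provided that the values on the time slices
and on the vertical lines through the exceptional points tend to the value at `p`. -/
lemma eventually_lower_of_exceptional (m : ℕ) {lam Lam : ℝ} (hl : 0 < lam) (hL : lam ≤ Lam)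
    {w : Spc m × ℝ → ℝ} {B : Set (Spc m × ℝ)} {p : Spc m × ℝ} {η : ℝ} (hη : 0 < η)
    (hB : IsClosed B) (hp : p ∈ B)
    (hsup : ∀ z ∈ box p η (η ^ 2), SupAt lam Lam w z)
    (hsub : ∀ z ∈ box p η (η ^ 2), SupAt lam Lam (fun z => -w z) z)
    (hcont : ∀ z ∈ box p η (η ^ 2), z ∉ B → ContinuousAt w z)
    (hR : ∀ e > 0, ∃ δ > 0, ∀ z ∈ box p δ (δ ^ 2) ∩ B,
      (∀ y, (y, z.2) ∈ box p δ (δ ^ 2) → w p - e ≤ w (y, z.2)) ∧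
      ∀ τ, (z.1, τ) ∈ box p δ (δ ^ 2) → w p - e ≤ w (z.1, τ))
    (hbd : ∃ a, ∀ᶠ z in 𝓝 p, a ≤ w z) {a : ℝ} (ha : a < w p) : ∀ᶠ z in 𝓝 p, a ≤ w z := by
  obtain ⟨c, θ, hc, hθ, hlow⟩ := SingBox.lower m hl hL
  have hbox : ∀ {δ δ' : ℝ}, 0 < δ → δ ≤ δ' → box p δ (δ ^ 2) ⊆ box p δ' (δ' ^ 2) :=
    fun h h' => box_mono h' (pow_le_pow_left₀ h.le h' 2)
  have hstep : ∀ a e, 0 < e → a ≤ w p - e → (∀ᶠ z in 𝓝 p, a ≤ w z) →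
      ∀ᶠ z in 𝓝 p, a + c * (w p - e - a) ≤ w z := by
    intro a e he hae hev
    obtain ⟨δ₀, hδ₀, h₀⟩ := hR e he
    obtain ⟨δ, hδ, hδη, hδa⟩ := exists_box_of_eventually hev (lt_min hη hδ₀)
    have hs1 : box p δ (δ ^ 2) ⊆ box p η (η ^ 2) := hbox hδ (hδη.trans (min_le_left _ _))
    have hs2 : box p δ (δ ^ 2) ⊆ box p δ₀ (δ₀ ^ 2) := hbox hδ (hδη.trans (min_le_right _ _))
    have hS : SingBox lam Lam (fun z => w z - a) B p δ :=
      { pos := hδ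
        closed := hB
        mem := hp
        sup := fun z hz => by
          simpa [sub_eq_add_neg] using (hsup z (hs1 hz)).affine one_pos (-a)
        sub := fun z hz => by
          have := (hsub z (hs1 hz)).affine one_pos a
          simpa [sub_eq_add_neg, add_comm] using this
        nonneg := fun z hz => sub_nonneg.2 (hδa z hz)
        cont := fun z hz hzB => (hcont z (hs1 hz) hzB).sub continuousAt_const }
    have := hlow _ B p δ (w p - e - a) hS (by linarith)
      (fun z hz y hy => sub_le_sub_right ((h₀ z ⟨hs2 hz.1, hz.2⟩).1 y (hs2 hy)) _)
      (fun z hz y hy => sub_le_sub_right ((h₀ z ⟨hs2 hz.1, hz.2⟩).2 y (hs2 hy)) _)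
    filter_upwards [box_mem_nhds p (mul_pos hθ hδ) (by positivity : 0 < (θ * δ) ^ 2)] with z hz
    have := this z hz
    linarith
  set S := {a | ∀ᶠ z in 𝓝 p, a ≤ w z} with hS
  have hSb : ∀ a ∈ S, a ≤ w p := fun a ha =>
    Eventually.self_of_nhds (p := fun z => a ≤ w z) ha
  have hSbdd : BddAbove S := ⟨w p, hSb⟩
  have hSne : S.Nonempty := hbd
  have hs : w p ≤ sSup S := by
    by_contra! hlt
    set s := sSup S
    have hgap : 0 < w p - s := by linarith
    obtain ⟨a', ha', hlt'⟩ := exists_lt_of_lt_csSup hSne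
      (show s - c * (w p - s) / 4 < s by have := mul_pos hc hgap; linarith)
    have has : a' ≤ s := le_csSup hSbdd ha'
    have h1 := hstep a' ((w p - s) / 2) (by linarith) (by linarith) ha'
    have h2 : a' + c * (w p - (w p - s) / 2 - a') ≤ s := le_csSup hSbdd h1
    have h3 : c * ((w p - s) / 2) ≤ c * (w p - (w p - s) / 2 - a') :=
      mul_le_mul_of_nonneg_left (by linarith) hc.le
    have h4 : 0 < c * (w p - s) := mul_pos hc hgap
    linarith
  obtain ⟨a', ha', hlt'⟩ := exists_lt_of_lt_csSup hSne (ha.trans_le hs)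
  exact (show ∀ᶠ z in 𝓝 p, a' ≤ w z from ha').mono fun z hz => by linarith

lemma SingBox.continuousAt {m : ℕ} {lam Lam : ℝ} (hl : 0 < lam) (hL : lam ≤ Lam)
    {u : Spc m × ℝ → ℝ} {B : Set (Spc m × ℝ)} {p : Spc m × ℝ} {η k : ℝ} (hk : 0 < k)
    (h : SingBox lam Lam u B p η)
    (h1 : ∀ z ∈ box p η (η ^ 2) ∩ B, ∀ y, (y, z.2) ∈ box p η (η ^ 2) →
      |u (y, z.2) - u z| ≤ k * ‖y - z.1‖)
    (h2 : ∀ z ∈ box p η (η ^ 2) ∩ B, ∀ τ, (z.1, τ) ∈ box p η (η ^ 2) →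
      |u (z.1, τ) - u z| ≤ k * |τ - z.2|)
    (hct : ∀ z ∈ box p η (η ^ 2), ContinuousAt (fun s => u (z.1, s)) z.2) :
    ContinuousAt u p := by
  have hη := h.pos
  have hpp : p ∈ box p η (η ^ 2) ∩ B := ⟨h.self_mem, h.mem⟩
  have hbox : ∀ {δ δ' : ℝ}, 0 < δ → δ ≤ δ' → box p δ (δ ^ 2) ⊆ box p δ' (δ' ^ 2) :=
    fun h h' => box_mono h' (pow_le_pow_left₀ h.le h' 2)
  have hR : ∀ e > 0, ∃ δ > 0, δ ≤ η ∧ ∀ z ∈ box p δ (δ ^ 2) ∩ B,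
      (∀ y, (y, z.2) ∈ box p δ (δ ^ 2) → |u (y, z.2) - u p| ≤ e) ∧
      ∀ τ, (z.1, τ) ∈ box p δ (δ ^ 2) → |u (z.1, τ) - u p| ≤ e := by
    intro e he
    refine ⟨min (min η 1) (e / (6 * k)), by positivity,
      (min_le_left _ _).trans (min_le_left _ _), ?_⟩
    set δ := min (min η 1) (e / (6 * k)) with hδ
    have hδ0 : 0 < δ := by positivity
    have hδη : δ ≤ η := (min_le_left _ _).trans (min_le_left _ _)
    have hδ1 : δ ≤ 1 := (min_le_left _ _).trans (min_le_right _ _)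
    have hδe : k * δ ≤ e / 6 := by
      have : δ ≤ e / (6 * k) := min_le_right _ _
      rw [le_div_iff₀ (by positivity)] at this
      linarith
    have hδ2 : k * δ ^ 2 ≤ k * δ := mul_le_mul_of_nonneg_left (by nlinarith) hk.le
    have hs := hbox hδ0 hδη
    intro z hz
    obtain ⟨hz1, hz2⟩ := mem_box.1 hz.1
    have hpz : (p.1, z.2) ∈ box p η (η ^ 2) := by
      refine hs (mem_box.2 ⟨?_, hz2⟩)
      simp only [sub_self, norm_zero]; exact hδ0.le
    have e1 := abs_le.1 (h1 z ⟨hs hz.1, hz.2⟩ p.1 hpz)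
    have e2 := abs_le.1 (h2 p hpp z.2 hpz)
    rw [norm_sub_rev] at e1
    have e3 : k * ‖z.1 - p.1‖ ≤ k * δ := mul_le_mul_of_nonneg_left hz1 hk.le
    have e4 : k * |z.2 - p.2| ≤ k * δ ^ 2 := mul_le_mul_of_nonneg_left hz2 hk.le
    constructor
    · intro y hy
      have hy1 := (mem_box.1 hy).1
      simp only at hy1
      have e5 := abs_le.1 (h1 z ⟨hs hz.1, hz.2⟩ y (hs hy))
      have e6 : k * ‖y - z.1‖ ≤ k * (2 * δ) := by
        refine mul_le_mul_of_nonneg_left ?_ hk.le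
        have := norm_sub_le_norm_sub_add_norm_sub y p.1 z.1
        rw [norm_sub_rev p.1] at this
        linarith
      exact abs_le.2 ⟨by linarith, by linarith⟩
    · intro τ hτ
      have hy1 := (mem_box.1 hτ).2
      simp only at hy1
      have e5 := abs_le.1 (h2 z ⟨hs hz.1, hz.2⟩ τ (hs hτ))
      have e6 : k * |τ - z.2| ≤ k * (2 * δ ^ 2) := by
        refine mul_le_mul_of_nonneg_left ?_ hk.le
        have := abs_sub_le τ p.2 z.2
        rw [abs_sub_comm p.2] at this
        linarith
      exact abs_le.2 ⟨by linarith, by linarith⟩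
  have hup : ∃ M, ∀ᶠ z in 𝓝 p, u z ≤ M := by
    obtain ⟨C, θ, hC, hθ, hU⟩ := SingBox.upper m hl hL
    obtain ⟨δ, hδ, hδη, hd⟩ := hR 1 one_pos
    have hs := hbox hδ hδη
    have h0 := h.nonneg p h.self_mem
    refine ⟨C * (u p + 1), ?_⟩
    have hS : SingBox lam Lam u B p δ :=
      ⟨hδ, h.closed, h.mem, fun z hz => h.sup z (hs hz), fun z hz => h.sub z (hs hz),
        fun z hz => h.nonneg z (hs hz), fun z hz => h.cont z (hs hz)⟩
    filter_upwards [box_mem_nhds p (mul_pos hθ hδ) (by positivity : 0 < (θ * δ) ^ 2)] with z hz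
    exact hU u B p δ (u p + 1) hS (by linarith)
      (fun z hz y hy => by have := (abs_le.1 ((hd z hz).1 y hy)).2; linarith)
      (fun z hz y hy => by have := (abs_le.1 ((hd z hz).2 y hy)).2; linarith)
      (fun z hz => hct z (hs hz)) z hz
  have hlow : ∀ a, a < u p → ∀ᶠ z in 𝓝 p, a ≤ u z := by
    intro a ha
    refine eventually_lower_of_exceptional m hl hL hη h.closed h.mem h.sup h.sub h.cont ?_
      ⟨0, ?_⟩ ha
    · intro e he
      obtain ⟨δ, hδ, -, hd⟩ := hR e he
      exact ⟨δ, hδ, fun z hz => ⟨fun y hy => by have := (abs_le.1 ((hd z hz).1 y hy)).1; linarith,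
        fun y hy => by have := (abs_le.1 ((hd z hz).2 y hy)).1; linarith⟩⟩
    · filter_upwards [box_mem_nhds p hη (by positivity : 0 < η ^ 2)] with z hz using h.nonneg z hz
  have hupp : ∀ a, u p < a → ∀ᶠ z in 𝓝 p, u z ≤ a := by
    intro a ha
    have := eventually_lower_of_exceptional m hl hL (w := fun z => -u z) (a := -a) hη h.closed
      h.mem h.sub (fun z hz => by simpa using h.sup z hz)
      (fun z hz hzB => (h.cont z hz hzB).neg) (by
        intro e he
        obtain ⟨δ, hδ, -, hd⟩ := hR e he
        exact ⟨δ, hδ, fun z hz =>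
          ⟨fun y hy => by have := (abs_le.1 ((hd z hz).1 y hy)).2; linarith,
          fun y hy => by have := (abs_le.1 ((hd z hz).2 y hy)).2; linarith⟩⟩)
      (by
        obtain ⟨M, hM⟩ := hup
        exact ⟨-M, hM.mono fun z hz => neg_le_neg hz⟩) (neg_lt_neg ha)
    exact this.mono fun z hz => neg_le_neg_iff.1 hz
  rw [ContinuousAt, tendsto_order]
  constructor
  · intro a ha
    obtain ⟨b, hab, hb⟩ := exists_between ha
    exact (hlow b hb).mono fun z hz => hab.trans_le hz
  · intro a ha
    obtain ⟨b, hab, hb⟩ := exists_between ha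
    exact (hupp b hab).mono fun z hz => hz.trans_lt hb

/-- The function `u` has difference quotients at `p` bounded by `k` in space and in time, at the
scale `1 / k`. -/
def SliceLip {m : ℕ} (u : Spc m × ℝ → ℝ) (Ω : Set (Spc m × ℝ)) (k : ℝ) (p : Spc m × ℝ) : Prop :=
  (∀ τ, |τ - p.2| < 1 / k → (p.1, τ) ∈ Ω → |u (p.1, τ) - u p| ≤ k * |τ - p.2|) ∧
  ∀ y, ‖y - p.1‖ < 1 / k → (y, p.2) ∈ Ω → |u (y, p.2) - u p| ≤ k * ‖y - p.1‖

lemma SliceLip.of_tendsto {m : ℕ} {u : Spc m × ℝ → ℝ} {Ω : Set (Spc m × ℝ)} {k : ℝ} (hk : 0 < k)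
    (hΩ : IsOpen Ω) (hx : ∀ z ∈ Ω, ContinuousAt (fun y => u (y, z.2)) z.1)
    (ht : ∀ z ∈ Ω, ContinuousAt (fun s => u (z.1, s)) z.2) {f : ℕ → Spc m × ℝ} {p : Spc m × ℝ}
    (hp : p ∈ Ω) (hf : Tendsto f atTop (𝓝 p)) (h : ∀ n, SliceLip u Ω k (f n)) :
    SliceLip u Ω k p := by
  have hk' : 0 < 1 / k := by positivity
  have hf1 : Tendsto (fun n => (f n).1) atTop (𝓝 p.1) := (continuous_fst.tendsto p).comp hf
  have hf2 : Tendsto (fun n => (f n).2) atTop (𝓝 p.2) := (continuous_snd.tendsto p).comp hf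
  have hd : ∀ τ, Tendsto (fun n => |τ - (f n).2|) atTop (𝓝 |τ - p.2|) := fun τ =>
    (tendsto_const_nhds.sub hf2).abs
  have hd1 : ∀ y, Tendsto (fun n => ‖y - (f n).1‖) atTop (𝓝 ‖y - p.1‖) := fun τ =>
    (tendsto_const_nhds.sub hf1).norm
  have hin : ∀ τ, (p.1, τ) ∈ Ω → ∀ᶠ n in atTop, ((f n).1, τ) ∈ Ω := fun τ hτ =>
    (hf1.prodMk_nhds tendsto_const_nhds).eventually (hΩ.mem_nhds hτ)
  have hin1 : ∀ y, (y, p.2) ∈ Ω → ∀ᶠ n in atTop, (y, (f n).2) ∈ Ω := fun y hy =>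
    (Tendsto.prodMk_nhds (tendsto_const_nhds (x := y)) hf2).eventually (hΩ.mem_nhds hy)
  have hslice : ∀ τ, (p.1, τ) ∈ Ω → Tendsto (fun n => u ((f n).1, τ)) atTop (𝓝 (u (p.1, τ))) :=
    fun τ hτ => (hx (p.1, τ) hτ).tendsto.comp hf1
  have hslice1 : ∀ y, (y, p.2) ∈ Ω → Tendsto (fun n => u (y, (f n).2)) atTop (𝓝 (u (y, p.2))) :=
    fun y hy => (ht (y, p.2) hy).tendsto.comp hf2
  have hlim : Tendsto (fun n => u (f n)) atTop (𝓝 (u p)) := by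
    have h0 : Tendsto (fun n => k * |p.2 - (f n).2|) atTop (𝓝 0) := by
      have := (hd p.2).const_mul k
      simpa using this
    have h1 : Tendsto (fun n => u ((f n).1, p.2) - u (f n)) atTop (𝓝 0) := by
      refine squeeze_zero_norm' ?_ h0
      have hev : ∀ᶠ n in atTop, |p.2 - (f n).2| < 1 / k :=
        (hd p.2).eventually (gt_mem_nhds (by simpa using hk))
      filter_upwards [hin p.2 hp, hev] with n hn hn'
      exact (h n).1 p.2 hn' hn
    simpa using (hslice p.2 hp).sub h1
  refine ⟨fun τ hτ hτΩ => ?_, fun y hy hyΩ => ?_⟩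
  · refine le_of_tendsto_of_tendsto ((hslice τ hτΩ).sub hlim).abs ((hd τ).const_mul k) ?_
    filter_upwards [hin τ hτΩ, (hd τ).eventually (gt_mem_nhds hτ)] with n hn hn'
    exact (h n).1 τ hn' hn
  · refine le_of_tendsto_of_tendsto ((hslice1 y hyΩ).sub hlim).abs ((hd1 y).const_mul k) ?_
    filter_upwards [hin1 y hyΩ, (hd1 y).eventually (gt_mem_nhds hy)] with n hn hn'
    exact (h n).2 y hn' hn

lemma exists_sliceLip {m : ℕ} {u : Spc m × ℝ → ℝ} {Ω : Set (Spc m × ℝ)} {p : Spc m × ℝ}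
    (hx : DifferentiableAt ℝ (fun y => u (y, p.2)) p.1)
    (ht : DifferentiableAt ℝ (fun s => u (p.1, s)) p.2) :
    ∃ n : ℕ, SliceLip u Ω (n + 1) p := by
  obtain ⟨c₁, h₁⟩ := ht.isBigO_sub.bound
  obtain ⟨c₂, h₂⟩ := hx.isBigO_sub.bound
  obtain ⟨ε₁, hε₁, h₁⟩ := Metric.eventually_nhds_iff.1 h₁
  obtain ⟨ε₂, hε₂, h₂⟩ := Metric.eventually_nhds_iff.1 h₂
  obtain ⟨n, hn⟩ := exists_nat_gt (max (max c₁ c₂) (max (1 / ε₁) (1 / ε₂)))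
  have hn0 : (0 : ℝ) < n + 1 := by positivity
  simp only [max_lt_iff] at hn
  obtain ⟨⟨hn1, hn2⟩, hn3, hn4⟩ := hn
  have e1 : 1 / ((n : ℝ) + 1) < ε₁ := by
    rw [div_lt_comm₀ hn0 hε₁]; linarith
  have e2 : 1 / ((n : ℝ) + 1) < ε₂ := by
    rw [div_lt_comm₀ hn0 hε₂]; linarith
  refine ⟨n, fun τ hτ _ => ?_, fun y hy _ => ?_⟩
  · have := h₁ (y := τ) (by rw [Real.dist_eq]; linarith)
    rw [Real.norm_eq_abs, Real.norm_eq_abs] at this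
    exact this.trans (mul_le_mul_of_nonneg_right (by linarith) (abs_nonneg _))
  · have := h₂ (y := y) (by rw [dist_eq_norm]; linarith)
    rw [Real.norm_eq_abs] at this
    exact this.trans (mul_le_mul_of_nonneg_right (by linarith) (norm_nonneg _))

/-- A positive pointwise solution is jointly continuous. -/
lemma SolvesL.continuousOn {m : ℕ} {lam Lam : ℝ} (hl : 0 < lam) (hL : lam ≤ Lam)
    {A : Spc m → Matrix (Fin (m + 1)) (Fin (m + 1)) ℝ}
    (hA : IsElliptic lam Lam A) {u : Spc m × ℝ → ℝ} {Ω : Set (Spc m × ℝ)} (hΩ : IsOpen Ω)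
    (h : SolvesL A u Ω) (hpos : ∀ p ∈ Ω, 0 < u p) : ∀ p ∈ Ω, ContinuousAt u p := by
  have hdx : ∀ z ∈ Ω, DifferentiableAt ℝ (fun y => u (y, z.2)) z.1 := fun z hz =>
    (h z hz).1.differentiableAt (by simp)
  have hdt : ∀ z ∈ Ω, DifferentiableAt ℝ (fun s => u (z.1, s)) z.2 := fun z hz =>
    (h z hz).2.differentiableAt
  set B : Set (Spc m × ℝ) := {p | ∀ᶠ q in 𝓝 p, ContinuousAt u q}ᶜ with hB
  have hBc : IsClosed B := isOpen_setOfPred_eventually_nhds.isClosed_compl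
  have hBn : ∀ p, p ∉ B → ∀ᶠ q in 𝓝 p, ContinuousAt u q := fun p hp => not_not.1 hp
  suffices hemp : ∀ p ∈ Ω, p ∉ B from fun p hp => (hBn p (hemp p hp)).self_of_nhds
  by_contra! hne
  obtain ⟨p₁, hp₁, hp₁B⟩ := hne
  have hloc : IsLocallyClosed (B ∩ Ω) := hBc.isLocallyClosed.inter hΩ.isLocallyClosed
  have : LocallyCompactSpace (B ∩ Ω : Set (Spc m × ℝ)) := hloc.locallyCompactSpace
  have : Nonempty (B ∩ Ω : Set (Spc m × ℝ)) := ⟨⟨p₁, hp₁B, hp₁⟩⟩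
  obtain ⟨n, ⟨⟨p, hpB, hpΩ⟩, hpint⟩⟩ := nonempty_interior_of_iUnion_of_closed
    (X := (B ∩ Ω : Set (Spc m × ℝ))) (f := fun n : ℕ => {p | SliceLip u Ω (n + 1) p.1})
    (fun n => IsSeqClosed.isClosed fun f p hf hlim =>
      SliceLip.of_tendsto (by positivity) hΩ (fun z hz => (hdx z hz).continuousAt)
        (fun z hz => (hdt z hz).continuousAt) p.2.2 ((continuous_subtype_val.tendsto p).comp hlim)
        hf)
    (iUnion_eq_univ_iff.2 fun p => exists_sliceLip (hdx p.1 p.2.2) (hdt p.1 p.2.2))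
  set k : ℝ := n + 1 with hk
  have hk0 : 0 < k := by positivity
  have hev : ∀ᶠ q in 𝓝 p, q ∈ Ω ∧ (q ∈ B → SliceLip u Ω k q) := by
    have := mem_interior_iff_mem_nhds.1 hpint
    obtain ⟨t, ht, hsub⟩ := mem_nhds_subtype (B ∩ Ω) _ _ |>.1 this
    filter_upwards [ht, hΩ.mem_nhds hpΩ] with q hq hqΩ
    exact ⟨hqΩ, fun hqB => hsub (a := ⟨q, hqB, hqΩ⟩) hq⟩
  refine hpB ?_
  filter_upwards [hev.eventually_nhds] with q hq
  by_cases hqB : q ∈ B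
  swap
  · exact (hBn q hqB).self_of_nhds
  obtain ⟨η, hη, hη1, hbox⟩ := exists_box_of_eventually hq
    (show 0 < min 1 (1 / (4 * k)) by positivity)
  have hη2 : η ≤ 1 := hη1.trans (min_le_left _ _)
  have hη3 : 4 * η ≤ 1 / k := by
    have := hη1.trans (min_le_right _ _)
    have e1 : 1 / (4 * k) = 1 / k / 4 := by field_simp
    linarith
  have hη4 : η ^ 2 ≤ η := by nlinarith
  have hS : SingBox lam Lam u B q η :=
    { pos := hη
      closed := hBc
      mem := hqB
      sup := fun z hz => h.supAt hA (hbox z hz).1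
      sub := fun z hz => h.neg.supAt hA (hbox z hz).1
      nonneg := fun z hz => (hpos z (hbox z hz).1).le
      cont := fun z hz hzB => (hBn z hzB).self_of_nhds }
  refine hS.continuousAt hl hL hk0 ?_ ?_ fun z hz => (hdt z (hbox z hz).1).continuousAt
  · intro z hz y hy
    refine ((hbox z hz.1).2 hz.2).2 y ?_ (hbox _ hy).1
    have h1 := (mem_box.1 hz.1).1
    have h2 := (mem_box.1 hy).1
    have := norm_sub_le_norm_sub_add_norm_sub y q.1 z.1
    rw [norm_sub_rev q.1] at this
    simp only at h2
    linarith
  · intro z hz τ hτ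
    refine ((hbox z hz.1).2 hz.2).1 τ ?_ (hbox _ hτ).1
    have h1 := (mem_box.1 hz.1).2
    have h2 := (mem_box.1 hτ).2
    have := abs_sub_le τ q.2 z.2
    rw [abs_sub_comm q.2] at this
    simp only at h2
    linarith

lemma xprime_mkPt {m : ℕ} (a : Spc' m) (b : ℝ) : xprime (mkPt a b) = a := by
  ext i
  simp [xprime, mkPt]

lemma xlast_mkPt {m : ℕ} (a : Spc' m) (b : ℝ) : xlast (mkPt a b) = b := by
  simp [xlast, mkPt]

lemma norm_sq_eq_xprime {m : ℕ} (x : Spc m) : ‖x‖ ^ 2 = ‖xprime x‖ ^ 2 + xlast x ^ 2 := by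
  rw [EuclideanSpace.norm_sq_eq, EuclideanSpace.norm_sq_eq, Fin.sum_univ_castSucc]
  simp [xprime, xlast]

lemma xprime_sub {m : ℕ} (x y : Spc m) : xprime (x - y) = xprime x - xprime y := by
  ext i; simp [xprime]

lemma xlast_sub {m : ℕ} (x y : Spc m) : xlast (x - y) = xlast x - xlast y := by
  simp [xlast]

lemma norm_xprime_le {m : ℕ} (x : Spc m) : ‖xprime x‖ ≤ ‖x‖ := by
  have := norm_sq_eq_xprime x
  exact abs_le_of_sq_le_sq' (by nlinarith [sq_nonneg (xlast x)]) (norm_nonneg _) |>.2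

lemma abs_xlast_le {m : ℕ} (x : Spc m) : |xlast x| ≤ ‖x‖ := by
  have := norm_sq_eq_xprime x
  exact abs_le_of_sq_le_sq (by nlinarith [sq_nonneg ‖xprime x‖]) (norm_nonneg _)

lemma norm_le_xprime_add_xlast {m : ℕ} (x : Spc m) : ‖x‖ ≤ ‖xprime x‖ + |xlast x| := by
  have := norm_sq_eq_xprime x
  refine abs_le_of_sq_le_sq' ?_ (by positivity) |>.2
  have h1 := sq_abs (xlast x)
  nlinarith [mul_nonneg (norm_nonneg (xprime x)) (abs_nonneg (xlast x))]

lemma continuous_xprime {m : ℕ} : Continuous (xprime : Spc m → Spc' m) := by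
  have : Continuous fun x : Spc m => fun i : Fin m => x i.castSucc := by fun_prop
  exact (PiLp.continuous_toLp 2 _).comp this

lemma continuous_xlast {m : ℕ} : Continuous (xlast : Spc m → ℝ) := by
  unfold xlast; fun_prop

lemma mkPt_xprime_xlast {m : ℕ} (x : Spc m) : mkPt (xprime x) (xlast x) = x := by
  ext i
  by_cases h : i = Fin.last m
  · subst h; simp [mkPt, xlast]
  · simp [mkPt, h, xprime]

lemma continuous_hGamma {m : ℕ} {g : Spc' m → ℝ → ℝ}
    (hg : Continuous (fun q : Spc' m × ℝ => g q.1 q.2)) : Continuous (hGamma g) := by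
  unfold hGamma
  exact (continuous_xlast.comp continuous_fst).sub
    (hg.comp ((continuous_xprime.comp continuous_fst).prodMk continuous_snd))

lemma mem_Cyl_iff {m : ℕ} {g : Spc' m → ℝ → ℝ} {r : ℝ} {p : Spc m × ℝ} :
    p ∈ Cyl g r ↔ ‖xprime p.1‖ < r ∧ |p.2| < r ^ 2 ∧ 0 < hGamma g p ∧ hGamma g p < r := by
  simp only [Cyl, mem_ofPred_eq, hGamma, abs_lt]
  constructor
  · rintro ⟨h1, h2, h3, h4, h5⟩
    exact ⟨h1, ⟨h2, h3⟩, by linarith, by linarith⟩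
  · rintro ⟨h1, ⟨h2, h3⟩, h4, h5⟩
    exact ⟨h1, h2, h3, by linarith, by linarith⟩

lemma isOpen_Cyl {m : ℕ} {g : Spc' m → ℝ → ℝ}
    (hg : Continuous (fun q : Spc' m × ℝ => g q.1 q.2)) (r : ℝ) : IsOpen (Cyl g r) := by
  have : Cyl g r = {p : Spc m × ℝ | ‖xprime p.1‖ < r} ∩ {p | |p.2| < r ^ 2} ∩
      {p | 0 < hGamma g p} ∩ {p | hGamma g p < r} := by
    ext p; rw [mem_Cyl_iff]; simp only [mem_inter_iff, mem_ofPred_eq]; tauto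
  rw [this]
  have h := continuous_hGamma hg
  exact ((((isOpen_lt (continuous_xprime.comp continuous_fst).norm continuous_const).inter
    (isOpen_lt continuous_snd.abs continuous_const)).inter (isOpen_lt continuous_const h)).inter
    (isOpen_lt h continuous_const))

lemma abs_hGamma_sub_le {m : ℕ} {g : Spc' m → ℝ → ℝ} {α β K a b : ℝ} (hα : 0 ≤ α) (hβ : 0 ≤ β)
    (hK : 0 ≤ K) (hg : HolderSemi α β K g) {z w : Spc m × ℝ} (h1 : ‖z.1 - w.1‖ ≤ a)
    (h2 : |z.2 - w.2| ≤ b) : |hGamma g z - hGamma g w| ≤ a + K * (a ^ α + b ^ β) := by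
  have e1 := (abs_xlast_le (z.1 - w.1)).trans h1
  have e2 := (norm_xprime_le (z.1 - w.1)).trans h1
  rw [xlast_sub] at e1
  rw [xprime_sub] at e2
  have e3 := hg (xprime z.1) (xprime w.1) z.2 w.2
  have e4 : ‖xprime z.1 - xprime w.1‖ ^ α ≤ a ^ α := Real.rpow_le_rpow (norm_nonneg _) e2 hα
  have e5 : |z.2 - w.2| ^ β ≤ b ^ β := Real.rpow_le_rpow (abs_nonneg _) h2 hβ
  have e6 : K * (‖xprime z.1 - xprime w.1‖ ^ α + |z.2 - w.2| ^ β) ≤ K * (a ^ α + b ^ β) :=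
    mul_le_mul_of_nonneg_left (by linarith) hK
  have : hGamma g z - hGamma g w = (xlast z.1 - xlast w.1) -
    (g (xprime z.1) z.2 - g (xprime w.1) w.2) := by simp only [hGamma]; ring
  rw [this]
  exact (abs_sub _ _).trans (by linarith)

/-- Harnack chain along a space-time segment. -/
lemma harnack_chain (m : ℕ) {lam Lam : ℝ} (hl : 0 < lam) (hL : lam ≤ Lam) :
    ∃ C R : ℝ, 1 ≤ C ∧ 1 ≤ R ∧ ∀ (u : Spc m × ℝ → ℝ) (D : Set (Spc m × ℝ)), PosSol lam Lam u D →
      ∀ (P Q : Spc m × ℝ) (N : ℕ), 0 < N → P.2 < Q.2 →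
      ‖Q.1 - P.1‖ ^ 2 ≤ 4 * N * (Q.2 - P.2) →
      (∀ s ∈ Icc (0 : ℝ) 1, box (P + s • (Q - P)) (R * (2 * √((Q.2 - P.2) / N)))
        ((Q.2 - P.2) / N) ⊆ D) →
      u P ≤ C ^ N * u Q := by
  obtain ⟨C, R, hC, hR, hH⟩ := harnack_forward m hl hL (κ := 1 / 4) (by norm_num) (by norm_num)
  refine ⟨C, R, hC, hR, ?_⟩
  intro u D hu P Q N hN hPQ hdist hD
  have hN0 : (0 : ℝ) < N := by exact_mod_cast hN
  have hτ : 0 < (Q.2 - P.2) / N := div_pos (by linarith) hN0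
  set ρ := 2 * √((Q.2 - P.2) / N) with hρ
  have hρp : 0 < ρ := mul_pos two_pos (Real.sqrt_pos.2 hτ)
  have hρ2 : 1 / 4 * ρ ^ 2 = (Q.2 - P.2) / N := by
    rw [hρ, mul_pow, Real.sq_sqrt hτ.le]; ring
  have hstep : ‖Q.1 - P.1‖ / N ≤ ρ := by
    refine abs_le_of_sq_le_sq' ?_ hρp.le |>.2
    have : ρ ^ 2 = 4 * ((Q.2 - P.2) / N) := by linarith
    rw [this, div_pow, div_le_iff₀ (by positivity)]
    refine hdist.trans_eq ?_
    field_simp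
  have key : ∀ i : ℕ, i ≤ N → u P ≤ C ^ i * u (P + ((i : ℝ) / N) • (Q - P)) := by
    intro i
    induction i with
    | zero => intro _; simp
    | succ i ih =>
      intro hi
      refine (ih (by omega)).trans ?_
      have hi' : (i : ℝ) + 1 ≤ N := by exact_mod_cast hi
      set X := P + ((i : ℝ) / N) • (Q - P) with hX
      have hs : (i : ℝ) / N ∈ Icc (0 : ℝ) 1 :=
        ⟨by positivity, by rw [div_le_one hN0]; linarith⟩
      have h1 := hH u X ρ hρp (hu.mono (Subset.trans (fun z hz => by
        rw [hρ2] at hz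
        exact hz) (hD _ hs))) (X.1 + (1 / N : ℝ) • (Q.1 - P.1)) (by
        rw [mem_closedBall_iff_norm, add_sub_cancel_left, norm_smul, Real.norm_of_nonneg
          (by positivity), one_div, inv_mul_eq_div]
        exact hstep)
      have h2 : (X.1 + (1 / N : ℝ) • (Q.1 - P.1), X.2 + 1 / 4 * ρ ^ 2) =
          P + (((i + 1 : ℕ) : ℝ) / N) • (Q - P) := by
        rw [hρ2]
        refine Prod.ext ?_ ?_
        · simp only [hX, Prod.fst_add, Prod.smul_fst, Prod.fst_sub]
          rw [add_assoc, ← add_smul]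
          congr 2
          push_cast; ring
        · simp only [hX, Prod.snd_add, Prod.smul_snd, Prod.snd_sub, smul_eq_mul]
          push_cast; ring
      rw [h2] at h1
      rw [pow_succ, mul_assoc]
      exact mul_le_mul_of_nonneg_left h1 (by positivity)
  have := key N le_rfl
  rwa [div_self hN0.ne', one_smul, add_sub_cancel] at this

/-- Harnack inequality between two points at comparable distance. -/
lemma harnack_link (m : ℕ) {lam Lam : ℝ} (hl : 0 < lam) (hL : lam ≤ Lam) {d τ : ℝ} (hd : 0 < d)
    (hτ : 0 < τ) :
    ∃ C : ℝ, 1 ≤ C ∧ ∀ (u : Spc m × ℝ → ℝ) (P Q : Spc m × ℝ),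
      PosSol lam Lam u (box P (2 * d) (2 * d)) → ‖Q.1 - P.1‖ ≤ d → P.2 + τ ≤ Q.2 →
      Q.2 ≤ P.2 + d → u P ≤ C * u Q := by
  obtain ⟨C, R, hC, hR, hH⟩ := harnack_chain m hl hL
  obtain ⟨N, hN⟩ := exists_nat_gt (max 1 (max (d ^ 2 / (4 * τ)) (4 * R ^ 2 / d)))
  simp only [max_lt_iff] at hN
  obtain ⟨hN1, hN2, hN3⟩ := hN
  have hN0 : (0 : ℝ) < N := by linarith
  refine ⟨C ^ N, one_le_pow₀ hC, ?_⟩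
  intro u P Q hu hPQ h1 h2
  have e1 : (Q.2 - P.2) / N ≤ d := by
    rw [div_le_iff₀ hN0]; nlinarith
  refine hH u _ hu P Q N (by exact_mod_cast hN0) (by linarith) ?_ ?_
  · rw [div_lt_iff₀ (by positivity)] at hN2
    have : ‖Q.1 - P.1‖ ^ 2 ≤ d ^ 2 := pow_le_pow_left₀ (norm_nonneg _) hPQ 2
    have : (N : ℝ) * (4 * τ) ≤ N * (4 * (Q.2 - P.2)) :=
      mul_le_mul_of_nonneg_left (by linarith) hN0.le
    linarith
  · intro s hs z hz
    have hz' := mem_box.1 hz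
    have e2 : R * (2 * √((Q.2 - P.2) / N)) ≤ d := by
      have e3 : 2 * √((Q.2 - P.2) / N) ≤ d / R := by
        refine abs_le_of_sq_le_sq' ?_ (by positivity) |>.2
        rw [mul_pow, Real.sq_sqrt (div_nonneg (by linarith) hN0.le), div_pow]
        rw [div_lt_iff₀ hd] at hN3
        have : (Q.2 - P.2) / N ≤ d / N := div_le_div_of_nonneg_right (by linarith) hN0.le
        have e4 : d / N ≤ d ^ 2 / (4 * R ^ 2) := by
          rw [div_le_div_iff₀ hN0 (by positivity)]
          nlinarith
        calc 2 ^ 2 * ((Q.2 - P.2) / N) ≤ 4 * (d ^ 2 / (4 * R ^ 2)) := by linarith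
          _ = d ^ 2 / R ^ 2 := by field_simp
      rw [le_div_iff₀ (by linarith)] at e3
      linarith
    refine mem_box.2 ⟨?_, ?_⟩
    · have e3 : z.1 - P.1 = (z.1 - (P + s • (Q - P)).1) + s • (Q.1 - P.1) := by
        rw [Prod.fst_add, Prod.smul_fst, Prod.fst_sub]; abel
      rw [e3]
      refine (norm_add_le _ _).trans ?_
      rw [norm_smul, Real.norm_of_nonneg hs.1]
      have : s * ‖Q.1 - P.1‖ ≤ 1 * d := mul_le_mul hs.2 hPQ (norm_nonneg _) zero_le_one
      linarith [hz'.1]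
    · have e3 : z.2 - P.2 = (z.2 - (P + s • (Q - P)).2) + s * (Q.2 - P.2) := by
        rw [Prod.snd_add, Prod.smul_snd, Prod.snd_sub, smul_eq_mul]; ring
      rw [e3]
      refine (abs_add_le _ _).trans ?_
      rw [abs_of_nonneg (a := s * (Q.2 - P.2)) (mul_nonneg hs.1 (by linarith))]
      have : s * (Q.2 - P.2) ≤ 1 * d := mul_le_mul hs.2 (by linarith) (by linarith) zero_le_one
      linarith [hz'.2]

set_option maxHeartbeats 1000000 in
/-- One step of the Harnack chain that moves away from the graph. -/
lemma harnack_up (m : ℕ) {lam Lam K α : ℝ} (hl : 0 < lam) (hL : lam ≤ Lam) (hK : 0 < K)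
    (hα : 0 < α) (hα1 : α < 1) :
    ∃ σ A : ℝ, 0 < σ ∧ σ ≤ 1 / 32 ∧ 0 ≤ A ∧ ∀ (g : Spc' m → ℝ → ℝ) (u : Spc m × ℝ → ℝ),
      HolderSemi α (α / (1 + α)) K g → PosSol lam Lam u (Cyl g 1) →
      ∀ x t, 0 < hGamma g (x, t) → hGamma g (x, t) ≤ 1 / 4 → ‖xprime x‖ ≤ 5 / 8 → |t| ≤ 1 / 2 →
      ∃ x₁ t₁, xprime x₁ = xprime x ∧ t ≤ t₁ ∧ t₁ ≤ t + σ * hGamma g (x, t) ∧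
        3 / 2 * hGamma g (x, t) ≤ hGamma g (x₁, t₁) ∧
        hGamma g (x₁, t₁) ≤ 5 / 2 * hGamma g (x, t) ∧
        u (x, t) ≤ Real.exp (A * hGamma g (x, t) ^ (1 - 1 / α)) * u (x₁, t₁) := by
  obtain ⟨C, R, hC, hR, hH⟩ := harnack_chain m hl hL
  set σ : ℝ := min (1 / 32) (1 / (16 * K)) with hσ
  have hσ0 : 0 < σ := by positivity
  have hσ1 : σ ≤ 1 / 32 := min_le_left _ _
  have hσK : K * σ ≤ 1 / 16 := by
    have : σ ≤ 1 / (16 * K) := min_le_right _ _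
    rw [le_div_iff₀ (by positivity)] at this
    linarith
  set A₀ : ℝ := 4 * R ^ 2 + 1 / (4 * σ ^ 2) with hA₀
  have hA₀p : 0 < A₀ := by positivity
  have hlogC : 0 ≤ Real.log C := Real.log_nonneg hC
  refine ⟨σ, (A₀ + 1) * σ ^ (1 - 1 / α) * Real.log C, hσ0, hσ1, by positivity, ?_⟩
  intro g u hg hu x t h0 h1 hx ht
  set h := hGamma g (x, t) with hh
  set q := σ * h with hq
  have hq0 : 0 < q := by positivity
  have hqh : q ≤ h / 32 := by
    have := mul_le_mul_of_nonneg_right hσ1 h0.le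
    rw [hq]; linarith
  have hq1 : q ≤ 1 := by linarith
  have hKq : K * q ≤ h / 16 := by
    have := mul_le_mul_of_nonneg_right hσK h0.le
    rw [hq]; linarith
  have hβ0 : 0 < α / (1 + α) := by positivity
  have hα2 : 1 ≤ 1 / α := by rw [le_div_iff₀ hα]; linarith
  set τ := q ^ (1 + 1 / α) with hτ
  set ω := q ^ (1 / α) with hω
  set E := q ^ (1 - 1 / α) with hE
  have hτ0 : 0 < τ := Real.rpow_pos_of_pos hq0 _
  have hω0 : 0 < ω := Real.rpow_pos_of_pos hq0 _
  have hE0 : 0 < E := Real.rpow_pos_of_pos hq0 _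
  have hτq : τ ≤ q := by
    have := Real.rpow_le_rpow_of_exponent_ge hq0 hq1 (show 1 ≤ 1 + 1 / α by linarith)
    rwa [Real.rpow_one] at this
  have hωq : ω ≤ q := by
    have := Real.rpow_le_rpow_of_exponent_ge hq0 hq1 hα2
    rwa [Real.rpow_one] at this
  have hE1 : 1 ≤ E := Real.one_le_rpow_of_pos_of_le_one_of_nonpos hq0 hq1 (by linarith)
  have hτβ : τ ^ (α / (1 + α)) = q := by
    rw [hτ, ← Real.rpow_mul hq0.le]
    have : (1 + 1 / α) * (α / (1 + α)) = 1 := by field_simp; ring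
    rw [this, Real.rpow_one]
  have hωα : ω ^ α = q := by
    rw [hω, ← Real.rpow_mul hq0.le, one_div, inv_mul_cancel₀ hα.ne', Real.rpow_one]
  have hEτ : E * τ = q ^ 2 := by
    rw [hE, hτ, ← Real.rpow_add hq0, ← Real.rpow_natCast]; congr 1; push_cast; ring
  have hEω : E * ω ^ 2 = τ := by
    rw [hE, hτ, hω, ← Real.rpow_natCast, ← Real.rpow_mul hq0.le, ← Real.rpow_add hq0]; congr 1
    push_cast; ring
  set N := ⌈A₀ * E⌉₊ with hN
  have hNA : A₀ * E ≤ N := Nat.le_ceil _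
  have hNA' : (N : ℝ) ≤ (A₀ + 1) * E := by
    have := Nat.ceil_lt_add_one (show 0 ≤ A₀ * E by positivity)
    linarith
  have hN0 : 0 < N := Nat.ceil_pos.2 (by positivity)
  have hN0' : (0 : ℝ) < N := by exact_mod_cast hN0
  have hN1' : (1 : ℝ) ≤ N := by exact_mod_cast hN0
  set x₁ : Spc m := mkPt (xprime x) (xlast x + h) with hx₁
  have hd' : xprime (x₁ - x) = 0 := by rw [xprime_sub, hx₁, xprime_mkPt, sub_self]
  have hd'' : xlast (x₁ - x) = h := by rw [xlast_sub, hx₁, xlast_mkPt]; ring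
  have hd : ‖x₁ - x‖ ^ 2 = h ^ 2 := by
    rw [norm_sq_eq_xprime, hd', hd'', norm_zero]; ring
  have hτN : τ / N ≤ τ := div_le_self hτ0.le hN1'
  have hrad : R * (2 * √(τ / N)) ≤ ω := by
    have h3 : 2 * √(τ / N) ≤ ω / R := by
      refine abs_le_of_sq_le_sq' ?_ (by positivity) |>.2
      rw [mul_pow, Real.sq_sqrt (by positivity), div_pow, le_div_iff₀ (by positivity),
        ← mul_div_assoc, div_mul_eq_mul_div, div_le_iff₀ hN0']
      have h4 : ω ^ 2 * (4 * R ^ 2 * E) ≤ ω ^ 2 * N := by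
        refine mul_le_mul_of_nonneg_left (le_trans ?_ hNA) (sq_nonneg _)
        refine mul_le_mul_of_nonneg_right ?_ hE0.le
        rw [hA₀]; linarith [show 0 < 1 / (4 * σ ^ 2) by positivity]
      rw [← hEω]
      linarith
    rw [le_div_iff₀ (by linarith)] at h3
    linarith
  have hβ2 : (2 * τ) ^ (α / (1 + α)) ≤ 2 * q := by
    rw [Real.mul_rpow two_pos.le hτ0.le, hτβ]
    refine mul_le_mul_of_nonneg_right ?_ hq0.le
    have : (2 : ℝ) ^ (α / (1 + α)) ≤ 2 ^ (1 : ℝ) :=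
      Real.rpow_le_rpow_of_exponent_le (by norm_num) (by rw [div_le_one (by linarith)]; linarith)
    rwa [Real.rpow_one] at this
  have hw : ∀ s, hGamma g (x + s • (x₁ - x), t) = h + s * h := by
    intro s
    have e1 : xprime (x + s • (x₁ - x)) = xprime x := by
      have : xprime (x + s • (x₁ - x)) = xprime x + s • xprime (x₁ - x) := by
        ext i; simp [xprime]
      rw [this, hd', smul_zero, add_zero]
    have e2 : xlast (x + s • (x₁ - x)) = xlast x + s * h := by
      have : xlast (x + s • (x₁ - x)) = xlast x + s * xlast (x₁ - x) := by simp [xlast]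
      rw [this, hd'']
    rw [hh]
    simp only [hGamma] at e1 e2 ⊢
    rw [e1, e2, hh]
    simp only [hGamma]
    ring
  have htube : ∀ s ∈ Icc (0 : ℝ) 1, ∀ z : Spc m × ℝ, ‖z.1 - (x + s • (x₁ - x))‖ ≤ ω →
      |z.2 - t| ≤ 2 * τ → |hGamma g z - (h + s * h)| ≤ h / 4 := by
    intro s hs z hz1 hz2
    have h3 := abs_hGamma_sub_le hα.le hβ0.le hK.le hg (w := (x + s • (x₁ - x), t)) hz1 hz2
    rw [hw, hωα] at h3
    have h4 : K * (q + (2 * τ) ^ (α / (1 + α))) ≤ K * (q + 2 * q) :=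
      mul_le_mul_of_nonneg_left (by linarith) hK.le
    linarith
  have hend := abs_le.1 (htube 1 ⟨zero_le_one, le_rfl⟩ (x₁, t + τ) (by simp; exact hω0.le)
    (by simp only [add_sub_cancel_left]; rw [abs_of_pos hτ0]; linarith))
  have hx1 : xprime x₁ = xprime x := by rw [hx₁, xprime_mkPt]
  refine ⟨x₁, t + τ, hx1, by linarith, by linarith, by linarith, by linarith, ?_⟩
  have hch := hH u (Cyl g 1) hu (x, t) (x₁, t + τ) N hN0 (by simp only; linarith) (by
    simp only [add_sub_cancel_left]
    rw [hd]
    have h3 : 1 / (4 * σ ^ 2) * E ≤ N := le_trans (mul_le_mul_of_nonneg_right (by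
      rw [hA₀]; linarith [show 0 < 4 * R ^ 2 by positivity]) hE0.le) hNA
    have h4 : 4 * (1 / (4 * σ ^ 2) * E) * τ ≤ 4 * N * τ :=
      mul_le_mul_of_nonneg_right (by linarith) hτ0.le
    refine le_trans (le_of_eq ?_) h4
    have h5 : 4 * (1 / (4 * σ ^ 2) * E) * τ = 1 / σ ^ 2 * (E * τ) := by field_simp
    rw [h5, hEτ, hq]
    field_simp) (by
    intro s hs z hz
    simp only [add_sub_cancel_left] at hz
    obtain ⟨hz1, hz2⟩ := mem_box.1 hz
    simp only [Prod.fst_add, Prod.smul_fst, Prod.fst_sub, Prod.snd_add, Prod.smul_snd,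
      Prod.snd_sub, add_sub_cancel_left, smul_eq_mul] at hz1 hz2
    have hz1 := hz1.trans hrad
    have hz3 : |z.2 - t| ≤ 2 * τ := by
      have h3 := abs_le.1 (hz2.trans hτN)
      have h4 : s * τ ≤ 1 * τ := mul_le_mul_of_nonneg_right hs.2 hτ0.le
      have h5 : 0 ≤ s * τ := mul_nonneg hs.1 hτ0.le
      exact abs_le.2 ⟨by linarith, by linarith⟩
    have h3 := abs_le.1 (htube s hs z hz1 hz3)
    have h4 : s * h ≤ 1 * h := mul_le_mul_of_nonneg_right hs.2 h0.le
    have h5 : 0 ≤ s * h := mul_nonneg hs.1 h0.le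
    refine mem_Cyl_iff.2 ⟨?_, ?_, by linarith, by linarith⟩
    · have e1 : xprime z.1 = xprime x + xprime (z.1 - (x + s • (x₁ - x))) := by
        have : xprime (z.1 - (x + s • (x₁ - x))) = xprime z.1 - (xprime x + s • xprime (x₁ - x)) := by
          ext i; simp [xprime]
        rw [this, hd', smul_zero, add_zero]; abel
      rw [e1]
      have := norm_add_le (xprime x) (xprime (z.1 - (x + s • (x₁ - x))))
      have := norm_xprime_le (z.1 - (x + s • (x₁ - x)))
      linarith
    · have h6 := abs_le.1 hz3
      have h7 := abs_le.1 ht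
      rw [abs_lt]
      constructor <;> linarith)
  refine hch.trans (mul_le_mul_of_nonneg_right ?_ ?_)
  · have hCe : C ^ N = Real.exp (N * Real.log C) := by
      rw [← Real.log_pow, Real.exp_log (by positivity)]
    rw [hCe, Real.exp_le_exp]
    have h3 : E = σ ^ (1 - 1 / α) * h ^ (1 - 1 / α) := by
      rw [hE, hq, Real.mul_rpow hσ0.le h0.le]
    calc (N : ℝ) * Real.log C ≤ (A₀ + 1) * E * Real.log C :=
          mul_le_mul_of_nonneg_right hNA' hlogC
      _ = _ := by rw [h3]; ring
  · refine hu.1.2.1 _ (mem_Cyl_iff.2 ⟨?_, ?_, by linarith, by linarith⟩)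
    · simp only [hx1]; linarith
    · have h7 := abs_le.1 ht
      simp only
      rw [abs_lt]
      constructor <;> linarith

/-- Harnack chain from a point near the graph to a point at unit height. -/
lemma harnack_to_height (m : ℕ) {lam Lam K α : ℝ} (hl : 0 < lam) (hL : lam ≤ Lam) (hK : 0 < K)
    (hα : 0 < α) (hα1 : α < 1) :
    ∃ A : ℝ, 0 ≤ A ∧ ∀ (g : Spc' m → ℝ → ℝ) (u : Spc m × ℝ → ℝ),
      HolderSemi α (α / (1 + α)) K g → PosSol lam Lam u (Cyl g 1) →
      ∀ x t, 0 < hGamma g (x, t) → hGamma g (x, t) ≤ 5 / 8 → ‖xprime x‖ ≤ 5 / 8 → |t| ≤ 3 / 8 →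
      ∃ x₁ t₁, ‖xprime x₁‖ ≤ 5 / 8 ∧ -(3 / 8) ≤ t₁ ∧ t₁ ≤ 7 / 16 ∧
        1 / 4 ≤ hGamma g (x₁, t₁) ∧ hGamma g (x₁, t₁) ≤ 5 / 8 ∧
        u (x, t) ≤ Real.exp (A * hGamma g (x, t) ^ (1 - 1 / α)) * u (x₁, t₁) := by
  obtain ⟨σ, A, hσ, hσ1, hA, hH⟩ := harnack_up m hl hL hK hα hα1
  have he : 1 - 1 / α < 0 := by
    have : 1 < 1 / α := by rw [lt_div_iff₀ hα]; linarith
    linarith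
  set e := 1 - 1 / α with he'
  have hb : ((3 : ℝ) / 2) ^ e < 1 := Real.rpow_lt_one_of_one_lt_of_neg (by norm_num) he
  set b := ((3 : ℝ) / 2) ^ e with hbd
  refine ⟨A / (1 - b), div_nonneg hA (by linarith), ?_⟩
  intro g u hg hu
  have key : ∀ n : ℕ, ∀ x t, 0 < hGamma g (x, t) → 1 / 4 ≤ (3 / 2) ^ n * hGamma g (x, t) →
      hGamma g (x, t) ≤ 5 / 8 → ‖xprime x‖ ≤ 5 / 8 → -(3 / 8) ≤ t →
      t - 2 * σ * hGamma g (x, t) ≤ 3 / 8 →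
      ∃ x₁ t₁, ‖xprime x₁‖ ≤ 5 / 8 ∧ -(3 / 8) ≤ t₁ ∧ t₁ - 2 * σ * hGamma g (x₁, t₁) ≤ 3 / 8 ∧
        1 / 4 ≤ hGamma g (x₁, t₁) ∧ hGamma g (x₁, t₁) ≤ 5 / 8 ∧
        u (x, t) ≤ Real.exp (A / (1 - b) * (hGamma g (x, t) ^ e - hGamma g (x₁, t₁) ^ e)) *
          u (x₁, t₁) := by
    intro n
    induction n with
    | zero =>
      intro x t h0 h1 h2 hx ht1 ht2
      exact ⟨x, t, hx, ht1, ht2, by simpa using h1, h2, by simp⟩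
    | succ n ih =>
      intro x t h0 h1 h2 hx ht1 ht2
      rcases le_or_gt (1 / 4) (hGamma g (x, t)) with h3 | h3
      · exact ⟨x, t, hx, ht1, ht2, h3, h2, by simp⟩
      have hσh : σ * hGamma g (x, t) ≤ 1 / 32 * (1 / 4) := mul_le_mul hσ1 h3.le h0.le (by norm_num)
      obtain ⟨x₁, t₁, hx1, h4, h5, h6, h7, h8⟩ := hH g u hg hu x t h0 h3.le hx
        (abs_le.2 ⟨by linarith, by linarith⟩)
      have hh1 : 0 < hGamma g (x₁, t₁) := by linarith
      have hσh1 : σ * (3 / 2 * hGamma g (x, t)) ≤ σ * hGamma g (x₁, t₁) :=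
        mul_le_mul_of_nonneg_left h6 hσ.le
      obtain ⟨x₂, t₂, g1, g2, g3, g4, g5, g6⟩ := ih x₁ t₁ hh1 (by
        have := mul_le_mul_of_nonneg_left h6 (show (0 : ℝ) ≤ (3 / 2) ^ n by positivity)
        rw [pow_succ] at h1
        linarith) (by linarith) (by rw [hx1]; exact hx) (by linarith) (by linarith)
      refine ⟨x₂, t₂, g1, g2, g3, g4, g5, h8.trans ?_⟩
      refine (mul_le_mul_of_nonneg_left g6 (Real.exp_pos _).le).trans ?_
      rw [← mul_assoc, ← Real.exp_add]
      have hu2 : 0 ≤ u (x₂, t₂) := by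
        by_contra! hneg
        have p1 : 0 ≤ u (x₁, t₁) := by
          by_contra! hneg'
          have p2 := mul_neg_of_pos_of_neg
            (Real.exp_pos (A * hGamma g (x, t) ^ (1 - 1 / α))) hneg'
          have p3 := hu.1.2.1 (x, t) (mem_Cyl_iff.2 ⟨by simp only; linarith,
            by rw [abs_lt]; constructor <;> simp only <;> linarith, h0, by linarith⟩)
          linarith
        have p4 := mul_neg_of_pos_of_neg
          (Real.exp_pos (A / (1 - b) * (hGamma g (x₁, t₁) ^ e - hGamma g (x₂, t₂) ^ e))) hneg
        linarith
      refine mul_le_mul_of_nonneg_right (Real.exp_le_exp.2 ?_) hu2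
      have q1 : hGamma g (x₁, t₁) ^ e ≤ b * hGamma g (x, t) ^ e := by
        rw [hbd, ← Real.mul_rpow (by norm_num) h0.le]
        exact Real.rpow_le_rpow_of_nonpos (by positivity) h6 he.le
      have q2 : A / (1 - b) * hGamma g (x₁, t₁) ^ e ≤ A / (1 - b) * (b * hGamma g (x, t) ^ e) :=
        mul_le_mul_of_nonneg_left q1 (div_nonneg hA (by linarith))
      have q3 : A * hGamma g (x, t) ^ e = A / (1 - b) * ((1 - b) * hGamma g (x, t) ^ e) := by
        have : 1 - b ≠ 0 := by linarith
        field_simp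
      have q4 : A / (1 - b) * ((1 - b) * hGamma g (x, t) ^ e) =
        A / (1 - b) * hGamma g (x, t) ^ e - A / (1 - b) * (b * hGamma g (x, t) ^ e) := by ring
      rw [mul_sub, mul_sub]
      linarith
  intro x t h0 h1 hx ht
  have ht' := abs_le.1 ht
  obtain ⟨n, hn⟩ := pow_unbounded_of_one_lt (1 / 4 / hGamma g (x, t))
    (show (1 : ℝ) < 3 / 2 by norm_num)
  rw [div_lt_iff₀ h0] at hn
  obtain ⟨x₁, t₁, g1, g2, g3, g4, g5, g6⟩ := key n x t h0 hn.le h1 hx ht'.1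
    (by have := mul_pos hσ h0; linarith)
  refine ⟨x₁, t₁, g1, g2, ?_, g4, g5, g6.trans ?_⟩
  · have : σ * hGamma g (x₁, t₁) ≤ 1 / 32 * (5 / 8) := mul_le_mul hσ1 g5 (by linarith) (by norm_num)
    linarith
  · refine mul_le_mul_of_nonneg_right (Real.exp_le_exp.2 ?_) ?_
    · refine mul_le_mul_of_nonneg_left ?_ (div_nonneg hA (by linarith))
      have := Real.rpow_nonneg (show 0 ≤ hGamma g (x₁, t₁) by linarith) e
      linarith
    · have : σ * hGamma g (x₁, t₁) ≤ 1 / 32 * (5 / 8) :=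
        mul_le_mul hσ1 g5 (by linarith) (by norm_num)
      exact hu.1.2.1 _ (mem_Cyl_iff.2 ⟨by simp only; linarith,
        by rw [abs_lt]; constructor <;> simp only <;> linarith, by linarith, by linarith⟩)

lemma exists_modulus_lt {α β : ℝ} (hα : 0 < α) (hβ : 0 < β) (K c : ℝ) {ε : ℝ} (hε : 0 < ε) :
    ∃ d, 0 < d ∧ ∀ s, 0 ≤ s → s ≤ d → c * s + K * (s ^ α + s ^ β) < ε := by
  have hc : Tendsto (fun s : ℝ => c * s + K * (s ^ α + s ^ β)) (𝓝 0) (𝓝 0) := by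
    have : Continuous (fun s : ℝ => c * s + K * (s ^ α + s ^ β)) :=
      (continuous_const.mul continuous_id).add (continuous_const.mul
        ((Real.continuous_rpow_const hα.le).add (Real.continuous_rpow_const hβ.le)))
    have h0 := this.tendsto 0
    simpa [Real.zero_rpow hα.ne', Real.zero_rpow hβ.ne'] using h0
  obtain ⟨d, hd, h⟩ := Metric.eventually_nhds_iff.1 (hc.eventually (gt_mem_nhds hε))
  refine ⟨d / 2, by positivity, fun s h0 hs => h ?_⟩
  rw [Real.dist_eq, sub_zero, abs_of_nonneg h0]
  linarith

set_option maxHeartbeats 1000000 in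
/-- Harnack chain at unit height. -/
lemma harnack_to_Ebar (m : ℕ) {lam Lam K α : ℝ} (hl : 0 < lam) (hL : lam ≤ Lam) (hK : 0 < K)
    (hα : 0 < α) :
    ∃ C : ℝ, 1 ≤ C ∧ ∀ (g : Spc' m → ℝ → ℝ) (u : Spc m × ℝ → ℝ),
      HolderSemi α (α / (1 + α)) K g → PosSol lam Lam u (Cyl g 1) →
      ∀ x t, 1 / 4 ≤ hGamma g (x, t) → hGamma g (x, t) ≤ 5 / 8 → ‖xprime x‖ ≤ 5 / 8 →
      -(3 / 8) ≤ t → t ≤ 7 / 16 → u (x, t) ≤ C * u (Ebar g) := by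
  have hβ : 0 < α / (1 + α) := by positivity
  set β := α / (1 + α) with hβd
  obtain ⟨d₀, hd₀, hmod⟩ := exists_modulus_lt hα hβ K 1 (ε := 1 / 8) (by norm_num)
  set d := min (d₀ / 2) (1 / 32) with hd
  have hd0 : 0 < d := by positivity
  have hd1 : 2 * d ≤ d₀ := by linarith [min_le_left (d₀ / 2) (1 / 32)]
  have hd2 : d ≤ 1 / 32 := min_le_right _ _
  obtain ⟨d₁, hd₁, hmod1⟩ := exists_modulus_lt hα hβ K 2 hd0
  obtain ⟨N, hN⟩ := exists_nat_gt (max 1 (1 / d₁))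
  simp only [max_lt_iff] at hN
  obtain ⟨hN1, hN2⟩ := hN
  have hN0 : (0 : ℝ) < N := by linarith
  have hNd : 1 / (N : ℝ) ≤ d₁ := by
    rw [div_le_iff₀ hN0]
    rw [div_lt_iff₀ hd₁] at hN2
    linarith
  set ν : ℝ := 1 / N with hν
  have hν0 : 0 < ν := by positivity
  have hνmod := hmod1 ν hν0.le hNd
  have hνd : ν ≤ d := by
    have : 0 ≤ K * (ν ^ α + ν ^ β) := by positivity
    linarith
  obtain ⟨C, hC, hH⟩ := harnack_link m hl hL hd0 (τ := ν / 16) (by positivity)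
  refine ⟨C ^ N, one_le_pow₀ hC, ?_⟩
  intro g u hg hu x t h1 h2 hx ht1 ht2
  set h := hGamma g (x, t) with hh
  set X : ℝ → Spc' m := fun s => (1 - s) • xprime x with hX
  set T : ℝ → ℝ := fun s => t + s * (1 / 2 - t) with hT
  set P : ℝ → Spc m × ℝ := fun s => (mkPt (X s) (g (X s) (T s) + (h + s * (1 / 2 - h))), T s) with hP
  have hPh : ∀ s, hGamma g (P s) = h + s * (1 / 2 - h) := by
    intro s; simp [hGamma, hP, xprime_mkPt, xlast_mkPt]
  have hPx : ∀ s, xprime (P s).1 = X s := fun s => xprime_mkPt _ _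
  have hXn : ∀ s ∈ Icc (0 : ℝ) 1, ‖X s‖ ≤ 5 / 8 := by
    intro s hs
    simp only [hX]
    rw [norm_smul, Real.norm_of_nonneg (by linarith [hs.2])]
    have : (1 - s) * ‖xprime x‖ ≤ 1 * (5 / 8) :=
      mul_le_mul (by linarith [hs.1]) hx (norm_nonneg _) zero_le_one
    linarith
  have hsub : ∀ s ∈ Icc (0 : ℝ) 1, box (P s) (2 * d) (2 * d) ⊆ Cyl g 1 := by
    intro s hs z hz
    obtain ⟨hz1, hz2⟩ := mem_box.1 hz
    have h3 := abs_hGamma_sub_le hα.le hβ.le hK.le hg hz1 hz2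
    have h4 := hmod (2 * d) (by positivity) hd1
    rw [hPh] at h3
    have h3 := abs_le.1 h3
    have h5 : (1 / 4 : ℝ) ≤ h + s * (1 / 2 - h) := by nlinarith [hs.1, hs.2]
    have h6 : h + s * (1 / 2 - h) ≤ 5 / 8 := by nlinarith [hs.1, hs.2]
    have h7 : -(3 / 8) ≤ T s := by simp only [hT]; nlinarith [hs.1, hs.2]
    have h8 : T s ≤ 1 / 2 := by simp only [hT]; nlinarith [hs.1, hs.2]
    refine mem_Cyl_iff.2 ⟨?_, ?_, by linarith, by linarith⟩
    · have e1 : xprime z.1 = X s + xprime (z.1 - (P s).1) := by rw [xprime_sub, hPx]; abel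
      rw [e1]
      have := norm_add_le (X s) (xprime (z.1 - (P s).1))
      have := norm_xprime_le (z.1 - (P s).1)
      have := hXn s hs
      linarith
    · have h9 := abs_le.1 hz2
      simp only [hP] at h9
      rw [abs_lt]
      constructor <;> linarith
  have hlink : ∀ s, 0 ≤ s → s + ν ≤ 1 → u (P s) ≤ C * u (P (s + ν)) := by
    intro s hs0 hs1
    refine hH u _ _ (hu.mono (hsub s ⟨hs0, by linarith⟩)) ?_ ?_ ?_
    · refine (norm_le_xprime_add_xlast _).trans ?_
      rw [xprime_sub, xlast_sub, hPx, hPx]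
      have e1 : ‖X (s + ν) - X s‖ ≤ ν := by
        have : X (s + ν) - X s = (-ν) • xprime x := by
          simp only [hX]; rw [← sub_smul]; congr 1; ring
        rw [this, norm_smul, norm_neg, Real.norm_of_nonneg hν0.le]
        nlinarith
      have e2 : |T (s + ν) - T s| ≤ ν := by
        have : T (s + ν) - T s = ν * (1 / 2 - t) := by simp only [hT]; ring
        rw [this, abs_of_nonneg (mul_nonneg hν0.le (by linarith))]
        nlinarith
      have e3 := hg (X (s + ν)) (X s) (T (s + ν)) (T s)
      have e4 : ‖X (s + ν) - X s‖ ^ α ≤ ν ^ α := Real.rpow_le_rpow (norm_nonneg _) e1 hα.le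
      have e5 : |T (s + ν) - T s| ^ β ≤ ν ^ β := Real.rpow_le_rpow (abs_nonneg _) e2 hβ.le
      have e6 := mul_le_mul_of_nonneg_left (add_le_add e4 e5) hK.le
      have e7 : xlast (P (s + ν)).1 - xlast (P s).1 =
          (g (X (s + ν)) (T (s + ν)) - g (X s) (T s)) + ν * (1 / 2 - h) := by
        simp only [hP, xlast_mkPt]; ring
      have e8 : |ν * (1 / 2 - h)| ≤ ν := by
        rw [abs_mul, abs_of_pos hν0]
        have : |1 / 2 - h| ≤ 1 := abs_le.2 ⟨by linarith, by linarith⟩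
        nlinarith
      rw [e7]
      have := abs_add_le (g (X (s + ν)) (T (s + ν)) - g (X s) (T s)) (ν * (1 / 2 - h))
      linarith
    · simp only [hP, hT]; nlinarith
    · simp only [hP, hT]; nlinarith
  have key : ∀ i : ℕ, i ≤ N → u (P 0) ≤ C ^ i * u (P (i * ν)) := by
    intro i
    induction i with
    | zero => intro _; simp
    | succ i ih =>
      intro hi
      refine (ih (by omega)).trans ?_
      have hi' : (i : ℝ) + 1 ≤ N := by exact_mod_cast hi
      have e1 : ((i : ℝ) + 1) * ν ≤ N * ν := mul_le_mul_of_nonneg_right hi' hν0.le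
      have e2 : (N : ℝ) * ν = 1 := by rw [hν]; field_simp
      have := hlink (i * ν) (by positivity) (by linarith)
      rw [pow_succ, mul_assoc]
      refine mul_le_mul_of_nonneg_left ?_ (by positivity)
      push_cast
      rwa [add_mul, one_mul]
  have hfin := key N le_rfl
  have e2 : (N : ℝ) * ν = 1 := by rw [hν]; field_simp
  rw [e2] at hfin
  have e3 : P 0 = (x, t) := by
    have : h + g (xprime x) t = xlast x := by rw [hh]; simp [hGamma]
    simp only [hP, hX, hT, sub_zero, one_smul, zero_mul, add_zero]
    rw [add_comm, this, mkPt_xprime_xlast]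
  have e4 : P 1 = Ebar g := by
    simp only [hP, hX, hT, Ebar, sub_self, zero_smul, one_mul, add_sub_cancel]
  rwa [e3, e4] at hfin

/-- Growth bound for a normalized positive solution near the graph. -/
lemma growth_bound (m : ℕ) {lam Lam K α : ℝ} (hl : 0 < lam) (hL : lam ≤ Lam) (hK : 0 < K)
    (hα : 0 < α) (hα1 : α < 1) :
    ∃ C : ℝ, 0 < C ∧ ∀ (g : Spc' m → ℝ → ℝ) (u : Spc m × ℝ → ℝ),
      HolderSemi α (α / (1 + α)) K g → PosSol lam Lam u (Cyl g 1) → u (Ebar g) = 1 →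
      ∀ x t, 0 < hGamma g (x, t) → hGamma g (x, t) ≤ 5 / 8 → ‖xprime x‖ ≤ 5 / 8 → |t| ≤ 3 / 8 →
      u (x, t) ≤ Real.exp (C * hGamma g (x, t) ^ (1 - 1 / α)) := by
  obtain ⟨A, hA, hA1⟩ := harnack_to_height m hl hL hK hα hα1
  obtain ⟨C, hC, hC1⟩ := harnack_to_Ebar m hl hL hK hα
  have hlog := Real.log_nonneg hC
  refine ⟨A + Real.log C + 1, by linarith, ?_⟩
  intro g u hg hu hE x t h0 h1 hx ht
  obtain ⟨x₁, t₁, g1, g2, g3, g4, g5, g6⟩ := hA1 g u hg hu x t h0 h1 hx ht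
  have h2 := hC1 g u hg hu x₁ t₁ g4 g5 g1 g2 g3
  rw [hE, mul_one] at h2
  have he : 1 - 1 / α ≤ 0 := by
    have : 1 ≤ 1 / α := by rw [le_div_iff₀ hα]; linarith
    linarith
  have h3 : 1 ≤ hGamma g (x, t) ^ (1 - 1 / α) :=
    Real.one_le_rpow_of_pos_of_le_one_of_nonpos h0 (by linarith) he
  set E := hGamma g (x, t) ^ (1 - 1 / α)
  calc u (x, t) ≤ Real.exp (A * E) * C :=
        g6.trans (mul_le_mul_of_nonneg_left h2 (Real.exp_pos _).le)
    _ = Real.exp (A * E + Real.log C) := by rw [Real.exp_add, Real.exp_log (by linarith)]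
    _ ≤ _ := by
      refine Real.exp_le_exp.2 ?_
      have := mul_le_mul_of_nonneg_left h3 hlog
      linarith

/-- The excess of `u` over the level `M`, extended by zero outside the cylinder `𝒞₁`. -/
def excess {m : ℕ} (g : Spc' m → ℝ → ℝ) (u : Spc m × ℝ → ℝ) (M : ℝ) (p : Spc m × ℝ) : ℝ :=
  if p ∈ Cyl g 1 then max (u p - M) 0 else 0

lemma excess_eventually_eq_zero {m : ℕ} {g : Spc' m → ℝ → ℝ} {u : Spc m × ℝ → ℝ} {M : ℝ}
    (hg : Continuous (fun q : Spc' m × ℝ => g q.1 q.2)) (hM : 0 < M)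
    (hv : VanishesOn u (Cyl g 1) (graphSet g)) {p : Spc m × ℝ} (hp : hGamma g p ≤ 0) :
    ∀ᶠ z in 𝓝 p, excess g u M z = 0 := by
  by_cases hc : p ∈ closure (Cyl g 1)
  · have h0 : 0 ≤ hGamma g p :=
      closure_minimal (t := {z | 0 ≤ hGamma g z}) (fun z hz => (mem_Cyl_iff.1 hz).2.2.1.le)
        (isClosed_le continuous_const (continuous_hGamma hg)) hc
    have hΓ : p ∈ graphSet g := by
      have := le_antisymm hp h0
      simp only [hGamma] at this
      simp only [graphSet, mem_ofPred_eq]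
      linarith
    have h1 := (hv p ⟨hΓ, hc⟩).eventually (gt_mem_nhds hM)
    filter_upwards [eventually_nhdsWithin_iff.1 h1] with z hz
    by_cases hzc : z ∈ Cyl g 1
    · have := hz hzc
      simp only [excess, if_pos hzc]
      exact max_eq_right (by linarith)
    · simp [excess, hzc]
  · filter_upwards [isClosed_closure.isOpen_compl.mem_nhds hc] with z hz
    have : z ∉ Cyl g 1 := fun h => hz (subset_closure h)
    simp [excess, this]

lemma continuousAt_excess {m : ℕ} {g : Spc' m → ℝ → ℝ} {u : Spc m × ℝ → ℝ} {M : ℝ}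
    (hg : Continuous (fun q : Spc' m × ℝ => g q.1 q.2)) (hM : 0 < M)
    (hv : VanishesOn u (Cyl g 1) (graphSet g)) (hu : ∀ p ∈ Cyl g 1, ContinuousAt u p)
    {p : Spc m × ℝ} (hp : p ∈ Cyl g 1 ∨ hGamma g p ≤ 0) : ContinuousAt (excess g u M) p := by
  rcases hp with hp | hp
  · have h1 : ContinuousAt (fun z => max (u z - M) 0) p :=
      ((hu p hp).sub continuousAt_const).max continuousAt_const
    refine h1.congr ?_
    filter_upwards [(isOpen_Cyl hg 1).mem_nhds hp] with z hz
    simp [excess, hz]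
  · have h1 : ContinuousAt (fun _ : Spc m × ℝ => (0 : ℝ)) p := continuousAt_const
    refine h1.congr ?_
    filter_upwards [excess_eventually_eq_zero hg hM hv hp] with z hz
    exact hz.symm

lemma supAt_neg_excess {m : ℕ} {lam Lam : ℝ} (hL : lam ≤ Lam) {g : Spc' m → ℝ → ℝ}
    {u : Spc m × ℝ → ℝ} {M : ℝ}
    (hg : Continuous (fun q : Spc' m × ℝ => g q.1 q.2))
    (hu : ∀ p ∈ Cyl g 1, SupAt lam Lam (fun z => -u z) p)
    (p : Spc m × ℝ) : SupAt lam Lam (fun z => -excess g u M z) p := by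
  by_cases h0 : excess g u M p = 0
  · refine (SupAt.const hL 0 p).mono (by simp [h0]) (Eventually.of_forall fun z => ?_)
    simp only [excess]
    split_ifs <;> simp
  · have hp : p ∈ Cyl g 1 := by
      by_contra hc
      exact h0 (by simp [excess, hc])
    refine ((hu p hp).affine one_pos M).mono ?_ ?_
    · simp only [excess, if_pos hp] at h0 ⊢
      rcases max_choice (u p - M) 0 with h | h
      · rw [h]; ring
      · exact absurd h h0
    · filter_upwards [(isOpen_Cyl hg 1).mem_nhds hp] with z hz
      simp only [excess, if_pos hz]
      have := le_max_left (u z - M) 0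
      linarith

lemma hGamma_add_vertical {m : ℕ} (g : Spc' m → ℝ → ℝ) (x : Spc m) (t s : ℝ) :
    hGamma g (x + s • eVec m (Fin.last m), t) = hGamma g (x, t) + s := by
  have h1 : xprime (x + s • eVec m (Fin.last m)) = xprime x := by
    ext i
    simp [xprime, eVec]
  have h2 : xlast (x + s • eVec m (Fin.last m)) = xlast x + s := by
    simp [xlast, eVec]
  simp only [hGamma, h1, h2]
  ring

/-- A strip of height `ρ` above the graph occupies at most a fraction `1 / N` of a cylinder of
size `N * ρ`, up to a dimensional constant. -/
lemma volume_strip_le {m : ℕ} {g : Spc' m → ℝ → ℝ}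
    (hg : Continuous (fun q : Spc' m × ℝ => g q.1 q.2)) (P : Spc m × ℝ) {ρ : ℝ} (hρ : 0 < ρ)
    {N : ℕ} (hN : 0 < N) :
    N * volume {z | z ∈ Metric.ball P.1 (N * ρ) ×ˢ Ioc (P.2 - (N * ρ) ^ 2) P.2 ∧
        0 < hGamma g z ∧ hGamma g z < ρ} ≤
      ENNReal.ofReal (2 ^ (m + 2) * (N * ρ) ^ (m + 3)) * unitVol m := by
  set E := {z | z ∈ Metric.ball P.1 (N * ρ) ×ˢ Ioc (P.2 - (N * ρ) ^ 2) P.2 ∧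
        0 < hGamma g z ∧ hGamma g z < ρ} with hE
  have hN' : (0 : ℝ) < N := by exact_mod_cast hN
  have hcont := continuous_hGamma hg
  have hEm : MeasurableSet E := by
    have e : E = (Metric.ball P.1 (N * ρ) ×ˢ Ioc (P.2 - (N * ρ) ^ 2) P.2) ∩
        ({z | 0 < hGamma g z} ∩ {z | hGamma g z < ρ}) := rfl
    rw [e]
    exact (Metric.isOpen_ball.measurableSet.prod measurableSet_Ioc).inter
      ((isOpen_lt continuous_const hcont).measurableSet.inter
        (isOpen_lt hcont continuous_const).measurableSet)
  set τ : ℕ → Spc m × ℝ := fun k => (-((k : ℝ) * ρ) • eVec m (Fin.last m), 0) with hτ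
  set F : ℕ → Set (Spc m × ℝ) := fun k => (fun z => τ k + z) ⁻¹' E with hF
  have hshift : ∀ k z, hGamma g (τ k + z) = hGamma g z - k * ρ := by
    intro k z
    have : τ k + z = (z.1 + (-((k : ℝ) * ρ)) • eVec m (Fin.last m), z.2) := by
      refine Prod.ext ?_ ?_
      · simp only [hτ, Prod.fst_add]; exact add_comm _ _
      · simp [hτ]
    rw [this, hGamma_add_vertical]
    ring
  have hFm : ∀ k ∈ Finset.range N, MeasurableSet (F k) := fun k _ =>
    hEm.preimage (measurable_const_add (τ k))
  have hvol : ∀ k, volume (F k) = volume E := by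
    intro k
    rw [hF, Measure.volume_eq_prod]
    exact measure_preimage_add _ _ _
  have hdisj : Set.PairwiseDisjoint (Finset.range N : Set ℕ) F := by
    intro k _ l _ hkl
    refine Set.disjoint_left.2 fun z hz hz' => hkl ?_
    obtain ⟨_, h1, h2⟩ := hz
    obtain ⟨_, h3, h4⟩ := hz'
    rw [hshift] at h1 h2 h3 h4
    rcases lt_trichotomy k l with h | h | h
    · have : (k : ℝ) + 1 ≤ l := by exact_mod_cast h
      nlinarith
    · exact h
    · have : (l : ℝ) + 1 ≤ k := by exact_mod_cast h
      nlinarith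
  have hsub : (⋃ k ∈ Finset.range N, F k) ⊆
      Metric.ball P.1 (2 * (N * ρ)) ×ˢ Ioo (P.2 - (N * ρ) ^ 2) (P.2 + (N * ρ) ^ 2) := by
    refine iUnion₂_subset fun k hk z hz => ?_
    obtain ⟨⟨h1, h2⟩, -⟩ := hz
    have hk' : (k : ℝ) < N := by exact_mod_cast Finset.mem_range.1 hk
    have hpos : 0 < (N * ρ) ^ 2 := by positivity
    simp only [hτ, Prod.snd_add, zero_add] at h2
    refine ⟨?_, h2.1, by linarith [h2.2]⟩
    rw [Metric.mem_ball, dist_eq_norm] at h1 ⊢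
    have e : z.1 - P.1 = ((τ k + z).1 - P.1) + ((k : ℝ) * ρ) • eVec m (Fin.last m) := by
      simp only [hτ, Prod.fst_add]
      module
    rw [e]
    refine (norm_add_le _ _).trans_lt ?_
    have : ‖((k : ℝ) * ρ) • eVec m (Fin.last m)‖ = k * ρ := by
      rw [norm_smul, Real.norm_of_nonneg (by positivity)]
      simp [eVec]
    rw [this]
    have := mul_lt_mul_of_pos_right hk' hρ
    linarith
  calc (N : ENNReal) * volume E = ∑ k ∈ Finset.range N, volume (F k) := by
        simp [hvol]
    _ = volume (⋃ k ∈ Finset.range N, F k) := (measure_biUnion_finset hdisj hFm).symm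
    _ ≤ _ := measure_mono hsub
    _ = _ := by
      rw [volume_ball_prod_Ioo _ (by positivity)]
      congr 2
      ring

/-- A subsolution supported in a thin strip above the graph is halved when moving into the
interior by a fixed multiple of the width of the strip. -/
lemma strip_halving (m : ℕ) {lam Lam : ℝ} (hl : 0 < lam) (hL : lam ≤ Lam) :
    ∃ N : ℕ, 0 < N ∧ ∀ g : Spc' m → ℝ → ℝ, Continuous (fun q : Spc' m × ℝ => g q.1 q.2) →
      ∀ (v : Spc m × ℝ → ℝ) (P : Spc m × ℝ) (ρ S : ℝ), 0 < ρ → 0 < S →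
      (∀ z ∈ Metric.closedBall P.1 (N * ρ) ×ˢ Icc (P.2 - (N * ρ) ^ 2) P.2,
        ContinuousAt v z ∧ SupAt lam Lam (fun z => -v z) z ∧
        (0 < v z → 0 < hGamma g z ∧ hGamma g z < ρ) ∧ v z ≤ S) → v P ≤ S / 2 := by
  obtain ⟨ε, hε, hsm⟩ := small_measure m hl hL (κ := 1 / 2) (by norm_num) (by norm_num)
  obtain ⟨N, hN⟩ := exists_nat_gt (2 ^ (m + 2) * (unitVol m).toReal / ε)
  have hV : 0 ≤ 2 ^ (m + 2) * (unitVol m).toReal / ε := by positivity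
  have hN0' : (0 : ℝ) < N := hV.trans_lt hN
  have hN0 : 0 < N := by exact_mod_cast hN0'
  refine ⟨N, hN0, ?_⟩
  intro g hg v P ρ S hρ hS h
  have hsub : Metric.ball P.1 (N * ρ) ×ˢ Ioc (P.2 - (N * ρ) ^ 2) P.2 ⊆
      Metric.closedBall P.1 (N * ρ) ×ˢ Icc (P.2 - (N * ρ) ^ 2) P.2 :=
    prod_mono Metric.ball_subset_closedBall Ioc_subset_Icc_self
  have key := hsm (fun z => S - v z) P (N * ρ) S (by positivity) hS
    (fun z hz => (continuousAt_const.sub (h z hz).1).continuousWithinAt)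
    (fun z hz => by linarith [(h z hz).2.2.2])
    (fun z hz => by
      have := ((h z (hsub hz)).2.1).affine one_pos S
      simpa [sub_eq_add_neg, add_comm] using this) ?_
  · linarith
  · have h1 := volume_strip_le hg P hρ hN0
    have hmono : volume {z | z ∈ Metric.ball P.1 (N * ρ) ×ˢ Ioc (P.2 - (N * ρ) ^ 2) P.2 ∧
        S - v z < S} ≤ volume {z | z ∈ Metric.ball P.1 (N * ρ) ×ˢ
          Ioc (P.2 - (N * ρ) ^ 2) P.2 ∧ 0 < hGamma g z ∧ hGamma g z < ρ} :=
      measure_mono fun z hz => ⟨hz.1, (h z (hsub hz.1)).2.2.1 (by linarith [hz.2])⟩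
    refine hmono.trans ?_
    have hNE : (N : ENNReal) ≠ 0 := by exact_mod_cast hN0.ne'
    refine (ENNReal.mul_le_mul_iff_right hNE (ENNReal.natCast_ne_top N)).1 (h1.trans ?_)
    have e1 : unitVol m = ENNReal.ofReal (unitVol m).toReal :=
      (ENNReal.ofReal_toReal (unitVol_lt_top m).ne).symm
    rw [e1, ← ENNReal.ofReal_natCast N, ← ENNReal.ofReal_mul (by positivity),
      ← ENNReal.ofReal_mul (by positivity)]
    refine ENNReal.ofReal_le_ofReal ?_
    rw [div_lt_iff₀ hε] at hN
    have hp : 0 ≤ (N * ρ) ^ (m + 3) := by positivity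
    have := mul_le_mul_of_nonneg_right hN.le hp
    linarith

/-- Iterated decay of a subsolution supported in a thin strip above the graph. -/
lemma strip_decay (m : ℕ) {lam Lam : ℝ} (hl : 0 < lam) (hL : lam ≤ Lam) :
    ∃ N : ℕ, 0 < N ∧ ∀ g : Spc' m → ℝ → ℝ, Continuous (fun q : Spc' m × ℝ => g q.1 q.2) →
      ∀ (v : Spc m × ℝ → ℝ) (ρ S : ℝ), 0 < ρ → 0 < S → ∀ (j : ℕ) (P : Spc m × ℝ),
      (∀ z : Spc m × ℝ, ‖z.1 - P.1‖ ≤ j * (N * ρ) → P.2 - j * (N * ρ) ^ 2 ≤ z.2 → z.2 ≤ P.2 →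
        ContinuousAt v z ∧ SupAt lam Lam (fun z => -v z) z ∧
        (0 < v z → 0 < hGamma g z ∧ hGamma g z < ρ) ∧ v z ≤ S) → v P ≤ S / 2 ^ j := by
  obtain ⟨N, hN, hhalf⟩ := strip_halving m hl hL
  refine ⟨N, hN, ?_⟩
  intro g hg v ρ S hρ hS j
  induction j with
  | zero =>
    intro P h
    simpa using (h P (by simp) (by simp) le_rfl).2.2.2
  | succ j ih =>
    intro P h
    push_cast at h
    have hb : (0 : ℝ) ≤ j * (N * ρ) := by positivity
    have hb' : (0 : ℝ) ≤ j * (N * ρ) ^ 2 := by positivity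
    have := hhalf g hg v P ρ (S / 2 ^ j) hρ (by positivity) ?_
    · rw [pow_succ, ← div_div]; exact this
    rintro z ⟨hz1, hz2, hz3⟩
    rw [Metric.mem_closedBall, dist_eq_norm] at hz1
    obtain ⟨a1, a2, a3, -⟩ := h z (by linarith) (by linarith) hz3
    refine ⟨a1, a2, a3, ih z fun q hq1 hq2 hq3 => h q ?_ (by linarith) (by linarith)⟩
    have := norm_sub_le_norm_sub_add_norm_sub q.1 z.1 P.1
    linarith

/-- The number of halving steps that fit into a cylinder of size `r` suffices to beat the growth
of the solution. -/
lemma exists_decay_steps {N : ℕ} (hN : 0 < N) {C β γ : ℝ} (hC : 0 < C) (hβ : 1 ≤ β)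
    (hγ : γ ≤ 0) (hβγ : γ = 2 - β) :
    ∃ r₀ : ℝ, 0 < r₀ ∧ ∀ r : ℝ, 0 < r → r ≤ r₀ → r ≤ 1 → ∃ j : ℕ,
      j * (N * r ^ β) ≤ r / 2 ∧ j * (N * r ^ β) ^ 2 ≤ r / 2 ∧
      Real.exp (C * (r / 2) ^ γ) ≤ 2 ^ j := by
  have hN' : (0 : ℝ) < N := by exact_mod_cast hN
  set D := 2 * C * (1 / 2) ^ γ with hD
  have hDp : 0 < D := by positivity
  refine ⟨1 / (2 * N * (D + 1)), by positivity, ?_⟩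
  intro r hr hr0 hr1
  rw [le_div_iff₀ (by positivity)] at hr0
  have hρ : 0 < r ^ β := Real.rpow_pos_of_pos hr _
  have hρr : r ^ β ≤ r := by
    simpa using Real.rpow_le_rpow_of_exponent_ge hr hr1 hβ
  have hγ1 : 1 ≤ r ^ γ := Real.one_le_rpow_of_pos_of_le_one_of_nonpos hr hr1 hγ
  have hrel : r ^ γ * r ^ β = r ^ 2 := by
    rw [← Real.rpow_add hr, hβγ]
    norm_num
  set j := ⌊r / (2 * (N * r ^ β))⌋₊ with hj
  have hj1 : (j : ℝ) ≤ r / (2 * (N * r ^ β)) := Nat.floor_le (by positivity)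
  have hj2 : r / (2 * (N * r ^ β)) < j + 1 := Nat.lt_floor_add_one _
  rw [le_div_iff₀ (by positivity)] at hj1
  have hNρ : N * r ^ β ≤ 1 := by
    have h1 := mul_le_mul_of_nonneg_left hρr hN'.le
    have h2 : 0 < r * N * D := by positivity
    have h3 : 0 < r * N := by positivity
    nlinarith
  have hNρ0 : 0 < N * r ^ β := by positivity
  have hjr : j * (N * r ^ β) ≤ r / 2 := by linarith
  refine ⟨j, hjr, ?_, ?_⟩
  · have : (j : ℝ) * (N * r ^ β) * (N * r ^ β) ≤ j * (N * r ^ β) * 1 :=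
      mul_le_mul_of_nonneg_left hNρ (by positivity)
    calc (j : ℝ) * (N * r ^ β) ^ 2 = j * (N * r ^ β) * (N * r ^ β) := by ring
      _ ≤ _ := by linarith
  · have hbig : D * r ^ γ + 1 ≤ j + 1 := by
      refine le_trans ?_ hj2.le
      rw [le_div_iff₀ (by positivity)]
      have e1 : (D * r ^ γ + 1) * (2 * (N * r ^ β)) ≤
          (D * r ^ γ + r ^ γ) * (2 * (N * r ^ β)) := by gcongr
      have e2 : (D * r ^ γ + r ^ γ) * (2 * (N * r ^ β)) = (r * (2 * N * (D + 1))) * r := by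
        calc _ = (D + 1) * 2 * N * (r ^ γ * r ^ β) := by ring
          _ = _ := by rw [hrel]; ring
      have e3 : (r * (2 * N * (D + 1))) * r ≤ 1 * r := by gcongr
      linarith
    have hl2 : (1 / 2 : ℝ) ≤ Real.log 2 := by linarith [Real.log_two_gt_d9]
    have e4 : C * (r / 2) ^ γ = D * r ^ γ / 2 := by
      rw [div_eq_mul_one_div r 2, Real.mul_rpow hr.le (by norm_num), hD]
      ring
    have hjD : D * r ^ γ ≤ j := by linarith
    have e5 : D * r ^ γ / 2 ≤ j * Real.log 2 := by
      have : (j : ℝ) * (1 / 2) ≤ j * Real.log 2 := by gcongr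
      linarith
    calc Real.exp (C * (r / 2) ^ γ) ≤ Real.exp (j * Real.log 2) := by
          rw [e4]; exact Real.exp_le_exp.2 e5
      _ = 2 ^ j := by
          rw [Real.exp_nat_mul, Real.exp_log (by norm_num)]

end

/-- **Propagation of largeness toward the boundary** (claim in the proof of
Lemma 3.2). -/
theorem propagation_of_largeness (m : ℕ) (hm : 1 ≤ m) (lam Lam K α : ℝ)
    (hlam : 0 < lam) (hlamLam : lam ≤ Lam) (hK : 0 < K)
    (hα : 1 / 2 < α) (hα1 : α < 1) :
    ∃ C₀ β r₀ : ℝ, 0 < C₀ ∧ 1 < β ∧ 0 < r₀ ∧ r₀ < 1 ∧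
      ∀ (A : Spc m → Matrix (Fin (m + 1)) (Fin (m + 1)) ℝ), IsElliptic lam Lam A →
      ∀ g : Spc' m → ℝ → ℝ,
        Continuous (fun q : Spc' m × ℝ => g q.1 q.2) → g 0 0 = 0 →
        HolderSemi α (α / (1 + α)) K g →
      ∀ u : Spc m × ℝ → ℝ,
        SolvesL A u (Cyl g 1) →
        (∀ p ∈ Cyl g 1, 0 < u p) →
        VanishesOn u (Cyl g 1) (graphSet g) →
        u (Ebar g) = 1 →
        ∀ r : ℝ, 0 < r → r ≤ r₀ →
        ∀ y : Spc m, ∀ ty : ℝ, (y, ty) ∈ Cyl g (1 / 2) →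
          Real.exp (C₀ * r ^ (β * (1 - 1 / α))) ≤ u (y, ty) →
          ∃ z : Spc m, ∃ tz : ℝ,
            (∀ i : Fin m, -r < xprime z i - xprime y i ∧ xprime z i - xprime y i < r) ∧
            ty - r < tz ∧ tz ≤ ty ∧
            0 < hGamma g (z, tz) ∧ hGamma g (z, tz) < r ^ β ∧
            Real.exp (C₀ * (r / 2) ^ (β * (1 - 1 / α))) ≤ u (z, tz) := by
  have hα0 : 0 < α := by linarith
  obtain ⟨C, hC, hgrowth⟩ := growth_bound m hlam hlamLam hK hα0 hα1
  obtain ⟨N, hN, hdecay⟩ := strip_decay m hlam hlamLam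
  have hinv1 : 1 < 1 / α := by rw [lt_div_iff₀ hα0]; linarith
  have hinv2 : 1 / α < 2 := by rw [div_lt_iff₀ hα0]; linarith
  set β := 2 / (2 - 1 / α) with hβ
  have hβ2 : 2 < β := by rw [hβ, lt_div_iff₀ (by linarith)]; linarith
  have hγ : β * (1 - 1 / α) = 2 - β := by
    have : β * (2 - 1 / α) = 2 := div_mul_cancel₀ _ (by linarith)
    linarith
  have hγ0 : β * (1 - 1 / α) ≤ 0 := by linarith
  obtain ⟨r₁, hr₁, hsteps⟩ := exists_decay_steps hN (C := C + 1) (by linarith)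
    (by linarith : 1 ≤ β) hγ0 hγ
  have hα' : 0 < α / (1 + α) := by positivity
  obtain ⟨d, hd, hmod⟩ := exists_modulus_lt hα0 hα' K 1 (ε := 1 / 8) (by norm_num)
  refine ⟨C + 1, β, min (min r₁ d) (1 / 8), by linarith, by linarith, by positivity,
    (min_le_right _ _).trans_lt (by norm_num), ?_⟩
  intro A hA g hg _ hgH u hu hpos hvan hE r hr hr0 y ty hy hlarge
  have hrr₁ : r ≤ r₁ := hr0.trans ((min_le_left _ _).trans (min_le_left _ _))
  have hrd : r ≤ d := hr0.trans ((min_le_left _ _).trans (min_le_right _ _))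
  have hr8 : r ≤ 1 / 8 := hr0.trans (min_le_right _ _)
  obtain ⟨j, hj1, hj2, hj3⟩ := hsteps r hr hrr₁ (by linarith)
  by_contra! hcon
  set γ := β * (1 - 1 / α) with hγd
  set ρ := r ^ β with hρd
  have hρ : 0 < ρ := Real.rpow_pos_of_pos hr _
  have hcontu := SolvesL.continuousOn hlam hlamLam hA (isOpen_Cyl hg 1) hu hpos
  have hneg : ∀ p ∈ Cyl g 1, SupAt lam Lam (fun z => -u z) p := fun p hp =>
    (SolvesL.neg hu).supAt hA hp
  have hsol : PosSol lam Lam u (Cyl g 1) :=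
    ⟨⟨fun p hp => (hcontu p hp).continuousWithinAt, fun p hp => (hpos p hp).le,
      fun p hp => hu.supAt hA hp⟩, hneg⟩
  set M := Real.exp (C * r ^ γ) with hM
  have hMpos : 0 < M := Real.exp_pos _
  set S := Real.exp ((C + 1) * (r / 2) ^ γ) with hS
  have hSpos : 0 < S := Real.exp_pos _
  rw [mem_Cyl_iff] at hy
  obtain ⟨hy1, hy2, hy3, hy4⟩ := hy
  simp only at hy1 hy2
  have hy2' : |ty| < 1 / 4 := by linarith
  have hyC : (y, ty) ∈ Cyl g 1 := by
    rw [mem_Cyl_iff]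
    exact ⟨by simp only; linarith, by simp only; linarith, hy3, by linarith⟩
  have hfin : excess g u M (y, ty) ≤ S / 2 ^ j := by
    refine hdecay g hg (excess g u M) ρ S hρ hSpos j (y, ty) ?_
    rintro ⟨x, t⟩ hx ht1 ht2
    simp only at hx ht1 ht2
    have hx2 : ‖x - y‖ ≤ r / 2 := hx.trans hj1
    have ht3 : |t - ty| ≤ r := by rw [abs_le]; constructor <;> linarith
    have hh := abs_hGamma_sub_le hα0.le hα'.le hK.le hgH (z := (x, t)) (w := (y, ty))
      (a := r) (b := r) (by simp only; linarith) ht3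
    have hm1 := hmod r hr.le hrd
    have hhx : hGamma g (x, t) < 5 / 8 := by linarith [(abs_le.1 hh).2]
    have hxp : ‖xprime x‖ ≤ 5 / 8 := by
      have h1 := norm_xprime_le (x - y)
      rw [xprime_sub] at h1
      have h2 := norm_le_norm_add_norm_sub' (xprime x) (xprime y)
      linarith
    have htt : |t| ≤ 3 / 8 := by
      have := abs_sub_abs_le_abs_sub t ty
      linarith
    have hmem : 0 < hGamma g (x, t) → (x, t) ∈ Cyl g 1 := fun h0 => by
      rw [mem_Cyl_iff]
      exact ⟨by simp only; linarith, by simp only; linarith, h0, by linarith⟩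
    have hsupp : 0 < excess g u M (x, t) → 0 < hGamma g (x, t) ∧ hGamma g (x, t) < ρ := by
      intro hv
      have hc : (x, t) ∈ Cyl g 1 := by
        by_contra hc
        simp [excess, hc] at hv
      have h0 := (mem_Cyl_iff.1 hc).2.2.1
      refine ⟨h0, ?_⟩
      by_contra! hle
      have h1 := hgrowth g u hgH hsol hE x t h0 hhx.le hxp htt
      have h2 : hGamma g (x, t) ^ (1 - 1 / α) ≤ r ^ γ := by
        rw [hγd, Real.rpow_mul hr.le]
        exact Real.rpow_le_rpow_of_nonpos hρ hle (by linarith)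
      have h3 : u (x, t) ≤ M :=
        h1.trans (Real.exp_le_exp.2 (mul_le_mul_of_nonneg_left h2 hC.le))
      simp only [excess, if_pos hc, lt_max_iff, lt_irrefl, or_false] at hv
      linarith
    refine ⟨continuousAt_excess hg hMpos hvan hcontu ?_,
      supAt_neg_excess hlamLam hg hneg _, hsupp, ?_⟩
    · rcases lt_or_ge 0 (hGamma g (x, t)) with h | h
      · exact Or.inl (hmem h)
      · exact Or.inr h
    · rcases le_or_gt (excess g u M (x, t)) 0 with h | h
      · exact h.trans hSpos.le
      · obtain ⟨h0, h1⟩ := hsupp h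
        have hlt := hcon x t (fun i => ?_) (by linarith) ht2 h0 h1
        · simp only [excess, if_pos (hmem h0)]
          exact max_le (by linarith) hSpos.le
        · have e1 := norm_xprime_le (x - y)
          rw [xprime_sub] at e1
          have e2 := PiLp.norm_apply_le (xprime x - xprime y) i
          rw [PiLp.sub_apply, Real.norm_eq_abs] at e2
          have e3 : |xprime x i - xprime y i| < r := by linarith
          exact abs_lt.1 e3
  have hle1 : S / 2 ^ j ≤ 1 := (div_le_one (by positivity)).2 hj3
  simp only [excess, if_pos hyC] at hfin
  have h1 := le_max_left (u (y, ty) - M) 0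
  have hγ1 : 1 ≤ r ^ γ := Real.one_le_rpow_of_pos_of_le_one_of_nonpos hr (by linarith) hγ0
  have hM1 : 1 ≤ M := Real.one_le_exp (by positivity)
  have h2 : M * 2 < u (y, ty) := by
    refine lt_of_lt_of_le ?_ hlarge
    rw [add_mul, one_mul, Real.exp_add]
    refine mul_lt_mul_of_pos_left ?_ hMpos
    have := Real.add_one_lt_exp (show r ^ γ ≠ 0 by linarith)
    linarith
  linarith
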